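/- Good-box probability: there exists a constant c > 0 such that for every edge e and every integer 1 ≤ N ≤ exp(c log² n), P( Λ_{3N}(e) is good ) ≥ 1 − c⁻¹ exp(−c N). -/

import Mathlib

open MeasureTheory
open scoped ENNReal NNReal

attribute [local instance] Classical.propDecidable

noncomputable section

namespace Perco

/-- Vertices of the lattice `ℤ^d`. -/
abbrev ZVec (d : ℕ) := Fin d → ℤ

/-- The `ℓ¹` norm of a lattice point (as a natural number). -/
def norm1 (d : ℕ) (x : ZVec d) : ℕ := ∑ i, (x i).natAbs

/-- The `ℓ∞` norm of a lattice point (as a natural number). -/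
def normInf (d : ℕ) (x : ZVec d) : ℕ := Finset.univ.sup fun i => (x i).natAbs

/-- Nearest-neighbour edges of `ℤ^d`, each written `(x_e, y_e)` with `‖x_e‖₁ < ‖y_e‖₁`. -/
def EdgeD (d : ℕ) := {e : ZVec d × ZVec d // norm1 d (e.1 - e.2) = 1 ∧ norm1 d e.1 < norm1 d e.2}

/-- A percolation configuration: each edge is open (`true`) or closed (`false`). -/
abbrev Config (d : ℕ) := EdgeD d → Bool

/-- Adjacency in `ℤ^d`. -/
def Adj (d : ℕ) (x y : ZVec d) : Prop := norm1 d (x - y) = 1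

/-- A (self-avoiding, nearest-neighbour) path, recorded as its list of vertices. -/
def IsPath (d : ℕ) (γ : List (ZVec d)) : Prop :=
  γ ≠ [] ∧ γ.Nodup ∧ γ.Chain' (Adj d)

/-- The (unordered) edge `{x,y}` is open in the configuration `ω`. -/
def EdgeOpen (d : ℕ) (ω : Config d) (x y : ZVec d) : Prop :=
  ∃ e : EdgeD d, (e.val = (x, y) ∨ e.val = (y, x)) ∧ ω e = true

/-- All edges of the path are open. -/
def IsOpenPath (d : ℕ) (ω : Config d) (γ : List (ZVec d)) : Prop :=
  γ.Chain' (EdgeOpen d ω)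

/-- The (unordered) edge `{x,y}` is an edge of the path `γ`. -/
def edgeMemPath (d : ℕ) (x y : ZVec d) (γ : List (ZVec d)) : Prop :=
  (x, y) ∈ γ.zip γ.tail ∨ (y, x) ∈ γ.zip γ.tail

/-- Truncated FPP weight of the edge `{x,y}`: `1` if open, `log² n` if closed. -/
def pairWeight (d n : ℕ) (ω : Config d) (x y : ZVec d) : ℝ :=
  if EdgeOpen d ω x y then 1 else (Real.log n) ^ 2

/-- Total truncated weight of a path. -/
def pathCost (d n : ℕ) (ω : Config d) : List (ZVec d) → ℝ
  | [] => 0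
  | [_] => 0
  | x :: y :: rest => pairWeight d n ω x y + pathCost d n ω (y :: rest)

/-- Truncated first-passage time between `x` and `y`. -/
def passageTime (d n : ℕ) (ω : Config d) (x y : ZVec d) : ℝ :=
  sInf {c : ℝ | ∃ γ : List (ZVec d), IsPath d γ ∧ γ.head? = some x ∧
    γ.getLast? = some y ∧ pathCost d n ω γ = c}

/-- Chemical distance between `x` and `y` using only open paths inside `U`. -/
def chemDistIn (d : ℕ) (ω : Config d) (U : Set (ZVec d)) (x y : ZVec d) : ℕ∞ :=
  sInf {k : ℕ∞ | ∃ γ : List (ZVec d), IsPath d γ ∧ IsOpenPath d ω γ ∧ (∀ v ∈ γ, v ∈ U) ∧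
    γ.head? = some x ∧ γ.getLast? = some y ∧ ((γ.length - 1 : ℕ) : ℕ∞) = k}

/-- Chemical distance in the whole lattice. -/
def chemDist (d : ℕ) (ω : Config d) (x y : ZVec d) : ℕ∞ := chemDistIn d ω Set.univ x y

/-- `x` belongs to an infinite open cluster. -/
def InInfCluster (d : ℕ) (ω : Config d) (x : ZVec d) : Prop :=
  {y | chemDist d ω x y ≠ ⊤}.Infinite

/-- `x*`: a point of the infinite cluster at minimal `ℓ∞`-distance from `x`
(deterministic tie-breaking via choice); `x` itself if there is no infinite cluster. -/
def starPt (d : ℕ) (ω : Config d) (x : ZVec d) : ZVec d :=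
  if h : ∃ y, InInfCluster d ω y ∧ ∀ z, InInfCluster d ω z →
      normInf d (y - x) ≤ normInf d (z - x)
  then h.choose else x

/-- `μ` is the Bernoulli(p) bond-percolation product measure on configurations. -/
def IsBernoulli (d : ℕ) (p : ℝ) (μ : Measure (Config d)) : Prop :=
  IsProbabilityMeasure μ ∧
  ∀ (s : Finset (EdgeD d)) (f : EdgeD d → Bool),
    μ {ω | ∀ e ∈ s, ω e = f e} = ∏ e ∈ s, ENNReal.ofReal (if f e then p else 1 - p)

/-- The critical parameter of Bernoulli bond percolation on `ℤ^d`. -/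
def pc (d : ℕ) : ℝ :=
  sSup {p : ℝ | 0 ≤ p ∧ p ≤ 1 ∧ ∀ μ : Measure (Config d), IsBernoulli d p μ →
    μ {ω | ∃ x, InInfCluster d ω x} = 0}

/-- The point `n·e₁`. -/
def ptE1 (d n : ℕ) : ZVec d := fun i => if (i : ℕ) = 0 then (n : ℤ) else 0

/-- `D*_n = D(0*, (n e₁)*)`, as a real number. -/
def DstarR (d n : ℕ) (ω : Config d) : ℝ :=
  ((chemDist d ω (starPt d ω 0) (starPt d ω (ptE1 d n))).toNat : ℝ)

/-- `T_n = T(0, n e₁)`, the truncated passage time. -/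
def TnR (d n : ℕ) (ω : Config d) : ℝ := passageTime d n ω 0 (ptE1 d n)

/-- The box `Λ_t(z)` with integer radius. -/
def boxZ (d : ℕ) (t : ℕ) (z : ZVec d) : Set (ZVec d) := {y | normInf d (y - z) ≤ t}

/-- The box `Λ_t(z)` with real radius. -/
def boxR (d : ℕ) (t : ℝ) (z : ZVec d) : Set (ZVec d) := {y | (normInf d (y - z) : ℝ) ≤ t}

/-- The annulus `A_N(e) = Λ_{3N}(e) \ Λ_N(e)`. -/
def annulus (d : ℕ) (N : ℕ) (e : EdgeD d) : Set (ZVec d) :=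
  {y | normInf d (y - e.val.1) ≤ 3 * N ∧ N < normInf d (y - e.val.1)}

/-- `π` is a geodesic of the truncated passage time between its endpoints, inside `A`. -/
def IsGeodesicIn (d n : ℕ) (ω : Config d) (A : Set (ZVec d)) (π : List (ZVec d)) : Prop :=
  IsPath d π ∧ (∀ v ∈ π, v ∈ A) ∧
  ∀ π' : List (ZVec d), IsPath d π' → (∀ v ∈ π', v ∈ A) →
    π'.head? = π.head? → π'.getLast? = π.getLast? →
    pathCost d n ω π ≤ pathCost d n ω π'

/-- `γ ∈ 𝔾_*(A)`: a path in `A` obtained from some geodesic in `A` by replacing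
segments by open paths (all edges of `γ` not on the geodesic are open). -/
def GstarIn (d n : ℕ) (ω : Config d) (A : Set (ZVec d)) (γ : List (ZVec d)) : Prop :=
  IsPath d γ ∧ (∀ v ∈ γ, v ∈ A) ∧
  ∃ π : List (ZVec d), IsGeodesicIn d n ω A π ∧
    ∀ x y, edgeMemPath d x y γ → ¬ edgeMemPath d x y π → EdgeOpen d ω x y

/-- `γ` is a crossing path of the annulus `A_N(e)`. -/
def IsCrossing (d : ℕ) (N : ℕ) (e : EdgeD d) (γ : List (ZVec d)) : Prop :=
  IsPath d γ ∧ (∀ v ∈ γ, v ∈ annulus d N e) ∧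
  (∃ v ∈ γ, normInf d (v - e.val.1) = N + 1) ∧ (∃ v ∈ γ, normInf d (v - e.val.1) = 3 * N)

/-- The event `𝒱¹_N(e)`: any two modified geodesics crossing `A_N(e)` are linked by an
open path inside `A_N(e)` of length at most `C_* N`. -/
def V1 (d : ℕ) (Cstar : ℝ) (n : ℕ) (e : EdgeD d) (N : ℕ) (ω : Config d) : Prop :=
  ∀ γ1 γ2 : List (ZVec d),
    GstarIn d n ω (boxR d (Cstar * N) e.val.1) γ1 → IsCrossing d N e γ1 →
    GstarIn d n ω (boxR d (Cstar * N) e.val.1) γ2 → IsCrossing d N e γ2 →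
    ∃ π : List (ZVec d), IsPath d π ∧ IsOpenPath d ω π ∧ (∀ v ∈ π, v ∈ annulus d N e) ∧
      (∃ u, π.head? = some u ∧ u ∈ γ1) ∧ (∃ v, π.getLast? = some v ∧ v ∈ γ2) ∧
      ((π.length : ℝ) - 1 ≤ Cstar * N)

/-- The event `𝒱²_N(e)`: points of `Λ_{3N}(e)` openly connected inside `Λ_{3N}(e)` are
connected inside `Λ_{4N}(e)` by an open path of length at most `C_* N`. -/
def V2 (d : ℕ) (Cstar : ℝ) (e : EdgeD d) (N : ℕ) (ω : Config d) : Prop :=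
  ∀ x y : ZVec d, x ∈ boxZ d (3 * N) e.val.1 → y ∈ boxZ d (3 * N) e.val.1 →
    (∃ γ, IsPath d γ ∧ IsOpenPath d ω γ ∧ (∀ v ∈ γ, v ∈ boxZ d (3 * N) e.val.1) ∧
      γ.head? = some x ∧ γ.getLast? = some y) →
    ∃ γ, IsPath d γ ∧ IsOpenPath d ω γ ∧ (∀ v ∈ γ, v ∈ boxZ d (4 * N) e.val.1) ∧
      γ.head? = some x ∧ γ.getLast? = some y ∧ ((γ.length : ℝ) - 1 ≤ Cstar * N)

/-- The effective radius `R_e` as a natural number (`0` when undefined). -/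
def ReffN (d : ℕ) (Cstar : ℝ) (n : ℕ) (e : EdgeD d) (ω : Config d) : ℕ :=
  sInf {N : ℕ | 1 ≤ N ∧ V1 d Cstar n e N ω ∧ V2 d Cstar e N ω}

/-- The effective radius `R_e`, valued in `ℝ≥0∞` (`∞` when undefined). -/
def ReffENN (d : ℕ) (Cstar : ℝ) (n : ℕ) (e : EdgeD d) (ω : Config d) : ℝ≥0∞ :=
  sInf {r : ℝ≥0∞ | ∃ N : ℕ, r = N ∧ 1 ≤ N ∧ V1 d Cstar n e N ω ∧ V2 d Cstar e N ω}

/-- The truncated effective radius `R̂_e = min (C_* R_e) (log² n)`. -/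
def RhatR (d : ℕ) (Cstar : ℝ) (n : ℕ) (e : EdgeD d) (ω : Config d) : ℝ :=
  (min (ENNReal.ofReal Cstar * ReffENN d Cstar n e ω)
    (ENNReal.ofReal ((Real.log n) ^ 2))).toReal

/-- `diam(γ) ≥ r`. -/
def DiamGE (d : ℕ) (γ : List (ZVec d)) (r : ℝ) : Prop :=
  ∃ i : Fin d, ∃ x ∈ γ, ∃ y ∈ γ, r ≤ |((x i : ℤ) : ℝ) - ((y i : ℤ) : ℝ)|

/-- The boundary `∂Λ_t` (real radius `t`). -/
def bdryR (d : ℕ) (t : ℝ) : Set (ZVec d) :=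
  {x | (normInf d x : ℝ) ≤ t ∧ t - 1 < (normInf d x : ℝ)}

/-- The slab `S(ℓ,t) = {x ∈ Λ_t : 0 ≤ x₁ ≤ ℓ}`. -/
def slab (d : ℕ) (l t : ℝ) : Set (ZVec d) :=
  {x | (normInf d x : ℝ) ≤ t ∧ ∀ i : Fin d, (i : ℕ) = 0 → 0 ≤ x i ∧ ((x i : ℤ) : ℝ) ≤ l}

/-- The open cluster of the vertex `v`. -/
def openClusterOf (d : ℕ) (ω : Config d) (v : ZVec d) : Set (ZVec d) :=
  {y | chemDist d ω v y ≠ ⊤}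

/-- The set `C` crosses the box `Λ_t(z)`: in each direction an open path of `C ∩ Λ_t(z)`
connects the two opposite faces. -/
def CrossesBox (d : ℕ) (ω : Config d) (C : Set (ZVec d)) (t : ℕ) (z : ZVec d) : Prop :=
  ∀ i : Fin d, ∃ γ, IsPath d γ ∧ IsOpenPath d ω γ ∧ (∀ u ∈ γ, u ∈ C ∧ u ∈ boxZ d t z) ∧
    (∃ u ∈ γ, u i = z i - t) ∧ (∃ u ∈ γ, u i = z i + t)

/-- The event `𝓔_N`: some crossing open cluster of `Λ_{2N}` is avoided by a modified
geodesic `π ⊆ Λ_N` of diameter at least `N/2` belonging to `𝔾_*(Λ_{tN})`. -/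
def ENevent (d n : ℕ) (t : ℝ) (N : ℕ) : Set (Config d) :=
  {ω | ∃ v0 : ZVec d, CrossesBox d ω (openClusterOf d ω v0) (2 * N) 0 ∧
    ∃ π : List (ZVec d), IsPath d π ∧ (∀ u ∈ π, u ∈ boxZ d N 0) ∧
      GstarIn d n ω (boxR d (t * N) 0) π ∧ DiamGE d π ((N : ℝ) / 2) ∧
      ∀ u ∈ π, u ∉ openClusterOf d ω v0}

/-- `ρ` is a Garet–Marchand moderate-deviation constant for the chemical distance. -/
def GMprop (d : ℕ) (μ : Measure (Config d)) (ρ : ℝ) : Prop :=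
  1 ≤ ρ ∧ ∃ c : ℝ, 0 < c ∧ ∀ x : ZVec d, ∀ t : ℝ, ρ * (normInf d x : ℝ) ≤ t →
    μ {ω | chemDist d ω 0 x ≠ ⊤ ∧ t ≤ ((chemDist d ω 0 x).toNat : ℝ)}
      ≤ ENNReal.ofReal (c⁻¹ * Real.exp (-c * t)) ∧
    μ {ω | t ≤ ((chemDist d ω (starPt d ω 0) (starPt d ω x)).toNat : ℝ) ∨
        chemDist d ω (starPt d ω 0) (starPt d ω x) = ⊤}
      ≤ ENNReal.ofReal (c⁻¹ * Real.exp (-c * t))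

/-- `cs` is a constant for which the crossing-cluster avoidance lemma holds. -/
def CrossProp (d : ℕ) (μ : Measure (Config d)) (cs : ℝ) : Prop :=
  0 < cs ∧ cs < 1 ∧ ∀ n : ℕ, 2 ≤ n → ∀ t : ℝ, 1 / cs ≤ t → ∀ N : ℕ, 1 ≤ N →
    (N : ℝ) ≤ Real.exp (cs * (Real.log n) ^ 2) →
    μ (ENevent d n t N) ≤ ENNReal.ofReal (cs⁻¹ * Real.exp (-cs * N))

/-- `N_ρ = ⌊N / (16 ρ²)⌋`. -/
def Nrho (ρ : ℝ) (N : ℕ) : ℕ := Nat.floor ((N : ℝ) / (16 * ρ ^ 2))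

/-- The cube of side-length `m` with lower corner `z`. -/
def cube (d : ℕ) (m : ℕ) (z : ZVec d) : Set (ZVec d) :=
  {y | ∀ i, z i ≤ y i ∧ y i ≤ z i + m}

/-- The open cluster of `v` inside `U`. -/
def clusterIn (d : ℕ) (ω : Config d) (U : Set (ZVec d)) (v : ZVec d) : Set (ZVec d) :=
  {y | chemDistIn d ω U v y ≠ ⊤}

/-- `k ≤ r` for `k : ℕ∞` and `r : ℝ` (in particular `k` is finite). -/
def chemLE (k : ℕ∞) (r : ℝ) : Prop := ∃ m : ℕ, k = (m : ℕ∞) ∧ (m : ℝ) ≤ r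

/-- The box `Λ_{3N}(e)` is good (Definition 2.2 of the paper). -/
def GoodBox (d n : ℕ) (ρ Cstar : ℝ) (e : EdgeD d) (N : ℕ) (ω : Config d) : Prop :=
  (∃ v0 ∈ boxZ d (3 * N) e.val.1,
    (∀ z : ZVec d, cube d (Nrho ρ N) z ⊆ boxZ d (3 * N) e.val.1 →
      ∀ i : Fin d, ∃ γ, IsPath d γ ∧ IsOpenPath d ω γ ∧
        (∀ u ∈ γ, u ∈ clusterIn d ω (boxZ d (3 * N) e.val.1) v0 ∧ u ∈ cube d (Nrho ρ N) z) ∧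
        (∃ u ∈ γ, u i = z i) ∧ (∃ u ∈ γ, u i = z i + (Nrho ρ N : ℤ))) ∧
    (∀ π, IsPath d π → (∀ u ∈ π, u ∈ boxZ d (3 * N) e.val.1) →
      GstarIn d n ω (boxR d (Cstar * N) e.val.1) π → DiamGE d π ((Nrho ρ N : ℝ)) →
      ∃ u ∈ π, u ∈ clusterIn d ω (boxZ d (3 * N) e.val.1) v0)) ∧
  (∀ x y : ZVec d, x ∈ boxZ d (3 * N) e.val.1 → y ∈ boxZ d (3 * N) e.val.1 →
    normInf d (x - y) ≤ 2 * Nrho ρ N → chemDist d ω x y ≠ ⊤ →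
    chemDistIn d ω (boxZ d (4 * N) e.val.1) x y = chemDist d ω x y ∧
    chemLE (chemDist d ω x y) (4 * ρ * (Nrho ρ N : ℝ))) ∧
  (∀ x y : ZVec d, x ∈ annulus d N e → y ∈ annulus d N e →
    (∀ b : ZVec d, (normInf d (b - e.val.1) = N ∨ normInf d (b - e.val.1) = 3 * N) →
      (N : ℝ) / 2 ≤ (normInf d (x - b) : ℝ) ∧ (N : ℝ) / 2 ≤ (normInf d (y - b) : ℝ)) →
    normInf d (x - y) ≤ 2 * Nrho ρ N → chemDist d ω x y ≠ ⊤ →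
    chemDistIn d ω (annulus d N e) x y = chemDist d ω x y ∧
    chemLE (chemDist d ω x y) (4 * ρ * (Nrho ρ N : ℝ)))

/-- Evaluate an edge-indexed function at the (unordered) pair `{x,y}`, `0` if not an edge. -/
def edgeFnVal (d : ℕ) (g : EdgeD d → ℝ) (x y : ZVec d) : ℝ :=
  if h : ∃ e : EdgeD d, e.val = (x, y) ∨ e.val = (y, x) then g h.choose else 0

/-- The sum of `g` over the edges of the path `γ`. -/
def pathSum (d : ℕ) (g : EdgeD d → ℝ) (γ : List (ZVec d)) : ℝ :=
  ((γ.zip γ.tail).map fun pr => edgeFnVal d g pr.1 pr.2).sum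

/-- Number of edges of `η` that are not edges of `γ`, i.e. `|η \ γ|`. -/
def diffEdgeCount (d : ℕ) (η γ : List (ZVec d)) : ℕ :=
  ((η.zip η.tail).filter fun pr => decide (¬ edgeMemPath d pr.1 pr.2 γ)).length

/-- Maximal total weight of a lattice animal (path) in `Ξ_L`. -/
def animalMax (d : ℕ) (L : ℕ) (g : EdgeD d → ℝ) : ℝ :=
  sSup {r : ℝ | ∃ γ : List (ZVec d), IsPath d γ ∧ (∀ v ∈ γ, v ∈ boxZ d L 0) ∧
    γ.length ≤ L + 1 ∧ r = pathSum d g γ}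

/-- `m = ⌊n^{1/4}⌋`. -/
def mOf (n : ℕ) : ℕ := Nat.floor ((n : ℝ) ^ ((1 : ℝ) / 4))

/-- The box `Λ_m` as a finite set. -/
def boxFinset (d m : ℕ) : Finset (ZVec d) := Finset.Icc (fun _ => -(m : ℤ)) (fun _ => (m : ℤ))

/-- The spatially averaged passage time `F_m`. -/
def Fm (d n : ℕ) (ω : Config d) : ℝ :=
  (∑ z ∈ boxFinset d (mOf n), passageTime d n ω z (z + ptE1 d n)) / (boxFinset d (mOf n)).card

/-- The σ-algebra generated by the states of the first `i` edges. -/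
def edgeFiltration (d : ℕ) (ε : ℕ ≃ EdgeD d) (i : ℕ) : MeasurableSpace (Config d) :=
  MeasurableSpace.comap (fun ω (j : Fin i) => ω (ε j)) MeasurableSpace.pi

/-- The martingale increment `Δ_i = E[e^{λ F_m} | 𝓕_i] − E[e^{λ F_m} | 𝓕_{i−1}]`. -/
def mgDelta (d n : ℕ) (ε : ℕ ≃ EdgeD d) (lam : ℝ) (μ : Measure (Config d)) (i : ℕ) :
    Config d → ℝ :=
  fun ω => (μ[fun ω' => Real.exp (lam * Fm d n ω') | edgeFiltration d ε i]) ω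
    - (μ[fun ω' => Real.exp (lam * Fm d n ω') | edgeFiltration d ε (i - 1)]) ω

/-- The entropy `Ent[X] = E[X log (X / E[X])]`. -/
def entOf {α : Type*} [MeasurableSpace α] (μ : Measure α) (X : α → ℝ) : ℝ :=
  ∫ ω, X ω * Real.log (X ω / ∫ ω', X ω' ∂μ) ∂μ

end Perco

namespace Perco

section

variable {d : ℕ}

/-! ### The lattice -/

theorem normInf_le {x : ZVec d} {t : ℕ} : normInf d x ≤ t ↔ ∀ i, |x i| ≤ t := by
  simp only [normInf, Finset.sup_le_iff, Finset.mem_univ, true_implies]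
  exact forall_congr' fun i => by rw [Int.abs_eq_natAbs]; norm_cast

/-- The `ℓ∞` distance. -/
def dst (x y : ZVec d) : ℕ := normInf d (x - y)

theorem dst_le {x y : ZVec d} {t : ℕ} : dst x y ≤ t ↔ ∀ i, |x i - y i| ≤ t := normInf_le

theorem coord_le_dst (x y : ZVec d) (i : Fin d) : |x i - y i| ≤ dst x y := dst_le.1 le_rfl i

theorem exists_coord_dst (x y : ZVec d) (h : 0 < dst x y) :
    ∃ i, |x i - y i| = dst x y := by
  by_contra! hc
  have : dst x y ≤ dst x y - 1 := dst_le.2 fun i => by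
    have := coord_le_dst x y i
    have := hc i
    omega
  omega

@[simp] theorem dst_self (x : ZVec d) : dst x x = 0 :=
  Nat.le_zero.1 (dst_le.2 fun i => by simp)

theorem dst_comm (x y : ZVec d) : dst x y = dst y x :=
  le_antisymm (dst_le.2 fun i => by rw [abs_sub_comm]; exact coord_le_dst y x i)
    (dst_le.2 fun i => by rw [abs_sub_comm]; exact coord_le_dst x y i)

theorem dst_triangle (x y z : ZVec d) : dst x z ≤ dst x y + dst y z :=
  dst_le.2 fun i => by
    have h1 := coord_le_dst x y i
    have h2 := coord_le_dst y z i
    have := abs_sub_le (x i) (y i) (z i)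
    push_cast
    omega

theorem eq_of_dst_eq_zero {x y : ZVec d} (h : dst x y = 0) : x = y := by
  funext i
  have := coord_le_dst x y i
  rw [h, Nat.cast_zero, abs_nonpos_iff] at this
  omega

theorem dst_add_right (x y v : ZVec d) : dst (x + v) (y + v) = dst x y := by simp [dst]

/-- The box `Λ_t(z)`. -/
abbrev bx (z : ZVec d) (t : ℕ) : Set (ZVec d) := {y | dst y z ≤ t}

theorem bx_mono {z w : ZVec d} {s t : ℕ} (h : dst z w + s ≤ t) : bx z s ⊆ bx w t := fun y hy => by
  have := dst_triangle y z w
  simp only [Set.mem_ofPred_eq] at *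
  omega

/-- The box `Λ_t(z)` as a finite set. -/
def bxF (z : ZVec d) (t : ℕ) : Finset (ZVec d) := Finset.Icc (fun i => z i - t) (fun i => z i + t)

theorem mem_bxF {z y : ZVec d} {t : ℕ} : y ∈ bxF z t ↔ dst y z ≤ t := by
  rw [dst_le, bxF, Finset.mem_Icc, Pi.le_def, Pi.le_def, ← forall_and]
  exact forall_congr' fun i => by rw [abs_le]; constructor <;> rintro ⟨_, _⟩ <;> constructor <;> omega

theorem card_bxF (z : ZVec d) (t : ℕ) : (bxF z t).card = (2 * t + 1) ^ d := by
  rw [bxF, Pi.card_Icc]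
  have : ∀ i : Fin d, (Finset.Icc (z i - (t : ℤ)) (z i + t)).card = 2 * t + 1 := fun i => by
    rw [Int.card_Icc]; omega
  simp [this]

theorem bx_finite (z : ZVec d) (t : ℕ) : (bx z t).Finite :=
  (bxF z t).finite_toSet.subset fun y hy => by simpa [mem_bxF] using hy

theorem norm1_neg (x : ZVec d) : norm1 d (-x) = norm1 d x := by simp [norm1]

theorem adj_comm {x y : ZVec d} : Adj d x y ↔ Adj d y x := by
  unfold Adj; rw [← norm1_neg, neg_sub]

theorem Adj.dst_le_one {x y : ZVec d} (h : Adj d x y) : dst x y ≤ 1 := by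
  refine dst_le.2 fun i => ?_
  have h1 : ((x - y) i).natAbs ≤ norm1 d (x - y) :=
    Finset.single_le_sum (f := fun i => ((x - y) i).natAbs) (fun _ _ => Nat.zero_le _)
      (Finset.mem_univ i)
  rw [h] at h1
  rw [Int.abs_eq_natAbs]
  exact_mod_cast h1

theorem norm1_mod_two (x : ZVec d) : (norm1 d x : ZMod 2) = ((∑ i, x i : ℤ) : ZMod 2) := by
  simp only [norm1, Nat.cast_sum, Int.cast_sum]
  refine Finset.sum_congr rfl fun i _ => ?_
  rcases Int.natAbs_eq (x i) with h | h <;> · nth_rewrite 2 [h]; simp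

theorem Adj.norm1_ne {x y : ZVec d} (h : Adj d x y) : norm1 d x ≠ norm1 d y := fun he => by
  have h1 := norm1_mod_two (x - y)
  rw [h] at h1
  have h2 : ((∑ i, (x - y) i : ℤ) : ZMod 2) = (norm1 d x : ZMod 2) - norm1 d y := by
    rw [norm1_mod_two, norm1_mod_two]
    push_cast [Pi.sub_apply, Finset.sum_sub_distrib]
    rfl
  rw [h2, he, sub_self] at h1
  simp at h1

theorem exists_edge {x y : ZVec d} (h : Adj d x y) :
    ∃ e : EdgeD d, e.val = (x, y) ∨ e.val = (y, x) := by
  rcases lt_or_gt_of_ne h.norm1_ne with hl | hl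
  · exact ⟨⟨(x, y), h, hl⟩, Or.inl rfl⟩
  · exact ⟨⟨(y, x), adj_comm.1 h, hl⟩, Or.inr rfl⟩

theorem edge_unique {x y : ZVec d} {e f : EdgeD d} (he : e.val = (x, y) ∨ e.val = (y, x))
    (hf : f.val = (x, y) ∨ f.val = (y, x)) : e = f := by
  apply Subtype.ext
  have h1 := e.2.2
  have h2 := f.2.2
  rcases he with he | he <;> rcases hf with hf | hf <;> rw [he, hf] <;> rw [he] at h1 <;>
    rw [hf] at h2 <;> simp at h1 h2 <;> omega

/-- The edge joining two adjacent vertices. -/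
def mkEdge {x y : ZVec d} (h : Adj d x y) : EdgeD d := (exists_edge h).choose

theorem mkEdge_val {x y : ZVec d} (h : Adj d x y) :
    (mkEdge h).val = (x, y) ∨ (mkEdge h).val = (y, x) := (exists_edge h).choose_spec

variable {ω : Config d} {S S' : Set (ZVec d)} {x y z a b : ZVec d}

theorem EdgeOpen.adj (h : EdgeOpen d ω x y) : Adj d x y := by
  obtain ⟨e, he | he, -⟩ := h
  · have := e.2.1; rw [he] at this; exact this
  · have := e.2.1; rw [he] at this; exact adj_comm.1 this

theorem EdgeOpen.symm (h : EdgeOpen d ω x y) : EdgeOpen d ω y x := by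
  obtain ⟨e, he, ho⟩ := h
  exact ⟨e, he.symm, ho⟩

theorem edgeOpen_iff (h : Adj d x y) : EdgeOpen d ω x y ↔ ω (mkEdge h) = true := by
  constructor
  · rintro ⟨e, he, ho⟩
    rwa [edge_unique (mkEdge_val h) he]
  · exact fun ho => ⟨_, mkEdge_val h, ho⟩

/-! ### Connections by open paths inside a set -/

/-- `a` and `b` are joined by an open path inside `S`. -/
def Conn (ω : Config d) (S : Set (ZVec d)) (a b : ZVec d) : Prop :=
  a ∈ S ∧ Relation.ReflTransGen (fun x y => EdgeOpen d ω x y ∧ x ∈ S ∧ y ∈ S) a b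

theorem Conn.refl (h : a ∈ S) : Conn ω S a a := ⟨h, .refl⟩

theorem Conn.mem_right (h : Conn ω S a b) : b ∈ S := by
  obtain ⟨ha, h⟩ := h
  induction h with
  | refl => exact ha
  | tail _ h _ => exact h.2.2

theorem Conn.mem_left (h : Conn ω S a b) : a ∈ S := h.1

theorem rtg_symm {α : Type*} {r : α → α → Prop} (hr : ∀ x y, r x y → r y x) {a b : α}
    (h : Relation.ReflTransGen r a b) : Relation.ReflTransGen r b a := by
  induction h with
  | refl => exact .refl
  | tail _ h ih => exact .head (hr _ _ h) ih

theorem rtg_mono {α : Type*} {r s : α → α → Prop} (hrs : ∀ x y, r x y → s x y) {a b : α}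
    (h : Relation.ReflTransGen r a b) : Relation.ReflTransGen s a b :=
  Relation.ReflTransGen.lift id hrs _ _ h

theorem Conn.symm (h : Conn ω S a b) : Conn ω S b a :=
  ⟨h.mem_right, rtg_symm (fun _ _ h => ⟨h.1.symm, h.2.2, h.2.1⟩) h.2⟩

theorem Conn.trans {c : ZVec d} (h : Conn ω S a b) (h' : Conn ω S b c) : Conn ω S a c :=
  ⟨h.1, h.2.trans h'.2⟩

theorem Conn.mono (h : Conn ω S a b) (hS : S ⊆ S') : Conn ω S' a b :=
  ⟨hS h.1, rtg_mono (fun _ _ h => ⟨h.1, hS h.2.1, hS h.2.2⟩) h.2⟩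

theorem Conn.single (h : EdgeOpen d ω a b) (ha : a ∈ S) (hb : b ∈ S) : Conn ω S a b :=
  ⟨ha, .single ⟨h, ha, hb⟩⟩

theorem exists_exit {α : Type*} {r : α → α → Prop} {P : α → Prop} {a b : α}
    (h : Relation.ReflTransGen r a b) (ha : P a) (hb : ¬ P b) :
    ∃ c e, Relation.ReflTransGen (fun x y => r x y ∧ P x ∧ P y) a c ∧ P c ∧ r c e ∧ ¬ P e := by
  induction h with
  | refl => exact absurd ha hb
  | @tail b c _ hr ih =>
    by_cases hb' : P b
    · clear ih
      rename_i h1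
      by_contra hcon
      have key : ∀ c, Relation.ReflTransGen r a c → P c ∧
          Relation.ReflTransGen (fun x y => r x y ∧ P x ∧ P y) a c := by
        intro c hc
        induction hc with
        | refl => exact ⟨ha, .refl⟩
        | @tail x y _ hxy ih =>
          by_cases hy : P y
          · exact ⟨hy, ih.2.tail ⟨hxy, ih.1, hy⟩⟩
          · exact absurd ⟨x, y, ih.2, ih.1, hxy, hy⟩ hcon
      exact hb (key c (h1.tail hr)).1
    · exact ih hb'

theorem Conn.exit {P : ZVec d → Prop} (h : Conn ω S a b) (ha : P a) (hb : ¬ P b) :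
    ∃ c e, Conn ω (S ∩ {x | P x}) a c ∧ EdgeOpen d ω c e ∧ e ∈ S ∧ ¬ P e := by
  obtain ⟨c, e, h1, h2, h3, h4⟩ := exists_exit h.2 ha hb
  exact ⟨c, e, ⟨⟨h.1, ha⟩, rtg_mono (fun x y h => ⟨h.1.1, ⟨h.1.2.1, h.2.1⟩, h.1.2.2, h.2.2⟩) h1⟩,
    h3.1, h3.2.2, h4⟩

theorem Conn.exit_ball {l : ℕ} (h : Conn ω S a b) (hl : l ≤ dst b a) :
    ∃ e, Conn ω (S ∩ bx a l) a e ∧ dst e a = l := by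
  rcases Nat.eq_zero_or_pos l with rfl | hl0
  · exact ⟨a, .refl ⟨h.1, by simp⟩, by simp⟩
  obtain ⟨c, e, h1, h2, h3, h4⟩ := h.exit (P := fun x => dst x a ≤ l - 1) (by simp) (by omega)
  have hc := h1.mem_right.2
  have h5 := h2.adj.dst_le_one
  have := dst_triangle e c a
  rw [dst_comm e c] at this
  simp only [Set.mem_ofPred_eq] at hc
  have hm : S ∩ {x | dst x a ≤ l - 1} ⊆ S ∩ bx a l :=
    Set.inter_subset_inter_right _ fun x hx => by simp only [Set.mem_ofPred_eq] at *; omega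
  exact ⟨e, (h1.mono hm).trans (.single h2 (hm h1.mem_right) ⟨h3, by simp; omega⟩), by omega⟩

theorem EdgeOpen.coord (h : EdgeOpen d ω a b) (i : Fin d) : |a i - b i| ≤ 1 := by
  have := coord_le_dst a b i
  have := h.adj.dst_le_one
  omega

theorem Conn.cut_le {β : ℤ} {i : Fin d} (h : Conn ω S a b) (ha : a i ≤ β) (hb : β ≤ b i) :
    ∃ b', Conn ω (S ∩ {x | x i ≤ β}) a b' ∧ b' i = β := by
  rcases ha.eq_or_lt with ha | ha
  · exact ⟨a, .refl ⟨h.1, ha.le⟩, ha⟩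
  obtain ⟨c, e, h1, h2, h3, h4⟩ := h.exit (P := fun x => x i < β) ha (by omega)
  have hc := h1.mem_right.2
  have h5 := abs_le.1 (h2.coord i)
  simp only [Set.mem_ofPred_eq] at hc
  have hm : S ∩ {x | x i < β} ⊆ S ∩ {x | x i ≤ β} :=
    Set.inter_subset_inter_right _ fun x hx => by simp only [Set.mem_ofPred_eq] at *; omega
  exact ⟨e, (h1.mono hm).trans (.single h2 (hm h1.mem_right) ⟨h3, by simp; omega⟩), by omega⟩

theorem Conn.cut_ge {β : ℤ} {i : Fin d} (h : Conn ω S a b) (ha : β ≤ a i) (hb : b i ≤ β) :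
    ∃ b', Conn ω (S ∩ {x | β ≤ x i}) a b' ∧ b' i = β := by
  rcases ha.eq_or_lt with ha | ha
  · exact ⟨a, .refl ⟨h.1, ha.le⟩, ha.symm⟩
  obtain ⟨c, e, h1, h2, h3, h4⟩ := h.exit (P := fun x => β < x i) ha (by omega)
  have hc := h1.mem_right.2
  have h5 := abs_le.1 (h2.coord i)
  simp only [Set.mem_ofPred_eq] at hc
  have hm : S ∩ {x | β < x i} ⊆ S ∩ {x | β ≤ x i} :=
    Set.inter_subset_inter_right _ fun x hx => by simp only [Set.mem_ofPred_eq] at *; omega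
  exact ⟨e, (h1.mono hm).trans (.single h2 (hm h1.mem_right) ⟨h3, by simp; omega⟩), by omega⟩

/-- A connection between the two sides of a slab contains a crossing of the slab. -/
theorem Conn.cut {α β : ℤ} {i : Fin d} (h : Conn ω S a b) (hαβ : α ≤ β) (ha : a i ≤ α)
    (hb : β ≤ b i) : ∃ a' b', Conn ω (S ∩ {x | α ≤ x i ∧ x i ≤ β}) a' b' ∧ a' i = α ∧ b' i = β ∧
      Conn ω S a a' := by
  obtain ⟨b', h1, hb'⟩ := h.cut_le (ha.trans hαβ) hb
  obtain ⟨a', h2, ha'⟩ := h1.symm.cut_ge (β := α) (by omega) ha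
  have h3 := h2.symm
  refine ⟨a', b', h3.mono ?_, ha', hb', ?_⟩
  · rintro x ⟨⟨h1, h2⟩, h3⟩; exact ⟨h1, h3, h2⟩
  · exact (h1.mono Set.inter_subset_left).trans
      (h2.mono (Set.inter_subset_left.trans Set.inter_subset_left))

/-! ### Lists and connections -/

theorem Conn.exists_path (h : Conn ω S a b) : ∃ γ, IsPath d γ ∧ IsOpenPath d ω γ ∧
    (∀ v ∈ γ, v ∈ S) ∧ γ.head? = some a ∧ γ.getLast? = some b := by
  let G : SimpleGraph (ZVec d) :=
    { Adj := fun x y => EdgeOpen d ω x y ∧ x ∈ S ∧ y ∈ S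
      symm := ⟨fun _ _ h => ⟨h.1.symm, h.2.2, h.2.1⟩⟩
      loopless := ⟨fun x h => by have := h.1.adj; simp [Adj, norm1] at this⟩ }
  have hr : G.Reachable a b := by
    obtain ⟨-, h⟩ := h
    induction h with
    | refl => exact SimpleGraph.Reachable.refl _
    | tail _ h ih => exact ih.trans (SimpleGraph.Adj.reachable (G := G) h)
  obtain ⟨p, hp⟩ := hr.exists_isPath
  have hch := p.isChain_adj_support
  refine ⟨p.support, ⟨p.support_ne_nil, hp.support_nodup, hch.imp fun _ _ h => h.1.adj⟩,
    hch.imp fun _ _ h => h.1, ?_, ?_, ?_⟩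
  · have : ∀ {a b : ZVec d} (p : G.Walk a b), a ∈ S → ∀ v ∈ p.support, v ∈ S := by
      intro a b p
      induction p with
      | nil => intro ha v hv; simp at hv; exact hv ▸ ha
      | cons h p ih =>
        intro ha v hv
        rw [SimpleGraph.Walk.support_cons, List.mem_cons] at hv
        rcases hv with rfl | hv
        · exact ha
        · exact ih h.2.2 v hv
    exact this p h.1
  · rw [List.head?_eq_some_head p.support_ne_nil]; simp
  · rw [List.getLast?_eq_some_getLast p.support_ne_nil]; simp

theorem conn_of_list {γ : List (ZVec d)} (ho : IsOpenPath d ω γ) (hS : ∀ v ∈ γ, v ∈ S)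
    (ha : γ.head? = some a) (v : ZVec d) (hv : v ∈ γ) : Conn ω S a v := by
  induction γ generalizing a with
  | nil => simp at hv
  | cons x γ ih =>
    simp only [List.head?_cons, Option.some.injEq] at ha
    subst ha
    rcases List.mem_cons.1 hv with rfl | hv
    · exact .refl (hS _ (by simp))
    cases γ with
    | nil => simp at hv
    | cons y γ =>
      have ho' := List.isChain_cons_cons.1 ho
      exact (Conn.single ho'.1 (hS _ (by simp)) (hS _ (by simp))).trans
        (ih ho'.2 (fun v hv => hS v (by simp [hv])) rfl hv)

theorem mem_of_getLast? {α : Type*} {l : List α} {a : α} (h : l.getLast? = some a) : a ∈ l :=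
  List.mem_of_getLast? h

theorem chemDistIn_ne_top : chemDistIn d ω S a b ≠ ⊤ ↔ Conn ω S a b := by
  constructor
  · intro h
    rw [chemDistIn, Ne, sInf_eq_top] at h
    push Not at h
    obtain ⟨k, ⟨γ, -, h2, h3, h4, h5, -⟩, -⟩ := h
    exact conn_of_list h2 h3 h4 b (mem_of_getLast? h5)
  · intro h
    obtain ⟨γ, h1, h2, h3, h4, h5⟩ := h.exists_path
    rw [chemDistIn, Ne, sInf_eq_top]
    push Not
    exact ⟨_, ⟨γ, h1, h2, h3, h4, h5, rfl⟩, ENat.natCast_ne_top _⟩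

theorem chemDistIn_attained (h : chemDistIn d ω S a b ≠ ⊤) :
    ∃ γ, IsPath d γ ∧ IsOpenPath d ω γ ∧ (∀ v ∈ γ, v ∈ S) ∧ γ.head? = some a ∧
      γ.getLast? = some b ∧ ((γ.length - 1 : ℕ) : ℕ∞) = chemDistIn d ω S a b := by
  have hne : {k : ℕ∞ | ∃ γ : List (ZVec d), IsPath d γ ∧ IsOpenPath d ω γ ∧ (∀ v ∈ γ, v ∈ S) ∧
    γ.head? = some a ∧ γ.getLast? = some b ∧ ((γ.length - 1 : ℕ) : ℕ∞) = k}.Nonempty := by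
    by_contra hc
    rw [Set.not_nonempty_iff_eq_empty] at hc
    rw [chemDistIn, hc, sInf_empty] at h
    exact h rfl
  exact csInf_mem hne

theorem dst_le_length {γ : List (ZVec d)} (hc : γ.IsChain (Adj d)) (ha : γ.head? = some a)
    (v : ZVec d) (hv : v ∈ γ) : dst v a ≤ γ.length - 1 := by
  induction γ generalizing a with
  | nil => simp at hv
  | cons x γ ih =>
    simp only [List.head?_cons, Option.some.injEq] at ha
    subst ha
    rcases List.mem_cons.1 hv with rfl | hv
    · simp
    cases γ with
    | nil => simp at hv
    | cons y γ =>
      have ho' := List.isChain_cons_cons.1 hc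
      have := ih ho'.2 rfl hv
      have := ho'.1.dst_le_one
      have := dst_triangle v y x
      rw [dst_comm y x] at this
      simp at *
      omega

/-- A connection of chemical length at most `k` stays in the ball of radius `k`. -/
theorem conn_of_chemDist (h : chemDist d ω a b ≠ ⊤) :
    Conn ω (bx a (chemDist d ω a b).toNat) a b := by
  obtain ⟨γ, h1, h2, -, h4, h5, h6⟩ := chemDistIn_attained h
  have h7 : (chemDist d ω a b).toNat = γ.length - 1 := by
    rw [chemDist, ← h6, ENat.toNat_natCast]
  rw [h7]
  exact conn_of_list h2 (fun v hv => dst_le_length h1.2.2 h4 v hv) h4 b (mem_of_getLast? h5)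

theorem chemDist_ne_top : chemDist d ω a b ≠ ⊤ ↔ Conn ω Set.univ a b := chemDistIn_ne_top

end

section

variable {d : ℕ}
variable {ω ω' : Config d} {S S' : Set (ZVec d)} {x y z a b : ZVec d}

/-! ### Local events and independence -/

/-- The edges with both endpoints in `S`. -/
def edgesIn (S : Set (ZVec d)) : Set (EdgeD d) := {e | e.val.1 ∈ S ∧ e.val.2 ∈ S}

theorem edgesIn_mono (h : S ⊆ S') : edgesIn S ⊆ edgesIn S' := fun _ he => ⟨h he.1, h he.2⟩

theorem edgesIn_finite (h : S.Finite) : (edgesIn S).Finite :=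
  Set.Finite.of_finite_image (f := Subtype.val)
    ((h.prod h).subset (by rintro _ ⟨e, he, rfl⟩; exact he)) Subtype.val_injective.injOn

theorem edgesIn_disjoint (h : Disjoint S S') : Disjoint (edgesIn S) (edgesIn S') :=
  Set.disjoint_left.2 fun _ h1 h2 => Set.disjoint_left.1 h h1.1 h2.1

/-- The predicate `P` depends only on the states of the edges in `F`. -/
def Loc (F : Set (EdgeD d)) (P : Config d → Prop) : Prop :=
  ∀ ω ω', (∀ e ∈ F, ω e = ω' e) → (P ω ↔ P ω')

theorem Loc.mono {F G : Set (EdgeD d)} {P : Config d → Prop} (h : Loc F P) (hFG : F ⊆ G) :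
    Loc G P := fun ω ω' hω => h ω ω' fun e he => hω e (hFG he)

theorem edgeOpen_congr {F : Set (EdgeD d)} (hω : ∀ e ∈ F, ω e = ω' e)
    (hF : edgesIn S ⊆ F) (hx : x ∈ S) (hy : y ∈ S) : EdgeOpen d ω x y ↔ EdgeOpen d ω' x y := by
  refine exists_congr fun e => and_congr_right fun he => ?_
  rw [hω e (hF _)]
  rcases he with he | he <;> simp [edgesIn, he, hx, hy]

theorem conn_congr {F : Set (EdgeD d)} (hω : ∀ e ∈ F, ω e = ω' e) (hF : edgesIn S ⊆ F) :
    Conn ω S a b ↔ Conn ω' S a b := by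
  have : (fun x y => EdgeOpen d ω x y ∧ x ∈ S ∧ y ∈ S) =
      fun x y => EdgeOpen d ω' x y ∧ x ∈ S ∧ y ∈ S := by
    funext x y
    exact propext ⟨fun h => ⟨(edgeOpen_congr hω hF h.2.1 h.2.2).1 h.1, h.2⟩,
      fun h => ⟨(edgeOpen_congr hω hF h.2.1 h.2.2).2 h.1, h.2⟩⟩
  rw [Conn, Conn, this]

theorem loc_conn : Loc (edgesIn S) fun ω => Conn ω S a b :=
  fun _ _ hω => conn_congr hω subset_rfl

theorem Loc.eq_preimage {F : Finset (EdgeD d)} {P : Config d → Prop} (h : Loc (F : Set _) P) :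
    {ω | P ω} = (fun ω (i : F) => ω i) ⁻¹' ((fun ω (i : F) => ω i) '' {ω | P ω}) := by
  refine Set.Subset.antisymm (Set.subset_preimage_image _ _) ?_
  rintro ω ⟨ω', h1, h2⟩
  exact (h ω' ω fun e he => congrFun h2 ⟨e, he⟩).1 h1

theorem Loc.measurableSet {F : Set (EdgeD d)} {P : Config d → Prop} (h : Loc F P)
    (hF : F.Finite) : MeasurableSet {ω | P ω} := by
  have h' : Loc (hF.toFinset : Set _) P := by simpa using h
  rw [h'.eq_preimage]
  exact (measurable_pi_lambda _ fun i => measurable_pi_apply _) (Set.toFinite _).measurableSet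

/-- The Bernoulli measure on `Bool`. -/
def bern (p : ℝ) : Measure Bool :=
  ENNReal.ofReal p • Measure.dirac true + ENNReal.ofReal (1 - p) • Measure.dirac false

theorem bern_singleton (p : ℝ) (b : Bool) :
    bern p {b} = ENNReal.ofReal (if b then p else 1 - p) := by
  cases b <;> simp [bern]

theorem isProbabilityMeasure_bern {p : ℝ} (h0 : 0 ≤ p) (h1 : p ≤ 1) :
    IsProbabilityMeasure (bern p) :=
  ⟨by simp [bern, ← ENNReal.ofReal_add h0 (sub_nonneg.2 h1)]⟩

theorem IsBernoulli.eq_infinitePi {p : ℝ} {μ : Measure (Config d)} (h0 : 0 ≤ p) (h1 : p ≤ 1)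
    (hμ : IsBernoulli d p μ) : μ = Measure.infinitePi fun _ => bern p := by
  have := isProbabilityMeasure_bern h0 h1
  have := hμ.1
  refine IsProjectiveLimit.unique (P := fun I : Finset (EdgeD d) => Measure.pi fun _ : I => bern p)
    (fun I => ?_) (Measure.isProjectiveLimit_infinitePi _)
  refine Measure.ext_of_singleton fun f => ?_
  rw [Measure.map_apply (Finset.measurable_restrict I) (measurableSet_singleton _),
    Measure.pi_singleton]
  have h2 := hμ.2 I fun e => if h : e ∈ I then f ⟨e, h⟩ else true
  convert h2 using 1
  · congr 1
    ext ω
    simp only [Set.mem_preimage, Set.mem_singleton_iff, Set.mem_ofPred_eq, funext_iff,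
      Finset.restrict, Subtype.forall]
    exact forall₂_congr fun e he => by simp [he]
  · rw [← Finset.prod_coe_sort I]
    exact Fintype.prod_congr _ _ fun e => by simp [bern_singleton]

section Bernoulli

variable {p : ℝ} {μ : Measure (Config d)} (h0 : 0 ≤ p) (h1 : p ≤ 1) (hμ : IsBernoulli d p μ)

include h0 h1 hμ

theorem measure_inter_of_loc {F G : Set (EdgeD d)} {P Q : Config d → Prop} (hP : Loc F P)
    (hQ : Loc G Q) (hF : F.Finite) (hG : G.Finite) (hFG : Disjoint F G) :
    μ {ω | P ω ∧ Q ω} = μ {ω | P ω} * μ {ω | Q ω} := by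
  have := isProbabilityMeasure_bern h0 h1
  have hi : ProbabilityTheory.iIndepFun (fun (e : EdgeD d) (ω : Config d) => ω e) μ := by
    rw [hμ.eq_infinitePi h0 h1]
    exact ProbabilityTheory.iIndepFun_infinitePi (X := fun _ b => b) fun _ => measurable_id
  have hi' := hi.indepFun_finset hF.toFinset hG.toFinset
    (by rw [← Finset.disjoint_coe]; simpa using hFG) fun e => measurable_pi_apply e
  have hP' : Loc (hF.toFinset : Set _) P := by simpa using hP
  have hQ' : Loc (hG.toFinset : Set _) Q := by simpa using hQ
  have := hi'.measure_inter_preimage_eq_mul _ _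
    (Set.toFinite ((fun ω (i : hF.toFinset) => ω i) '' {ω | P ω})).measurableSet
    (Set.toFinite ((fun ω (i : hG.toFinset) => ω i) '' {ω | Q ω})).measurableSet
  rw [← hP'.eq_preimage, ← hQ'.eq_preimage] at this
  exact this

theorem measure_list_of_loc {ι : Type*} (L : List ι) (B : ι → Set (ZVec d))
    (P : ι → Config d → Prop) (hP : ∀ i ∈ L, Loc (edgesIn (B i)) (P i))
    (hB : ∀ i ∈ L, (B i).Finite) (hL : L.Pairwise fun i j => Disjoint (B i) (B j)) :
    μ {ω | ∀ i ∈ L, P i ω} = (L.map fun i => μ {ω | P i ω}).prod := by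
  induction L with
  | nil => have := hμ.1; simp
  | cons i L ih =>
    rw [List.pairwise_cons] at hL
    have h := ih (fun i hi => hP i (by simp [hi])) (fun i hi => hB i (by simp [hi])) hL.2
    have h3 : Loc (⋃ j ∈ L, edgesIn (B j)) fun ω => ∀ j ∈ L, P j ω := fun ω ω' hω =>
      forall₂_congr fun j hj => hP j (by simp [hj]) ω ω' fun e he =>
        hω e (Set.mem_biUnion (show j ∈ {j | j ∈ L} from hj) he)
    have h4 := measure_inter_of_loc h0 h1 hμ (hP i (by simp)) h3 (edgesIn_finite (hB i (by simp)))
      (Set.Finite.biUnion (List.finite_toSet L) fun j hj => edgesIn_finite (hB j (by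
        have : j ∈ L := hj
        simp [this])))
      (Set.disjoint_iUnion₂_right.2 fun j hj => edgesIn_disjoint (hL.1 j hj))
    simp only [List.mem_cons, forall_eq_or_imp, List.map_cons, List.prod_cons]
    rw [h4, h]

end Bernoulli

/-! ### Translations -/

theorem adj_add (v : ZVec d) (h : Adj d x y) : Adj d (x + v) (y + v) := by
  unfold Adj at *; simpa using h

/-- Translation of edges. -/
def shiftEdge (v : ZVec d) (e : EdgeD d) : EdgeD d := mkEdge (adj_add v e.2.1)

theorem shiftEdge_val (v : ZVec d) {e : EdgeD d} (he : e.val = (x, y) ∨ e.val = (y, x)) :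
    (shiftEdge v e).val = (x + v, y + v) ∨ (shiftEdge v e).val = (y + v, x + v) := by
  have := mkEdge_val (adj_add v e.2.1)
  change (shiftEdge v e).val = _ ∨ (shiftEdge v e).val = _ at this
  generalize shiftEdge v e = f at this ⊢
  rcases he with he | he <;> rw [he] at this
  · exact this
  · exact this.symm

theorem shiftEdge_neg (v : ZVec d) (e : EdgeD d) : shiftEdge (-v) (shiftEdge v e) = e := by
  have h := shiftEdge_val (-v) (shiftEdge_val v (e := e) (Or.inl rfl))
  simp only [add_neg_cancel_right] at h
  exact edge_unique h (Or.inl rfl)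

/-- Translation of edges, as an equivalence. -/
def shiftEquiv (v : ZVec d) : EdgeD d ≃ EdgeD d where
  toFun := shiftEdge v
  invFun := shiftEdge (-v)
  left_inv := shiftEdge_neg v
  right_inv e := by simpa using shiftEdge_neg (-v) e

/-- The configuration seen from `v`. -/
def shiftC (v : ZVec d) (ω : Config d) : Config d := fun e => ω (shiftEdge v e)

theorem edgeOpen_shift (v : ZVec d) :
    EdgeOpen d (shiftC v ω) x y ↔ EdgeOpen d ω (x + v) (y + v) := by
  constructor
  · rintro ⟨e, he, ho⟩
    exact ⟨_, shiftEdge_val v he, ho⟩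
  · rintro ⟨e, he, ho⟩
    have := shiftEdge_val (-v) he
    simp only [add_neg_cancel_right] at this
    refine ⟨_, this, ?_⟩
    rw [shiftC]
    have h2 := shiftEdge_neg (-v) e
    rw [neg_neg] at h2
    rwa [h2]

theorem measure_shift {p : ℝ} {μ : Measure (Config d)} (h0 : 0 ≤ p) (h1 : p ≤ 1)
    (hμ : IsBernoulli d p μ) (v : ZVec d) (P : Config d → Prop) :
    μ {ω | P (shiftC v ω)} ≤ μ {ω | P ω} := by
  have := isProbabilityMeasure_bern h0 h1
  have h := Measure.infinitePi_map_piCongrLeft (fun _ : EdgeD d => bern p) (shiftEquiv v).symm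
  rw [← hμ.eq_infinitePi h0 h1] at h
  have hT : ⇑(MeasurableEquiv.piCongrLeft (fun _ : EdgeD d => Bool) (shiftEquiv v).symm)
      = shiftC v := by
    funext ω e
    have := Equiv.piCongrLeft_apply_apply (P := fun _ : EdgeD d => Bool) (shiftEquiv v).symm ω
      (shiftEquiv v e)
    rw [Equiv.symm_apply_apply] at this
    rw [MeasurableEquiv.coe_piCongrLeft]
    exact this
  rw [hT] at h
  conv_rhs => rw [← h]
  refine Measure.le_map_apply (AEMeasurable.of_map_ne_zero ?_) {ω | P ω}
  rw [h]
  have := hμ.1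
  exact IsProbabilityMeasure.ne_zero μ

theorem conn_shift (v : ZVec d) :
    Conn (shiftC v ω) S a b ↔ Conn ω {x | x - v ∈ S} (a + v) (b + v) := by
  constructor
  · rintro ⟨ha, h⟩
    refine ⟨by simpa using ha, Relation.ReflTransGen.lift (· + v) ?_ _ _ h⟩
    exact fun x y h => ⟨(edgeOpen_shift v).1 h.1, by simpa using h.2.1, by simpa using h.2.2⟩
  · rintro ⟨ha, h⟩
    have := Relation.ReflTransGen.lift (· - v) (p := fun x y => EdgeOpen d (shiftC v ω) x y ∧
      x ∈ S ∧ y ∈ S) (fun x y h => ⟨(edgeOpen_shift v).2 (by simpa using h.1), h.2.1, h.2.2⟩) _ _ h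
    simp only [Function.onFun] at this
    rw [add_sub_cancel_right, add_sub_cancel_right] at this
    exact ⟨by simpa using ha, this⟩

theorem conn_shift_box (v : ZVec d) (t : ℕ) :
    Conn (shiftC v ω) (bx z t) a b ↔ Conn ω (bx (z + v) t) (a + v) (b + v) := by
  rw [conn_shift]
  have : {x | x - v ∈ bx z t} = bx (z + v) t := by
    ext x
    change dst (x - v) z ≤ t ↔ dst x (z + v) ≤ t
    rw [← dst_add_right (x - v) z v, sub_add_cancel]
  rw [this]

theorem conn_shift_univ (v : ZVec d) :
    Conn (shiftC v ω) Set.univ a b ↔ Conn ω Set.univ (a + v) (b + v) := by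
  rw [conn_shift]
  have : {x | x - v ∈ (Set.univ : Set (ZVec d))} = Set.univ :=
    Set.eq_univ_of_forall fun _ => trivial
  rw [this]

end

section

variable {d : ℕ}
variable {ω ω' : Config d} {S S' : Set (ZVec d)} {x y z a b : ZVec d}

/-! ### Exponentially small sequences -/

/-- `f` decays exponentially fast. -/
def ExpSmall (f : ℕ → ℝ≥0∞) : Prop :=
  ∃ C c : ℝ, 0 < C ∧ 0 < c ∧ ∀ r : ℕ, f r ≤ ENNReal.ofReal (C * Real.exp (-c * r))

theorem ExpSmall.mono {f g : ℕ → ℝ≥0∞} (hg : ExpSmall g) (h : ∀ r, f r ≤ g r) : ExpSmall f := by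
  obtain ⟨C, c, hC, hc, hb⟩ := hg
  exact ⟨C, c, hC, hc, fun r => (h r).trans (hb r)⟩

theorem ExpSmall.add {f g : ℕ → ℝ≥0∞} (hf : ExpSmall f) (hg : ExpSmall g) :
    ExpSmall fun r => f r + g r := by
  obtain ⟨C, c, hC, hc, hb⟩ := hf
  obtain ⟨C', c', hC', hc', hb'⟩ := hg
  refine ⟨C + C', min c c', by positivity, lt_min hc hc', fun r => ?_⟩
  refine (add_le_add (hb r) (hb' r)).trans ?_
  rw [← ENNReal.ofReal_add (by positivity) (by positivity), add_mul]
  gcongr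
  · exact min_le_left _ _
  · exact min_le_right _ _

theorem ExpSmall.poly {f : ℕ → ℝ≥0∞} (hf : ExpSmall f) (A B k : ℕ) :
    ExpSmall fun r => ((A * r + B) ^ k : ℕ) * f r := by
  obtain ⟨C, c, hC, hc, hb⟩ := hf
  have hlim : Filter.Tendsto (fun r : ℕ => ((A * r + B) ^ k : ℝ) * Real.exp (-(c / 2) * r))
      Filter.atTop (nhds 0) := by
    have h1 : Filter.Tendsto (fun x : ℝ => (A * x + B) ^ k * Real.exp (-(c / 2) * x))
        Filter.atTop (nhds 0) := by
      have h3 : ∀ x : ℝ, ((Polynomial.C (A : ℝ) * Polynomial.X + Polynomial.C (B : ℝ)) ^ k).eval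
        x = (A * x + B) ^ k := fun x => by simp
      have h4 : Filter.Tendsto (fun x : ℝ => ((Polynomial.C (A * (2 / c) : ℝ) * Polynomial.X +
        Polynomial.C (B : ℝ)) ^ k).eval x / Real.exp x) Filter.atTop (nhds 0) :=
        Polynomial.tendsto_div_exp_atTop _
      have h5 : Filter.Tendsto (fun x : ℝ => (c / 2) * x) Filter.atTop Filter.atTop :=
        Filter.tendsto_id.const_mul_atTop (by positivity)
      refine (h4.comp h5).congr fun x => ?_
      simp only [Function.comp, Polynomial.eval_pow, Polynomial.eval_add, Polynomial.eval_mul,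
        Polynomial.eval_C, Polynomial.eval_X]
      rw [div_eq_mul_inv, ← Real.exp_neg]
      congr 2
      · field_simp
      · ring
    exact h1.comp tendsto_natCast_atTop_atTop
  obtain ⟨M, hM⟩ := hlim.bddAbove_range
  have hM' : ∀ r : ℕ, ((A * r + B) ^ k : ℝ) * Real.exp (-(c / 2) * r) ≤ M := fun r =>
    hM ⟨r, rfl⟩
  have hM0 : 0 ≤ M := le_trans (by positivity) (hM' 0)
  refine ⟨C * (M + 1), c / 2, by positivity, by positivity, fun r => ?_⟩
  refine (mul_le_mul_right (hb r) _).trans ?_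
  rw [← ENNReal.ofReal_natCast, ← ENNReal.ofReal_mul (by positivity)]
  apply ENNReal.ofReal_le_ofReal
  push_cast
  have h6 : Real.exp (-c * r) = Real.exp (-(c / 2) * r) * Real.exp (-(c / 2) * r) := by
    rw [← Real.exp_add]; ring_nf
  rw [h6]
  have h7 := hM' r
  have h8 : 0 < Real.exp (-(c / 2) * r) := Real.exp_pos _
  calc ((A * r + B) ^ k : ℝ) * (C * (Real.exp (-(c / 2) * r) * Real.exp (-(c / 2) * r)))
      = C * (((A * r + B) ^ k : ℝ) * Real.exp (-(c / 2) * r)) * Real.exp (-(c / 2) * r) := by ring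
    _ ≤ C * (M + 1) * Real.exp (-(c / 2) * r) := by gcongr; linarith

theorem ExpSmall.const_mul {f : ℕ → ℝ≥0∞} (hf : ExpSmall f) (B : ℕ) :
    ExpSmall fun r => B * f r := by
  simpa using hf.poly 0 B 1

theorem ExpSmall.div {f : ℕ → ℝ≥0∞} (hf : ExpSmall f) (Q : ℕ) (hQ : 0 < Q) :
    ExpSmall fun r => f (r / Q) := by
  obtain ⟨C, c, hC, hc, hb⟩ := hf
  have hQ' : (0 : ℝ) < Q := by exact_mod_cast hQ
  refine ⟨C * Real.exp c, c / Q, by positivity, by positivity, fun r => (hb _).trans ?_⟩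
  apply ENNReal.ofReal_le_ofReal
  rw [mul_assoc, ← Real.exp_add]
  have h1 : (r : ℝ) / Q ≤ (r / Q : ℕ) + 1 := by
    rw [div_le_iff₀ hQ']
    have := (Nat.lt_div_mul_add (a := r) hQ).le
    have h2 : (r : ℝ) ≤ ((r / Q * Q + Q : ℕ) : ℝ) := by exact_mod_cast this
    push_cast at h2 ⊢
    linarith
  have h2 : c / Q * r = c * (r / Q) := by ring
  gcongr
  nlinarith

theorem ExpSmall.of_eventually {f : ℕ → ℝ≥0∞} (h1 : ∀ r, f r ≤ 1) (r0 : ℕ) {g : ℕ → ℝ≥0∞}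
    (hg : ExpSmall g) (h : ∀ r, r0 ≤ r → f r ≤ g r) : ExpSmall f := by
  obtain ⟨C, c, hC, hc, hb⟩ := hg
  refine ⟨C + Real.exp (c * r0), c, by positivity, hc, fun r => ?_⟩
  rcases le_total r0 r with hr | hr
  · refine (h r hr).trans ((hb r).trans ?_)
    gcongr
    linarith [Real.exp_pos (c * r0)]
  · refine (h1 r).trans ?_
    rw [← ENNReal.ofReal_one]
    apply ENNReal.ofReal_le_ofReal
    have : Real.exp (c * r0) * Real.exp (-c * r) ≥ 1 := by
      rw [← Real.exp_add, ge_iff_le, Real.one_le_exp_iff]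
      have : (r : ℝ) ≤ r0 := by exact_mod_cast hr
      nlinarith
    nlinarith [Real.exp_pos (-c * r)]

theorem ExpSmall.tendsto {f : ℕ → ℝ≥0∞} (hf : ExpSmall f) :
    Filter.Tendsto f Filter.atTop (nhds 0) := by
  obtain ⟨C, c, hC, hc, hb⟩ := hf
  refine tendsto_of_tendsto_of_tendsto_of_le_of_le tendsto_const_nhds ?_ (fun _ => zero_le) hb
  rw [← ENNReal.ofReal_zero]
  refine ENNReal.tendsto_ofReal ?_
  rw [← mul_zero C]
  refine Filter.Tendsto.const_mul _ ?_
  refine Real.tendsto_exp_atBot.comp ?_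
  exact tendsto_natCast_atTop_atTop.const_mul_atTop_of_neg (neg_lt_zero.2 hc)

theorem expSmall_exp {C c : ℝ} (hC : 0 < C) (hc : 0 < c) :
    ExpSmall fun r => ENNReal.ofReal (C * Real.exp (-c * r)) := ⟨C, c, hC, hc, fun _ => le_rfl⟩

/-- Uniform control of tails. -/
theorem ExpSmall.tail {f : ℕ → ℝ≥0∞} (hf : ExpSmall f) :
    ExpSmall fun r => ∑' k, f (r + k) := by
  obtain ⟨C, c, hC, hc, hb⟩ := hf
  have hs : Summable fun k : ℕ => Real.exp (-c * k) := by
    have := Real.summable_exp_nat_mul_iff.2 (neg_lt_zero.2 hc)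
    exact this.congr fun k => by rw [mul_comm]
  have h0 : 0 ≤ ∑' k : ℕ, Real.exp (-c * k) := tsum_nonneg fun _ => (Real.exp_pos _).le
  refine ⟨C * ((∑' k : ℕ, Real.exp (-c * k)) + 1), c, by positivity, hc, fun r => ?_⟩
  calc ∑' k, f (r + k) ≤ ∑' k : ℕ, ENNReal.ofReal (C * Real.exp (-c * r) * Real.exp (-c * k)) := by
        refine ENNReal.tsum_le_tsum fun k => (hb _).trans (le_of_eq ?_)
        congr 1
        rw [mul_assoc, ← Real.exp_add]
        push_cast
        ring_nf
    _ = ENNReal.ofReal (∑' k : ℕ, C * Real.exp (-c * r) * Real.exp (-c * k)) := by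
        rw [ENNReal.ofReal_tsum_of_nonneg (fun _ => by positivity) (hs.mul_left _)]
    _ ≤ _ := by
        rw [tsum_mul_left]
        apply ENNReal.ofReal_le_ofReal
        have : 0 < C * Real.exp (-c * r) := by positivity
        nlinarith

end

section

variable {d : ℕ}
variable {ω ω' : Config d} {S S' : Set (ZVec d)} {x y z a b : ZVec d}

/-! ### The standing assumptions and the infinite cluster -/

/-- The standing assumptions. -/
structure Setup (d : ℕ) (p : ℝ) (μ : Measure (Config d)) (ρ cs : ℝ) : Prop where
  hd : 2 ≤ d
  p0 : 0 < p
  p1 : p < 1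
  ber : IsBernoulli d p μ
  gm : GMprop d μ ρ
  cp : CrossProp d μ cs

/-- Translation invariance as an inequality between events. -/
theorem Setup.shift_le {p ρ cs : ℝ} {μ : Measure (Config d)} (H : Setup d p μ ρ cs) (v : ZVec d)
    {P Q : Config d → Prop} (h : ∀ ω, Q ω → P (shiftC v ω)) : μ {ω | Q ω} ≤ μ {ω | P ω} :=
  (measure_mono fun ω hω => h ω hω).trans (measure_shift H.p0.le H.p1.le H.ber v P)

theorem Conn.exists_box (h : Conn ω Set.univ a b) : ∃ m : ℕ, Conn ω (bx a m) a b :=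
  ⟨_, conn_of_chemDist (chemDist_ne_top.2 h)⟩

theorem chemDist_shift_le (v : ZVec d) (h : Conn ω Set.univ (a + v) (b + v)) :
    (chemDist d ω (a + v) (b + v)).toNat ≤ (chemDist d (shiftC v ω) a b).toNat := by
  have h' : chemDist d (shiftC v ω) a b ≠ ⊤ :=
    chemDist_ne_top.2 ((conn_shift_univ v).2 h)
  refine ENat.toNat_le_toNat ?_ h'
  obtain ⟨γ, ⟨h1, h2, h3⟩, h4, -, h5, h6, h7⟩ := chemDistIn_attained h'
  refine (sInf_le ?_).trans h7.le
  refine ⟨γ.map (· + v), ⟨by simpa using h1, h2.map (add_left_injective v), ?_⟩, ?_,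
    fun _ _ => trivial, by simp [h5], by simp [h6], by simp⟩
  · exact List.isChain_map_of_isChain _ (fun x y h => adj_add v h) h3
  · exact List.isChain_map_of_isChain _ (fun x y h => (edgeOpen_shift v).1 h) h4

section

variable {p ρ cs : ℝ} {μ : Measure (Config d)}

theorem Setup.gm_dist (H : Setup d p μ ρ cs) : ∃ c : ℝ, 0 < c ∧ ∀ u v : ZVec d, ∀ t : ℝ,
    ρ * dst u v ≤ t → μ {ω | Conn ω Set.univ u v ∧ t ≤ ((chemDist d ω u v).toNat : ℝ)}
      ≤ ENNReal.ofReal (c⁻¹ * Real.exp (-c * t)) := by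
  obtain ⟨c, hc, h⟩ := H.gm.2
  refine ⟨c, hc, fun u v t ht => le_trans ?_ (h (v - u) t ?_).1⟩
  · refine H.shift_le u fun ω hω => ?_
    have hv : Conn ω Set.univ (0 + u) (v - u + u) := by simpa using hω.1
    refine ⟨chemDist_ne_top.2 ((conn_shift_univ u).2 hv), hω.2.trans ?_⟩
    have := chemDist_shift_le u hv
    rw [zero_add, sub_add_cancel] at this
    exact_mod_cast this
  · rw [dst_comm] at ht
    exact ht

/-- All pairs of connected points of `Λ_R(z)` have chemical distance controlled by `τ`. -/
def GMev (ρ τ : ℝ) (z : ZVec d) (R : ℕ) (ω : Config d) : Prop :=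
  ∀ u v, dst u z ≤ R → dst v z ≤ R → ρ * dst u v ≤ τ → Conn ω Set.univ u v →
    ((chemDist d ω u v).toNat : ℝ) < τ

theorem Setup.gmev (H : Setup d p μ ρ cs) : ∃ c : ℝ, 0 < c ∧ ∀ (z : ZVec d) (R : ℕ) (τ : ℝ),
    μ {ω | ¬ GMev ρ τ z R ω} ≤ (((2 * R + 1) ^ (2 * d) : ℕ) : ℝ≥0∞) *
      ENNReal.ofReal (c⁻¹ * Real.exp (-c * τ)) := by
  obtain ⟨c, hc, h⟩ := H.gm_dist
  refine ⟨c, hc, fun z R τ => ?_⟩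
  have h1 : {ω | ¬ GMev ρ τ z R ω} ⊆ ⋃ q ∈ bxF z R ×ˢ bxF z R, {ω | ρ * dst q.1 q.2 ≤ τ ∧
      Conn ω Set.univ q.1 q.2 ∧ τ ≤ ((chemDist d ω q.1 q.2).toNat : ℝ)} := by
    intro ω hω
    simp only [GMev, Set.mem_ofPred_eq] at hω
    push Not at hω
    obtain ⟨u, v, h1, h2, h3, h4, h5⟩ := hω
    refine Set.mem_biUnion (x := (u, v)) ?_ ⟨h3, h4, h5⟩
    simp [mem_bxF, h1, h2]
  refine (measure_mono h1).trans ((measure_biUnion_finset_le _ _).trans ?_)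
  refine (Finset.sum_le_card_nsmul _ _ (ENNReal.ofReal (c⁻¹ * Real.exp (-c * τ))) ?_).trans ?_
  · intro q _
    by_cases hq : ρ * dst q.1 q.2 ≤ τ
    · exact (measure_mono fun ω hω => hω.2).trans (h _ _ _ hq)
    · simp [hq]
  · rw [Finset.card_product, card_bxF, nsmul_eq_mul, ← pow_add, two_mul d]

/-- `x` lies in an infinite open cluster. -/
def InI (ω : Config d) (x : ZVec d) : Prop := ∀ n : ℕ, ∃ y, Conn ω Set.univ x y ∧ n ≤ dst y x

theorem inI_iff : InI ω x ↔ InInfCluster d ω x := by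
  constructor
  · intro h hf
    obtain ⟨M, hM⟩ := (hf.image fun y => dst y x).bddAbove
    obtain ⟨y, hy, hn⟩ := h (M + 1)
    have := hM ⟨y, chemDist_ne_top.2 hy, rfl⟩
    simp only at this
    omega
  · intro h n
    by_contra! hc
    refine h ((bx_finite x n).subset fun y hy => ?_)
    exact (hc y (chemDist_ne_top.1 hy)).le

theorem InI.conn (h : InI ω x) (hxy : Conn ω Set.univ x y) : InI ω y := fun n => by
  obtain ⟨w, hw, hn⟩ := h (n + dst x y)
  refine ⟨w, hxy.symm.trans hw, ?_⟩
  have := dst_triangle w y x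
  rw [dst_comm y x] at this
  omega

theorem inI_shift (v : ZVec d) : InI (shiftC v ω) x ↔ InI ω (x + v) := by
  refine forall_congr' fun n => ⟨?_, ?_⟩
  · rintro ⟨y, h1, h2⟩
    exact ⟨y + v, (conn_shift_univ v).1 h1, by rwa [dst_add_right]⟩
  · rintro ⟨y, h1, h2⟩
    refine ⟨y - v, (conn_shift_univ v).2 (by simpa using h1), ?_⟩
    rwa [← dst_add_right _ _ v, sub_add_cancel]

theorem measurableSet_conn_univ (a b : ZVec d) : MeasurableSet {ω | Conn ω Set.univ a b} := by
  have : {ω | Conn ω Set.univ a b} = ⋃ m : ℕ, {ω | Conn ω (bx a m) a b} := by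
    ext ω
    simp only [Set.mem_iUnion, Set.mem_ofPred_eq]
    exact ⟨Conn.exists_box, fun ⟨m, h⟩ => h.mono (Set.subset_univ _)⟩
  rw [this]
  exact MeasurableSet.iUnion fun m => loc_conn.measurableSet (edgesIn_finite (bx_finite _ _))

theorem measurableSet_inI (x : ZVec d) : MeasurableSet {ω | InI ω x} := by
  have : {ω | InI ω x} = ⋂ n : ℕ, ⋃ y : ZVec d, {ω | Conn ω Set.univ x y ∧ n ≤ dst y x} := by
    ext ω
    simp [InI]
  rw [this]
  refine MeasurableSet.iInter fun n => MeasurableSet.iUnion fun y => ?_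
  by_cases h : n ≤ dst y x
  · simpa [h] using measurableSet_conn_univ x y
  · simp [h]

theorem starPt_eq_self (h : InI ω x) : starPt d ω x = x := by
  have hex : ∃ y, InInfCluster d ω y ∧ ∀ z, InInfCluster d ω z →
      normInf d (y - x) ≤ normInf d (z - x) := ⟨x, inI_iff.1 h, fun z _ => by simp [normInf]⟩
  rw [starPt, dif_pos hex]
  have h1 := hex.choose_spec.2 x (inI_iff.1 h)
  refine eq_of_dst_eq_zero (Nat.le_zero.1 (h1.trans ?_))
  simp [normInf]

theorem Setup.ae_star (H : Setup d p μ ρ cs) : ∀ᵐ ω ∂μ, ∀ x : ZVec d,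
    Conn ω Set.univ (starPt d ω 0) (starPt d ω x) := by
  obtain ⟨c, hc, h⟩ := H.gm.2
  rw [ae_all_iff]
  intro x
  rw [ae_iff]
  refine le_antisymm ?_ zero_le
  have hlim : Filter.Tendsto (fun t : ℝ => ENNReal.ofReal (c⁻¹ * Real.exp (-c * t)))
      Filter.atTop (nhds 0) := by
    rw [← ENNReal.ofReal_zero, ← mul_zero c⁻¹]
    refine ENNReal.tendsto_ofReal (Filter.Tendsto.const_mul _ ?_)
    exact Real.tendsto_exp_atBot.comp (Filter.tendsto_id.const_mul_atTop_of_neg (neg_lt_zero.2 hc))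
  refine ge_of_tendsto hlim ?_
  filter_upwards [Filter.eventually_ge_atTop (ρ * (normInf d x : ℝ))] with t ht
  refine (measure_mono fun ω hω => ?_).trans (h x t ht).2
  right
  by_contra hc
  exact hω (chemDist_ne_top.1 hc)

theorem Setup.ae_inI (H : Setup d p μ ρ cs) : ∀ᵐ ω ∂μ, (∃ x, InI ω x) ∧
    ∀ x y, InI ω x → InI ω y → Conn ω Set.univ x y := by
  have h1 : ∀ᵐ ω ∂μ, ∃ x, InI ω x := by
    filter_upwards [H.ae_star] with ω hω
    by_contra! hc
    have h2 : ∀ x, starPt d ω x = x := fun x => by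
      rw [starPt, dif_neg]
      rintro ⟨y, hy, -⟩
      exact hc y (inI_iff.2 hy)
    simp only [h2] at hω
    refine hc 0 fun n => ⟨fun _ => n, hω _, ?_⟩
    have := coord_le_dst (fun _ => (n : ℤ)) (0 : ZVec d) ⟨0, by have := H.hd; omega⟩
    simp at this
    omega
  have h2 : ∀ᵐ ω ∂μ, ∀ y, InI ω 0 → InI ω y → Conn ω Set.univ 0 y := by
    filter_upwards [H.ae_star] with ω hω y h0 hy
    have := hω y
    rwa [starPt_eq_self h0, starPt_eq_self hy] at this
  have h3 : ∀ᵐ ω ∂μ, ∀ x y, InI ω x → InI ω y → Conn ω Set.univ x y := by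
    rw [ae_all_iff]
    intro x
    rw [ae_iff] at h2 ⊢
    refine le_antisymm (le_trans (H.shift_le x fun ω hω => ?_) h2.le) zero_le
    intro hc
    apply hω
    intro y hx hy
    have h4 := hc (y - x) ((inI_shift x).2 (by simpa using hx))
      ((inI_shift x).2 (by simpa using hy))
    have h5 := (conn_shift_univ x).1 h4
    rwa [zero_add, sub_add_cancel] at h5
  filter_upwards [h1, h3] with ω h4 h5 using ⟨h4, h5⟩

/-- The probability that the infinite cluster misses `Λ_r`. -/
def noI (μ : Measure (Config d)) (r : ℕ) : ℝ≥0∞ := μ {ω | ∀ x, dst x 0 ≤ r → ¬ InI ω x}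

theorem Setup.noI_tendsto (H : Setup d p μ ρ cs) :
    Filter.Tendsto (noI μ) Filter.atTop (nhds 0) := by
  have := H.ber.1
  have h0 : μ (⋂ r : ℕ, {ω | ∀ x, dst x 0 ≤ r → ¬ InI ω x}) = 0 := by
    have h1 := H.ae_inI
    rw [ae_iff] at h1
    refine le_antisymm (le_trans (measure_mono fun ω hω => ?_) h1.le) zero_le
    rintro ⟨⟨x, hx⟩, -⟩
    rw [Set.mem_iInter] at hω
    exact hω (dst x 0) x le_rfl hx
  rw [← h0]
  refine tendsto_measure_iInter_atTop (fun r => ?_) ?_ ⟨0, measure_ne_top _ _⟩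
  · refine MeasurableSet.nullMeasurableSet ?_
    have : {ω : Config d | ∀ x, dst x 0 ≤ r → ¬ InI ω x} =
        ⋂ x : ZVec d, ⋂ _ : dst x 0 ≤ r, {ω | InI ω x}ᶜ := by
      ext ω
      simp
    rw [this]
    exact MeasurableSet.iInter fun x => MeasurableSet.iInter fun _ => (measurableSet_inI x).compl
  · intro r s hrs ω hω x hx
    exact hω x (hx.trans hrs)

theorem Setup.noI_at (H : Setup d p μ ρ cs) (z : ZVec d) (r : ℕ) :
    μ {ω | ∀ x, dst x z ≤ r → ¬ InI ω x} ≤ noI μ r := by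
  refine H.shift_le z fun ω hω x hx hI => ?_
  refine hω (x + z) ?_ ((inI_shift z).1 hI)
  rw [← dst_add_right x 0 z, zero_add] at hx
  exact hx

end

end

section

variable {d : ℕ}
variable {ω ω' : Config d} {S S' : Set (ZVec d)} {x y z a b : ZVec d} {K : ℕ}

/-! ### Good boxes at a given scale -/

/-- `a` belongs to a large open cluster of `Λ_r(z)`. -/
def Seed (ω : Config d) (z : ZVec d) (r : ℕ) (a : ZVec d) : Prop :=
  ∃ b, Conn ω (bx z r) a b ∧ r ≤ 2 * dst a b

/-- Existence and local uniqueness of large clusters around `Λ_r(z)`. -/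
def Good (K : ℕ) (ω : Config d) (z : ZVec d) (r : ℕ) : Prop :=
  (∃ a, Seed ω z r a) ∧ ∀ a b a' b', Conn ω (bx z (4 * r)) a b → r ≤ 4 * dst a b →
    Conn ω (bx z (4 * r)) a' b' → r ≤ 4 * dst a' b' → Conn ω (bx z (K * r)) a a'

theorem Good.link {z' a' : ZVec d} {r r' : ℕ} (h : Good K ω z' r') (ha : Seed ω z r a)
    (ha' : Seed ω z' r' a') (hz : dst z z' + r ≤ 4 * r') (hr : r' ≤ 2 * r) :
    Conn ω (bx z' (K * r')) a a' := by
  obtain ⟨b, h1, h2⟩ := ha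
  obtain ⟨b', h1', h2'⟩ := ha'
  exact h.2 a b a' b' (h1.mono (bx_mono hz)) (by omega)
    (h1'.mono (bx_mono (by rw [dst_self]; omega))) (by omega)

theorem loc_good (hK : 4 ≤ K) (z : ZVec d) (r : ℕ) :
    Loc (edgesIn (bx z (K * r))) fun ω => Good K ω z r := by
  intro ω ω' hω
  have h1 : ∀ m ≤ 4 * r, ∀ a b, Conn ω (bx z m) a b ↔ Conn ω' (bx z m) a b := fun m hm a b =>
    conn_congr hω (edgesIn_mono (bx_mono (by rw [dst_self]; nlinarith)))
  have h2 : ∀ a b, Conn ω (bx z (K * r)) a b ↔ Conn ω' (bx z (K * r)) a b := fun a b =>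
    conn_congr hω subset_rfl
  simp only [Good, Seed, h1 r (by omega), h1 (4 * r) le_rfl, h2]

theorem conn_chain (f : ℕ → ZVec d) (n : ℕ) (h0 : f 0 ∈ S)
    (h : ∀ j < n, Conn ω S (f j) (f (j + 1))) : Conn ω S (f 0) (f n) := by
  induction n with
  | zero => exact .refl h0
  | succ n ih => exact (ih fun j hj => h j (by omega)).trans (h n (by omega))

theorem pathCost_nonneg (n : ℕ) (γ : List (ZVec d)) : 0 ≤ pathCost d n ω γ := by
  induction γ with
  | nil => simp [pathCost]
  | cons x l ih =>
    cases l with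
    | nil => simp [pathCost]
    | cons y l =>
      rw [pathCost]
      have : 0 ≤ pairWeight d n ω x y := by
        unfold pairWeight
        split_ifs <;> positivity
      positivity

theorem gstar_of_open {n : ℕ} {A : Set (ZVec d)} {γ : List (ZVec d)} (h1 : IsPath d γ)
    (h2 : IsOpenPath d ω γ) (h3 : ∀ v ∈ γ, v ∈ A) : GstarIn d n ω A γ := by
  obtain ⟨x, hx⟩ := List.exists_mem_of_ne_nil γ h1.1
  refine ⟨h1, h3, [x], ⟨⟨by simp, by simp, List.isChain_singleton _⟩, by simpa using h3 x hx,
    fun π' _ _ _ _ => ?_⟩, fun u v huv _ => ?_⟩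
  · simpa [pathCost] using pathCost_nonneg n π'
  · have key : ∀ l : List (ZVec d), IsOpenPath d ω l → ∀ u v, (u, v) ∈ l.zip l.tail →
        EdgeOpen d ω u v := by
      intro l
      induction l with
      | nil => simp
      | cons x l ih =>
        cases l with
        | nil => simp
        | cons y l =>
          intro hl u v huv
          have hl' := List.isChain_cons_cons.1 hl
          simp only [List.tail_cons, List.zip_cons_cons, List.mem_cons, Prod.mk.injEq] at huv
          rcases huv with ⟨rfl, rfl⟩ | h
          · exact hl'.1
          · exact ih hl'.2 u v h
    rcases huv with h | h
    · exact key γ h2 u v h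
    · exact (key γ h2 v u h).symm

/-- Outside the exceptional event, a large cluster meets a crossing cluster. -/
theorem inI_of_not_ENevent {n s : ℕ} {t : ℝ} (ht : 1 ≤ t) (hs : 1 ≤ s)
    (hE : shiftC a ω ∉ ENevent d n t s) {v0 : ZVec d} (hv0 : InI ω v0)
    (hcr : ∀ i : Fin d, ∃ u v, Conn ω (bx a (2 * s)) u v ∧ u i = a i - 2 * s ∧
      v i = a i + 2 * s ∧ Conn ω Set.univ v0 u)
    (hab : Conn ω (bx a s) a b) (hb : dst b a = s) : InI ω a := by
  by_contra hna
  apply hE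
  refine ⟨v0 - a, fun i => ?_, ?_⟩
  · obtain ⟨u, v, h1, h2, h3, h4⟩ := hcr i
    have h1' : Conn (shiftC a ω) (bx 0 (2 * s)) (u - a) (v - a) :=
      (conn_shift_box a _).2 (by simpa using h1)
    obtain ⟨γ, g1, g2, g3, g4, g5⟩ := h1'.exists_path
    refine ⟨γ, g1, g2, fun w hw => ⟨?_, g3 w hw⟩, ⟨_, List.mem_of_head? g4, by simp [h2]⟩,
      ⟨_, mem_of_getLast? g5, by simp [h3]⟩⟩
    refine chemDist_ne_top.2 (Conn.trans ((conn_shift_univ a).2 (by simpa using h4))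
      ((conn_of_list g2 g3 g4 w hw).mono (Set.subset_univ _)))
  · have h1' : Conn (shiftC a ω) (bx 0 s) (a - a) (b - a) :=
      (conn_shift_box a _).2 (by simpa using hab)
    obtain ⟨γ, g1, g2, g3, g4, g5⟩ := h1'.exists_path
    obtain ⟨i, hi⟩ := exists_coord_dst b a (by omega)
    refine ⟨γ, g1, g3, gstar_of_open g1 g2 fun w hw => ?_, ⟨i, _, mem_of_getLast? g5, _,
      List.mem_of_head? g4, ?_⟩, fun w hw hc => hna ?_⟩
    · have h2 : dst w 0 ≤ s := g3 w hw
      have h3 : (dst w 0 : ℝ) ≤ s := by exact_mod_cast h2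
      change (dst w 0 : ℝ) ≤ t * s
      nlinarith
    · have h2 : |((b i - a i : ℤ) : ℝ)| = (s : ℝ) := by rw [← Int.cast_abs, hi, hb]; simp
      have h3 : (((b - a) i : ℤ) : ℝ) - (((a - a) i : ℤ) : ℝ) = ((b i - a i : ℤ) : ℝ) := by simp
      rw [h3, h2]
      have : (0 : ℝ) ≤ s := by positivity
      linarith
    · have h2 : Conn (shiftC a ω) Set.univ (a - a) (v0 - a) :=
        ((conn_of_list g2 g3 g4 w hw).mono (Set.subset_univ _)).trans (chemDist_ne_top.1 hc).symm
      have h3 := (conn_shift_univ a).1 h2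
      simp only [sub_self, zero_add, sub_add_cancel] at h3
      exact hv0.conn h3.symm

/-- The infinite cluster crosses boxes when it is dense and well connected. -/
theorem cross_of_dense {ρ : ℝ} {s h κ R : ℕ} (hh : 1 ≤ h) (hκ : (2 : ℝ) + 5 * ρ ≤ κ) (hρ : 1 ≤ ρ)
    (hκs : κ * h ≤ 2 * s) (hI : ∀ x y, InI ω x → InI ω y → Conn ω Set.univ x y)
    (hd : ∀ w, dst w z + 4 * s ≤ R → ∃ x, InI ω x ∧ dst x w ≤ 2 * h) (ha : dst a z + 8 * s ≤ R)
    (hgm : GMev ρ (5 * ρ * h) z R ω) (i : Fin d) :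
    ∃ u v, Conn ω (bx a (2 * s)) u v ∧ u i = a i - 2 * s ∧ v i = a i + 2 * s ∧ InI ω u := by
  set M := 2 * s + κ * h with hM
  have hκ' : 2 * h ≤ κ * h := by
    have : (2 : ℝ) ≤ κ := by linarith
    have : 2 ≤ κ := by exact_mod_cast this
    gcongr
  let w : ℕ → ZVec d := fun j => Function.update a i (a i - M + (min j (2 * M) : ℕ))
  have hwi : ∀ j, w j i = a i - M + (min j (2 * M) : ℕ) := fun j => by simp [w]
  have hwk : ∀ j k, k ≠ i → w j k = a k := fun j k hk => by simp [w, hk]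
  have hwa : ∀ j, dst (w j) a ≤ M := fun j => dst_le.2 fun k => by
    by_cases hk : k = i
    · subst hk
      rw [hwi, abs_le]
      omega
    · rw [hwk j k hk]; simp
  have hww : ∀ j, dst (w j) (w (j + 1)) ≤ 1 := fun j => dst_le.2 fun k => by
    by_cases hk : k = i
    · subst hk
      rw [hwi, hwi, abs_le]
      omega
    · rw [hwk j k hk, hwk _ k hk]; simp
  have hwz : ∀ j, dst (w j) z + 4 * s ≤ R := fun j => by
    have := dst_triangle (w j) a z
    have := hwa j
    omega
  choose f hfI hf using fun j => hd (w j) (hwz j)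
  let T : Set (ZVec d) := {x | ∀ k, k ≠ i → |x k - a k| ≤ 2 * s}
  have hT : ∀ j x, dst x (w j) ≤ κ * h → x ∈ T := fun j x hx k hk => by
    have := coord_le_dst x (w j) k
    rw [hwk j k hk] at this
    have h2 : ((κ * h : ℕ) : ℤ) ≤ 2 * s := by exact_mod_cast hκs
    have h3 : (dst x (w j) : ℤ) ≤ ((κ * h : ℕ) : ℤ) := by exact_mod_cast hx
    omega
  have hstep : ∀ j < 2 * M, Conn ω T (f j) (f (j + 1)) := by
    intro j _
    have h1 : dst (f j) (f (j + 1)) ≤ 5 * h := by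
      have := dst_triangle (f j) (w j) (f (j + 1))
      have := dst_triangle (w j) (w (j + 1)) (f (j + 1))
      have := hf j
      have := hf (j + 1)
      have := hww j
      rw [dst_comm (w (j + 1))] at *
      omega
    have h2 := hI _ _ (hfI j) (hfI (j + 1))
    have hz : ∀ j, dst (f j) z ≤ R := fun j => by
      have := dst_triangle (f j) (w j) z
      have := hwz j
      have := hf j
      omega
    have h3 := hgm _ _ (hz j) (hz (j + 1)) (by
      have : (dst (f j) (f (j + 1)) : ℝ) ≤ 5 * h := by exact_mod_cast h1
      nlinarith) h2
    refine (conn_of_chemDist (chemDist_ne_top.2 h2)).mono fun x hx => hT j x ?_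
    have h4 := dst_triangle x (f j) (w j)
    have hx' : dst x (f j) ≤ _ := hx
    have h5 : ((dst x (f j) : ℕ) : ℝ) ≤ 5 * ρ * h :=
      (Nat.cast_le.2 hx').trans h3.le
    have h6 : (dst x (w j) : ℝ) ≤ dst x (f j) + dst (f j) (w j) := by exact_mod_cast h4
    have h7 : (dst (f j) (w j) : ℝ) ≤ 2 * h := by exact_mod_cast hf j
    have h8 : (0 : ℝ) < h := by exact_mod_cast hh
    have : (dst x (w j) : ℝ) ≤ ((κ * h : ℕ) : ℝ) := by push_cast; nlinarith
    exact_mod_cast this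
  have hc := conn_chain f (2 * M) (hT 0 _ ((hf 0).trans hκ')) hstep
  have h0 := coord_le_dst (f 0) (w 0) i
  have h0' := hf 0
  have h1 := coord_le_dst (f (2 * M)) (w (2 * M)) i
  have h1' := hf (2 * M)
  rw [hwi, abs_le] at h0 h1
  have hκi : (2 * h : ℤ) ≤ κ * h := by exact_mod_cast hκ'
  have hMi : (M : ℤ) = 2 * s + κ * h := by rw [hM]; push_cast; ring
  obtain ⟨u, v, g1, g2, g3, g4⟩ := hc.cut (i := i) (α := a i - 2 * s) (β := a i + 2 * s)
    (by omega) (by omega) (by omega)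
  refine ⟨u, v, g1.mono fun x hx => dst_le.2 fun k => ?_, g2, g3,
    (hfI 0).conn (g4.mono (Set.subset_univ _))⟩
  by_cases hk : k = i
  · subst hk
    have := hx.2
    simp only [Set.mem_ofPred_eq] at this
    rw [abs_le]
    push_cast
    omega
  · exact_mod_cast hx.1 k hk

end

section

variable {d : ℕ}
variable {ω ω' : Config d} {S S' : Set (ZVec d)} {x y z a b : ZVec d} {K : ℕ}
  {p ρ cs : ℝ} {μ : Measure (Config d)}

/-! ### Good boxes are likely -/

theorem exists_grid {h G R : ℕ} (hh : 1 ≤ h) (hG : R ≤ (G - 1) * h) (hG1 : 1 ≤ G) {w : ZVec d}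
    (hw : dst w z ≤ R) : ∃ g ∈ bxF (0 : ZVec d) G, dst (z + h • g) w ≤ h := by
  refine ⟨fun i => (w i - z i) / h, mem_bxF.2 (dst_le.2 fun i => ?_), dst_le.2 fun i => ?_⟩
  · have h1 := abs_le.1 (coord_le_dst w z i)
    have h2 : (dst w z : ℤ) ≤ (G - 1) * h := by
      have := hw.trans hG
      zify [hG1] at this
      exact this
    have hh' : (0 : ℤ) < h := by exact_mod_cast hh
    rw [Pi.zero_apply, sub_zero, abs_le]
    constructor
    · rw [Int.le_ediv_iff_mul_le hh']
      nlinarith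
    · have : (w i - z i) / (h : ℤ) < G := by
        rw [Int.ediv_lt_iff_lt_mul hh']
        nlinarith
      exact this.le
  · have hh' : (0 : ℤ) < h := by exact_mod_cast hh
    have h1 := Int.emod_add_mul_ediv (w i - z i) h
    have h2 := Int.emod_nonneg (w i - z i) hh'.ne'
    have h3 := Int.emod_lt_of_pos (w i - z i) hh'
    simp only [Pi.add_apply, nsmul_eq_mul, Pi.mul_apply, Pi.natCast_apply]
    rw [abs_le]
    constructor <;> linarith

theorem good_of_events {n r s h κ : ℕ} (hρ : 1 ≤ ρ) (hcs : 0 < cs) (hcs1 : cs < 1)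
    (hh : 1 ≤ h) (hs : 1 ≤ s) (hsr : 8 * s ≤ r) (hhr : 8 * h ≤ r)
    (hκ : (2 : ℝ) + 5 * ρ ≤ κ) (hκs : κ * h ≤ 2 * s) (hK : (4 : ℝ) + 8 * ρ ≤ K)
    (hI : ∀ x y, InI ω x → InI ω y → Conn ω Set.univ x y)
    (hd : ∀ w, dst w z ≤ 6 * r → ∃ x, InI ω x ∧ dst x w ≤ 2 * h)
    (hg1 : GMev ρ (8 * ρ * r) z (6 * r) ω) (hg2 : GMev ρ (5 * ρ * h) z (6 * r) ω)
    (hE : ∀ a, dst a z ≤ 4 * r → shiftC a ω ∉ ENevent d n (1 / cs) s) : Good K ω z r := by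
  have hbig : ∀ a b, Conn ω (bx z (4 * r)) a b → r ≤ 4 * dst a b → InI ω a := by
    intro a b hab hr
    have ha : dst a z ≤ 4 * r := hab.mem_left
    obtain ⟨v0, hv0, -⟩ := hd z (by simp)
    obtain ⟨e, he, hes⟩ := hab.exit_ball (l := s) (by rw [dst_comm]; omega)
    refine inI_of_not_ENevent (by rw [le_div_iff₀ hcs]; linarith) hs (hE a ha) hv0 (fun i => ?_)
      (he.mono Set.inter_subset_right) hes
    obtain ⟨u, v, h1, h2, h3, h4⟩ := cross_of_dense hh hκ hρ hκs hI (z := z) (R := 6 * r)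
      (fun w hw => hd w (by omega)) (a := a) (by omega) hg2 i
    exact ⟨u, v, h1, h2, h3, hI _ _ hv0 h4⟩
  refine ⟨?_, fun a b a' b' h1 h2 h3 h4 => ?_⟩
  · obtain ⟨x, hx, hxz⟩ := hd z (by simp)
    obtain ⟨y, hy, hyx⟩ := hx ((r + 1) / 2)
    obtain ⟨e, he, hes⟩ := hy.exit_ball hyx
    refine ⟨x, e, he.mono fun u hu => ?_, by rw [dst_comm]; omega⟩
    have h1 : dst u x ≤ (r + 1) / 2 := hu.2
    have := dst_triangle u x z
    change dst u z ≤ r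
    omega
  · have ha := hbig a b h1 h2
    have ha' := hbig a' b' h3 h4
    have hc := hI a a' ha ha'
    have haz : dst a z ≤ 4 * r := h1.mem_left
    have haz' : dst a' z ≤ 4 * r := h3.mem_left
    have hd8 : dst a a' ≤ 8 * r := by
      have := dst_triangle a z a'
      rw [dst_comm z a'] at this
      omega
    have h5 := hg1 a a' (by omega) (by omega) (by
      have : (dst a a' : ℝ) ≤ 8 * r := by exact_mod_cast hd8
      nlinarith) hc
    refine (conn_of_chemDist (chemDist_ne_top.2 hc)).mono fun u hu => ?_
    have h6 : (dst u a : ℝ) < 8 * ρ * r := lt_of_le_of_lt (Nat.cast_le.2 hu) h5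
    have h7 : (dst u z : ℝ) ≤ dst u a + dst a z := by exact_mod_cast dst_triangle u a z
    have h8 : (dst a z : ℝ) ≤ 4 * r := by exact_mod_cast haz
    have h9 : (dst u z : ℝ) ≤ ((K * r : ℕ) : ℝ) := by
      push_cast
      have : (0 : ℝ) ≤ r := by positivity
      nlinarith
    exact_mod_cast h9

theorem exists_n_large {c : ℝ} (hc : 0 < c) (s : ℕ) :
    ∃ n : ℕ, 2 ≤ n ∧ (s : ℝ) ≤ Real.exp (c * (Real.log n) ^ 2) := by
  have h1 : Filter.Tendsto (fun n : ℕ => Real.log n) Filter.atTop Filter.atTop :=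
    Real.tendsto_log_atTop.comp tendsto_natCast_atTop_atTop
  obtain ⟨n, h2, h3⟩ := ((h1.eventually_ge_atTop (max 1 (Real.log s / c))).and
    (Filter.eventually_ge_atTop 2)).exists
  refine ⟨n, h3, (Real.le_exp_log _).trans (Real.exp_le_exp.2 ?_)⟩
  have h4 := (le_max_left _ _).trans h2
  have h5 := (div_le_iff₀ hc).1 ((le_max_right _ _).trans h2)
  nlinarith [mul_nonneg hc.le (mul_nonneg (zero_le_one.trans h4) (sub_nonneg.2 h4))]

/-- The probability that `Λ_r(z)` is not good is controlled by the density of the infinite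
cluster. -/
theorem Setup.not_good_le (H : Setup d p μ ρ cs) : ∃ K B Q : ℕ, ∃ f : ℕ → ℝ≥0∞, 4 ≤ K ∧ 0 < Q ∧
    (4 : ℝ) + 8 * ρ ≤ K ∧ ExpSmall f ∧ ∀ (z : ZVec d) (r : ℕ),
      μ {ω | ¬ Good K ω z r} ≤ B * noI μ (r / Q) + f r := by
  obtain ⟨c, hc, hgm⟩ := H.gmev
  obtain ⟨hcs, hcs1, hcp⟩ := H.cp
  have hρ := H.gm.1
  have := H.ber.1
  obtain ⟨κ, hκ⟩ := exists_nat_ge (2 + 5 * ρ)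
  obtain ⟨K, hK⟩ := exists_nat_ge (4 + 8 * ρ)
  have hK4 : 4 ≤ K := by
    have : (4 : ℝ) ≤ K := by linarith
    exact_mod_cast this
  have hκ1 : 1 ≤ κ := by
    have : (1 : ℝ) ≤ κ := by linarith
    exact_mod_cast this
  set Q := 16 * κ with hQ
  set G := 12 * Q + 1 with hG
  let F : ℕ → ℝ≥0∞ := fun r =>
    ((12 * r + 1) ^ (2 * d) : ℕ) * ENNReal.ofReal (c⁻¹ * Real.exp (-(c * (8 * ρ)) * r)) +
    ((12 * r + 1) ^ (2 * d) : ℕ) * ENNReal.ofReal (c⁻¹ * Real.exp (-(c * (5 * ρ)) * (r / Q : ℕ))) +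
    ((8 * r + 1) ^ d : ℕ) * ENNReal.ofReal (cs⁻¹ * Real.exp (-cs * (r / 8 : ℕ)))
  have hF : ExpSmall F := by
    refine (ExpSmall.add ?_ ?_).add ?_
    · exact (expSmall_exp (inv_pos.2 hc) (by positivity)).poly _ _ _
    · exact ((expSmall_exp (inv_pos.2 hc) (c := c * (5 * ρ)) (by positivity)).div Q
        (by omega)).poly _ _ _
    · exact ((expSmall_exp (inv_pos.2 hcs) hcs).div 8 (by omega)).poly _ _ _
  have hmain : ∀ (z : ZVec d) (r : ℕ), Q ≤ r →
      μ {ω | ¬ Good K ω z r} ≤ ((2 * G + 1) ^ d : ℕ) * noI μ (r / Q) + F r := by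
    intro z r hr
    set h := r / Q with hh
    set s := r / 8 with hs
    have hh1 : 1 ≤ h := (Nat.one_le_div_iff (by omega)).2 hr
    have hhQ : h * Q ≤ r := Nat.div_mul_le_self r Q
    have hhr : r < h * Q + Q := Nat.lt_div_mul_add (by omega)
    have hκs : κ * h ≤ 2 * s := by
      have : 16 * (κ * h) ≤ r := by rw [hQ] at hhQ; nlinarith
      omega
    obtain ⟨n, hn2, hn⟩ := exists_n_large hcs s
    have hsub : {ω | ¬ Good K ω z r} ⊆ {ω | ¬ ((∃ x, InI ω x) ∧
        ∀ x y, InI ω x → InI ω y → Conn ω Set.univ x y)} ∪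
        ((⋃ g ∈ bxF (0 : ZVec d) G, {ω | ∀ x, dst x (z + h • g) ≤ h → ¬ InI ω x}) ∪
        (({ω | ¬ GMev ρ (8 * ρ * r) z (6 * r) ω} ∪ {ω | ¬ GMev ρ (5 * ρ * h) z (6 * r) ω}) ∪
        ⋃ a ∈ bxF z (4 * r), {ω | shiftC a ω ∈ ENevent d n (1 / cs) s})) := by
      intro ω hω
      by_contra hc
      simp only [Set.mem_union, Set.mem_iUnion, Set.mem_ofPred_eq, not_or, not_exists, not_not,
        not_forall] at hc
      obtain ⟨⟨-, c1⟩, c2, ⟨c3, c4⟩, c5⟩ := hc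
      refine hω (good_of_events (n := n) (s := s) (h := h) hρ hcs hcs1 hh1 (by omega) (by omega)
        (by nlinarith) hκ hκs hK c1 (fun w hw => ?_) c3 c4 fun a ha => c5 a (mem_bxF.2 ha))
      obtain ⟨g, hg, hgw⟩ := exists_grid (G := G) hh1 (by rw [hG]; simp; nlinarith) (by omega) hw
      obtain ⟨x, hx, hxI⟩ := c2 g hg
      refine ⟨x, hxI, ?_⟩
      have := dst_triangle x (z + h • g) w
      omega
    refine (measure_mono hsub).trans ((measure_union_le _ _).trans ?_)
    rw [ae_iff.1 H.ae_inI, zero_add]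
    refine (measure_union_le _ _).trans (add_le_add ?_ ((measure_union_le _ _).trans
      (add_le_add ((measure_union_le _ _).trans (add_le_add ?_ ?_)) ?_)))
    · refine (measure_biUnion_finset_le _ _).trans ((Finset.sum_le_card_nsmul _ _ (noI μ h)
        fun g _ => H.noI_at _ _).trans ?_)
      rw [card_bxF, nsmul_eq_mul]
    · refine (hgm z (6 * r) _).trans (le_of_eq ?_)
      rw [show 2 * (6 * r) + 1 = 12 * r + 1 by ring,
        show -c * (8 * ρ * r) = -(c * (8 * ρ)) * r by ring]
    · refine (hgm z (6 * r) _).trans (le_of_eq ?_)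
      rw [show 2 * (6 * r) + 1 = 12 * r + 1 by ring,
        show -c * (5 * ρ * h) = -(c * (5 * ρ)) * h by ring]
    · refine (measure_biUnion_finset_le _ _).trans ((Finset.sum_le_card_nsmul _ _
        (ENNReal.ofReal (cs⁻¹ * Real.exp (-cs * s))) fun a _ => ?_).trans ?_)
      · refine (measure_shift H.p0.le H.p1.le H.ber a (fun ω => ω ∈ ENevent d n (1 / cs) s)).trans ?_
        exact hcp n hn2 _ le_rfl s (by omega) hn
      · rw [card_bxF, nsmul_eq_mul, show 2 * (4 * r) + 1 = 8 * r + 1 by ring]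
  refine ⟨K, (2 * G + 1) ^ d, Q, fun r => if Q ≤ r then F r else 1, hK4, by omega, hK, ?_, ?_⟩
  · refine ExpSmall.of_eventually (f := fun r => if Q ≤ r then min (F r) 1 else 1)
      (g := F) (fun r => ?_) Q hF (fun r hr => ?_) |>.add hF |>.mono fun r => ?_
    · split_ifs <;> simp
    · simp [hr]
    · split_ifs
      · exact le_add_self
      · exact le_self_add
  · intro z r
    by_cases hr : Q ≤ r
    · simpa [hr] using hmain z r hr
    · simp only [hr, if_false]
      exact prob_le_one.trans le_add_self

end

section

variable {d : ℕ}
/-! ### Chains of bad items -/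

theorem exists_nodup_chain {α : Type*} {r : α → α → Prop} {a b : α}
    (h : Relation.ReflTransGen r a b) :
    ∃ l : List α, (a :: l).IsChain r ∧ (a :: l).Nodup ∧ (a :: l).getLast? = some b := by
  induction h using Relation.ReflTransGen.head_induction_on with
  | refl => exact ⟨[], by simp, by simp, by simp⟩
  | head hac hcb ih =>
    rename_i a c
    obtain ⟨l, h1, h2, h3⟩ := ih
    by_cases ha : a ∈ c :: l
    · obtain ⟨s, t, hst⟩ := List.append_of_mem ha
      rw [hst] at h1 h2 h3
      exact ⟨t, h1.right_of_append, (List.nodup_append.1 h2).2.1, by simpa using h3⟩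
    · exact ⟨c :: l, List.isChain_cons_cons.2 ⟨hac, h1⟩, List.nodup_cons.2 ⟨ha, h2⟩, by simpa using h3⟩

section PathBad

set_option linter.unusedSectionVars false

variable {Θ : Type*} [Fintype Θ] (rad : Θ → ℕ) (κ : ℕ)

/-- An item: a location together with a type. -/
abbrev Item (d : ℕ) (Θ : Type*) := (_ : Θ) × ZVec d

/-- Items close to a given location. -/
def nbrItems (u : ZVec d) (r : ℕ) : Finset (Item d Θ) :=
  Finset.univ.sigma fun θ => bxF u (3 * κ * (r + rad θ) + 1)

/-- Chains of `n` items. -/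
def chainsF : ℕ → ZVec d → ℕ → Finset (List (Item d Θ))
  | 0, _, _ => {[]}
  | n + 1, u, r => (nbrItems rad κ u r).biUnion fun i =>
      (chainsF n i.2 (rad i.1)).image (List.cons i)

theorem mem_chainsF {l : List (Item d Θ)} : ∀ {u : ZVec d} {r : ℕ},
    (∀ i, l.head? = some i → dst u i.2 ≤ 3 * κ * (r + rad i.1) + 1) →
    l.IsChain (fun i j => dst i.2 j.2 ≤ 3 * κ * (rad i.1 + rad j.1) + 1) →
    l ∈ chainsF rad κ l.length u r := by
  induction l with
  | nil => intro u r _ _; simp [chainsF]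
  | cons i l ih =>
    intro u r h hc
    simp only [List.length_cons, chainsF, Finset.mem_biUnion, Finset.mem_image]
    refine ⟨i, ?_, l, ih (fun j hj => ?_) hc.tail, rfl⟩
    · simp only [nbrItems, Finset.mem_sigma, Finset.mem_univ, true_and, mem_bxF]
      rw [dst_comm]; exact h i rfl
    · cases l with
      | nil => simp at hj
      | cons k l =>
        simp only [List.head?_cons, Option.some.injEq] at hj
        subst hj
        exact (List.isChain_cons_cons.1 hc).1

theorem sum_chainsF_le (hrad : ∀ θ, 1 ≤ rad θ) (hκ : 1 ≤ κ) (w : Θ → ℝ≥0∞) (q : ℝ≥0∞)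
    (hq : ∑ θ, ((15 * κ) ^ d * rad θ ^ (2 * d) : ℕ) * w θ ≤ q) (n : ℕ) :
    ∀ (u : ZVec d) (r : ℕ), 1 ≤ r →
      ∑ l ∈ chainsF rad κ n u r, (l.map fun i => w i.1).prod ≤ (r ^ d : ℕ) * q ^ n := by
  induction n with
  | zero =>
    intro u r hr
    simp only [chainsF, Finset.sum_singleton, List.map_nil, List.prod_nil, pow_zero, mul_one]
    exact_mod_cast Nat.one_le_pow _ _ hr
  | succ n ih =>
    intro u r hr
    rw [chainsF, Finset.sum_biUnion]
    swap
    · intro i _ j _ hij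
      rw [Function.onFun, Finset.disjoint_left]
      intro l h1 h2
      obtain ⟨l1, -, rfl⟩ := Finset.mem_image.1 h1
      obtain ⟨l2, -, h⟩ := Finset.mem_image.1 h2
      exact hij (List.cons.inj h).1.symm
    have h1 : ∀ i ∈ nbrItems rad κ u r,
        ∑ l ∈ (chainsF rad κ n i.2 (rad i.1)).image (List.cons i), (l.map fun i => w i.1).prod ≤
          w i.1 * ((rad i.1 ^ d : ℕ) * q ^ n) := fun i _ => by
      rw [Finset.sum_image (fun _ _ _ _ h => (List.cons.inj h).2)]
      simp only [List.map_cons, List.prod_cons]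
      rw [← Finset.mul_sum]
      gcongr
      exact ih _ _ (hrad _)
    refine (Finset.sum_le_sum h1).trans ?_
    rw [nbrItems, Finset.sum_sigma]
    simp only [Finset.sum_const, card_bxF, nsmul_eq_mul]
    have h2 : ∀ θ, (((2 * (3 * κ * (r + rad θ) + 1) + 1) ^ d : ℕ) : ℝ≥0∞) *
        (w θ * ((rad θ ^ d : ℕ) * q ^ n)) ≤
        (r ^ d : ℕ) * q ^ n * (((15 * κ) ^ d * rad θ ^ (2 * d) : ℕ) * w θ) := fun θ => by
      have h3 : (2 * (3 * κ * (r + rad θ) + 1) + 1) ^ d * rad θ ^ d ≤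
          r ^ d * ((15 * κ) ^ d * rad θ ^ (2 * d)) := by
        rw [pow_mul, ← mul_pow, ← mul_pow, ← mul_pow]
        refine Nat.pow_le_pow_left ?_ d
        have h4 : r + rad θ ≤ 2 * (r * rad θ) := by nlinarith [hrad θ]
        have h5 : 1 ≤ κ * (r * rad θ) := Nat.mul_pos hκ (Nat.mul_pos hr (hrad θ))
        have h6 : 2 * (3 * κ * (r + rad θ) + 1) + 1 ≤ 15 * κ * (r * rad θ) := by nlinarith
        calc _ ≤ 15 * κ * (r * rad θ) * rad θ := Nat.mul_le_mul_right _ h6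
          _ = _ := by ring
      calc _ = (((2 * (3 * κ * (r + rad θ) + 1) + 1) ^ d * rad θ ^ d : ℕ) : ℝ≥0∞) *
            (w θ * q ^ n) := by push_cast; ring
        _ ≤ ((r ^ d * ((15 * κ) ^ d * rad θ ^ (2 * d)) : ℕ) : ℝ≥0∞) * (w θ * q ^ n) := by
            gcongr
        _ = _ := by push_cast; ring
    refine (Finset.sum_le_sum fun θ _ => h2 θ).trans ?_
    rw [← Finset.mul_sum, pow_succ, ← mul_assoc]
    gcongr

theorem chain_length_le (hrad : ∀ θ, 1 ≤ rad θ) (hκ : 1 ≤ κ) {e : ZVec d} {l : List (Item d Θ)} :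
    ∀ {i : Item d Θ},
    (i :: l).IsChain (fun i j => dst i.2 j.2 ≤ 3 * κ * (rad i.1 + rad j.1) + 1) →
    (∀ j, (i :: l).getLast? = some j → dst e j.2 ≤ 3 * κ * rad j.1) →
    dst i.2 e + 3 * κ * rad i.1 ≤ ((i :: l).map fun j => 7 * κ * rad j.1).sum := by
  induction l with
  | nil =>
    intro i _ h
    have := h i rfl
    rw [dst_comm] at this
    simp
    nlinarith
  | cons j l ih =>
    intro i hc h
    have h1 := ih hc.tail (by simpa using h)
    have h2 := (List.isChain_cons_cons.1 hc).1
    have h3 := dst_triangle i.2 j.2 e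
    have h4 : 1 ≤ κ * rad i.1 := Nat.mul_pos hκ (hrad _)
    rw [List.map_cons, List.sum_cons]
    nlinarith

theorem exists_item_chain (hrad : ∀ θ, 1 ≤ rad θ) (hκ : 1 ≤ κ) (I : Item d Θ → Prop)
    {v e : ZVec d} (hv : ∃ θ, I ⟨θ, v⟩)
    (h : Relation.ReflTransGen (fun u u' => dst u u' ≤ 1 ∧ (∃ θ, I ⟨θ, u⟩) ∧ ∃ θ, I ⟨θ, u'⟩) v e) :
    ∃ l : List (Item d Θ), l ≠ [] ∧ (∀ i ∈ l, I i) ∧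
      l.Pairwise (fun i j => κ * (rad i.1 + rad j.1) < dst i.2 j.2) ∧
      l ∈ chainsF rad κ l.length v 1 ∧ dst v e ≤ (l.map fun j => 7 * κ * rad j.1).sum := by
  let Bs : Item d Θ → Set (Sym2 (Item d Θ)) := fun a =>
    {p | ∃ b, p = s(a, b) ∧ dst a.2 b.2 ≤ κ * (rad a.1 + rad b.1)}
  obtain ⟨M, hM⟩ : ∃ M : ℕ, ∀ θ, rad θ ≤ M :=
    ⟨Finset.univ.sup rad, fun θ => Finset.le_sup (Finset.mem_univ θ)⟩
  obtain ⟨U, hU, hUd, hUc⟩ := Vitali.exists_disjoint_subfamily_covering_enlargement Bs {i | I i}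
    (fun i => (rad i.1 : ℝ)) 2 (by norm_num) (fun _ _ => by positivity) M
    (fun i _ => by exact_mod_cast hM i.1) (fun a _ => ⟨s(a, a), a, rfl, by simp⟩)
  have hsep : ∀ i ∈ U, ∀ j ∈ U, i ≠ j → κ * (rad i.1 + rad j.1) < dst i.2 j.2 := by
    intro i hi j hj hij
    by_contra! hle
    refine Set.disjoint_left.1 (show Disjoint (Bs i) (Bs j) from hUd hi hj hij)
      (show s(i, j) ∈ Bs i from ⟨j, rfl, hle⟩) ⟨i, Sym2.eq_swap, ?_⟩
    rw [dst_comm, add_comm]; exact hle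
  have hcov : ∀ u : ZVec d, (∃ θ, I ⟨θ, u⟩) → ∃ b ∈ U, dst u b.2 ≤ 3 * κ * rad b.1 := by
    rintro u ⟨θ, hθ⟩
    obtain ⟨b, hb, ⟨p, ⟨x, rfl, hx⟩, y, hxy, hy⟩, hr⟩ := hUc ⟨θ, u⟩ hθ
    have hr' : rad θ ≤ 2 * rad b.1 := by exact_mod_cast hr
    refine ⟨b, hb, ?_⟩
    rcases Sym2.eq_iff.1 hxy with ⟨h1, -⟩ | ⟨h1, -⟩
    · rw [← h1]; simp
    · subst h1
      rw [dst_comm]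
      nlinarith
  have : Nonempty (Item d Θ) := ⟨⟨hv.choose, v⟩⟩
  choose! c hcU hcd using hcov
  have h' : Relation.ReflTransGen (fun i j : Item d Θ => (i ∈ U ∧ j ∈ U) ∧
      dst i.2 j.2 ≤ 3 * κ * (rad i.1 + rad j.1) + 1) (c v) (c e) := by
    refine Relation.ReflTransGen.lift c ?_ _ _ h
    rintro a b ⟨hab, ha, hb⟩
    refine ⟨⟨hcU a ha, hcU b hb⟩, ?_⟩
    have h1 := hcd a ha
    have h2 := hcd b hb
    have h3 := dst_triangle (c a).2 a (c b).2
    have h4 := dst_triangle a b (c b).2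
    rw [dst_comm] at h1
    nlinarith
  have he : ∃ θ, I ⟨θ, e⟩ := by
    rcases Relation.ReflTransGen.cases_tail h with rfl | ⟨_, _, _, _, h⟩
    · exact hv
    · exact h
  obtain ⟨l, hl1, hl2, hl3⟩ := exists_nodup_chain h'
  have hlU : ∀ i ∈ c v :: l, i ∈ U := by
    have : ∀ (l : List (Item d Θ)) (a : Item d Θ), a ∈ U → (a :: l).IsChain (fun i j : Item d Θ =>
      (i ∈ U ∧ j ∈ U) ∧ dst i.2 j.2 ≤ 3 * κ * (rad i.1 + rad j.1) + 1) → ∀ i ∈ a :: l, i ∈ U := by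
      intro l
      induction l with
      | nil => intro a ha _ i hi; simp at hi; exact hi ▸ ha
      | cons b l ih =>
        intro a ha hc i hi
        rcases List.mem_cons.1 hi with rfl | hi
        · exact ha
        · exact ih b (List.isChain_cons_cons.1 hc).1.1.2 hc.tail i hi
    exact this l _ (hcU v hv) hl1
  have hch : (c v :: l).IsChain
      (fun i j => dst i.2 j.2 ≤ 3 * κ * (rad i.1 + rad j.1) + 1) := hl1.imp fun _ _ h => h.2
  refine ⟨c v :: l, by simp, fun i hi => hU (hlU i hi), ?_, ?_, ?_⟩
  · exact hl2.pairwise_of_forall_ne fun a ha b hb hab => hsep a (hlU a ha) b (hlU b hb) hab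
  · refine mem_chainsF rad κ (fun i hi => ?_) hch
    simp only [List.head?_cons, Option.some.injEq] at hi
    subst hi
    have := hcd v hv
    nlinarith
  · have h1 := chain_length_le rad κ hrad hκ (e := e) hch fun j hj => by
      rw [hl3] at hj
      cases hj
      exact hcd e he
    have h2 := dst_triangle v (c v).2 e
    have h3 := hcd v hv
    omega

theorem pathBad_le {p : ℝ} {μ : Measure (Config d)} (h0 : 0 ≤ p) (h1 : p ≤ 1)
    (hμ : IsBernoulli d p μ) (hrad : ∀ θ, 1 ≤ rad θ) (hκ : 1 ≤ κ)
    (cl : Θ → Prop) (P : Θ → ZVec d → Config d → Prop) (B : Θ → ZVec d → Set (ZVec d))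
    (hfin : ∀ θ u, (B θ u).Finite)
    (hdisj : ∀ θ θ' u u', κ * (rad θ + rad θ') < dst u u' → Disjoint (B θ u) (B θ' u'))
    (hloc : ∀ θ u, ¬ cl θ → Loc (edgesIn (B θ u)) (P θ u)) (w : Θ → ℝ≥0∞)
    (hw : ∀ θ u, ¬ cl θ → μ {ω | P θ u ω} ≤ w θ) (x b : ℝ≥0∞) (hx : x ≤ 1) (hb : 1 ≤ b)
    (hq : ∑ θ, ((15 * κ) ^ d * rad θ ^ (2 * d) : ℕ) *
      ((if cl θ then x else w θ) * b ^ (7 * κ * rad θ)) ≤ 2⁻¹) (v : ZVec d) (R f : ℕ) :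
    x ^ f * b ^ R * μ {ω | ∃ (e : ZVec d) (F : Finset (ZVec d)), F.card ≤ f ∧ R ≤ dst v e ∧
      (∃ θ, if cl θ then ∃ y ∈ F, dst v y ≤ rad θ else P θ v ω) ∧
      Relation.ReflTransGen (fun u u' => dst u u' ≤ 1 ∧
        (∃ θ, if cl θ then ∃ y ∈ F, dst u y ≤ rad θ else P θ u ω) ∧
        ∃ θ, if cl θ then ∃ y ∈ F, dst u' y ≤ rad θ else P θ u' ω) v e} ≤ 1 := by
  set ŵ : Θ → ℝ≥0∞ := fun θ => (if cl θ then x else w θ) * b ^ (7 * κ * rad θ) with hŵ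
  set E := {ω | ∃ (e : ZVec d) (F : Finset (ZVec d)), F.card ≤ f ∧ R ≤ dst v e ∧
      (∃ θ, if cl θ then ∃ y ∈ F, dst v y ≤ rad θ else P θ v ω) ∧
      Relation.ReflTransGen (fun u u' => dst u u' ≤ 1 ∧
        (∃ θ, if cl θ then ∃ y ∈ F, dst u y ≤ rad θ else P θ u ω) ∧
        ∃ θ, if cl θ then ∃ y ∈ F, dst u' y ≤ rad θ else P θ u' ω) v e} with hE
  let ok : List (Item d Θ) → Prop := fun l =>
    l.Pairwise (fun i j => κ * (rad i.1 + rad j.1) < dst i.2 j.2) ∧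
    (l.filter fun i => cl i.1).length ≤ f ∧ R ≤ (l.map fun j => 7 * κ * rad j.1).sum
  let A : List (Item d Θ) → Set (Config d) := fun l =>
    {ω | ok l ∧ ∀ i ∈ l.filter (fun i => ¬ cl i.1), P i.1 i.2 ω}
  have hA : ∀ l, x ^ f * b ^ R * μ (A l) ≤ (l.map fun i => ŵ i.1).prod := by
    intro l
    by_cases hl : ok l
    swap
    · simp [A, hl]
    have hm : μ (A l) ≤ ((l.filter (fun i => ¬ cl i.1)).map fun i => w i.1).prod := by
      have h2 : A l = {ω | ∀ i ∈ l.filter (fun i => ¬ cl i.1), P i.1 i.2 ω} := by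
        ext ω; simp [A, hl]
      rw [h2, measure_list_of_loc h0 h1 hμ _ (fun i : Item d Θ => B i.1 i.2)
        (fun i => P i.1 i.2)
        (fun i hi => hloc _ _ (by simpa using (List.mem_filter.1 hi).2)) (fun i _ => hfin _ _)
        ((hl.1.imp fun h => hdisj _ _ _ _ h).filter _)]
      exact List.prod_le_prod' fun i hi => hw _ _ (by simpa using (List.mem_filter.1 hi).2)
    have hprod : (l.map fun i => ŵ i.1).prod = x ^ (l.filter fun i => cl i.1).length *
        b ^ (l.map fun j => 7 * κ * rad j.1).sum *
        ((l.filter (fun i => ¬ cl i.1)).map fun i => w i.1).prod := by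
      clear hl hm
      induction l with
      | nil => simp
      | cons i l ih =>
        rw [List.map_cons, List.prod_cons, ih, List.map_cons, List.sum_cons, pow_add]
        by_cases hc : cl i.1 <;> simp [hŵ, hc] <;> ring
    rw [hprod]
    exact mul_le_mul' (mul_le_mul' (pow_le_pow_right_of_le_one' hx hl.2.1)
      (pow_le_pow_right' hb hl.2.2)) hm
  have hsub : E ⊆ ⋃ n, ⋃ l ∈ chainsF rad κ (n + 1) v 1, A l := by
    rintro ω ⟨e, F, hF, hR, hv, hrt⟩
    obtain ⟨l, hl0, hlI, hls, hlm, hld⟩ := exists_item_chain rad κ hrad hκ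
      (fun i : Item d Θ => if cl i.1 then ∃ y ∈ F, dst i.2 y ≤ rad i.1 else P i.1 i.2 ω) hv hrt
    simp only [Set.mem_iUnion]
    refine ⟨l.length - 1, l, ?_, ⟨hls, ?_, by omega⟩, fun i hi => ?_⟩
    · rwa [Nat.sub_add_cancel (List.length_pos_iff.2 hl0)]
    · have hnd : (l.filter fun i => cl i.1).Nodup := by
        refine List.Nodup.filter _ (hls.imp ?_)
        rintro i j hij rfl
        simp at hij
      have : ∀ i ∈ l.filter (fun i => cl i.1), ∃ y ∈ F, dst i.2 y ≤ rad i.1 := fun i hi => by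
        have h2 := hlI i (List.mem_filter.1 hi).1
        rwa [if_pos (by simpa using (List.mem_filter.1 hi).2)] at h2
      choose! y hy hyd using this
      rw [← List.toFinset_card_of_nodup hnd]
      refine (Finset.card_le_card_of_injOn y (fun i hi => hy i (by simpa using hi)) ?_).trans hF
      intro i hi j hj hij
      simp only [Finset.mem_coe, List.mem_toFinset] at hi hj
      by_contra hne
      have h3 := hyd i hi
      have h4 := hyd j hj
      have h5 := dst_triangle i.2 (y i) j.2
      rw [hij, dst_comm (y j)] at h5
      rw [hij] at h3
      have hs : Std.Symm (fun i j : Item d Θ => κ * (rad i.1 + rad j.1) < dst i.2 j.2) :=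
        ⟨fun i j h => by rwa [dst_comm, add_comm]⟩
      have h6 := hls.forall (List.mem_filter.1 hi).1 (List.mem_filter.1 hj).1 hne
      nlinarith
    · have h2 := hlI i (List.mem_filter.1 hi).1
      rwa [if_neg (by simpa using (List.mem_filter.1 hi).2)] at h2
  calc x ^ f * b ^ R * μ E ≤ x ^ f * b ^ R * ∑' n, ∑ l ∈ chainsF rad κ (n + 1) v 1, μ (A l) := by
        gcongr
        exact (measure_mono hsub).trans ((measure_iUnion_le _).trans
          (ENNReal.tsum_le_tsum fun n => measure_biUnion_finset_le _ _))
    _ = ∑' n, ∑ l ∈ chainsF rad κ (n + 1) v 1, x ^ f * b ^ R * μ (A l) := by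
        rw [← ENNReal.tsum_mul_left]
        simp only [Finset.mul_sum]
    _ ≤ ∑' n : ℕ, (2⁻¹ : ℝ≥0∞) ^ (n + 1) := by
        refine ENNReal.tsum_le_tsum fun n => (Finset.sum_le_sum fun l _ => hA l).trans ?_
        have := sum_chainsF_le rad κ hrad hκ ŵ 2⁻¹ hq (n + 1) v 1 le_rfl
        simpa using this
    _ = 1 := by
        simp only [pow_succ]
        rw [ENNReal.tsum_mul_right, ENNReal.tsum_geometric]
        rw [ENNReal.one_sub_inv_two, inv_inv, ENNReal.mul_inv_cancel] <;> simp

end PathBad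

end

section

variable {d : ℕ}
variable {p ρ cs : ℝ} {μ : Measure (Config d)}

/-! ### Outer boundaries in the plane -/

section Plane

variable (s : ℤ × ℤ → Prop)

/-- Outer boundary points of a planar set. -/
def OutBd (q : ℤ × ℤ) : Prop := ¬ s q ∧ ∃ q', s q' ∧ |q.1 - q'.1| + |q.2 - q'.2| = 1

/-- The top or right endpoint of a planar edge, recorded by its direction and its other endpoint. -/
def planeHd : Bool × ℤ × ℤ → ℤ × ℤ
  | (false, x, y) => (x + 1, y)
  | (true, x, y) => (x, y + 1)

/-- The edge has exactly one endpoint in the set. -/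
def bdEdge (e : Bool × ℤ × ℤ) : Prop := ¬ (s e.2 ↔ s (planeHd e))

/-- The four edges of a unit face. -/
def planeFace (x y : ℤ) : Set (Bool × ℤ × ℤ) :=
  {(false, x, y), (false, x, y + 1), (true, x, y), (true, x + 1, y)}

/-- Boundary edges on a common face. -/
def bdLink (e e' : Bool × ℤ × ℤ) : Prop :=
  bdEdge s e ∧ bdEdge s e' ∧ ∃ x y, e ∈ planeFace x y ∧ e' ∈ planeFace x y

/-- Boundary edges linked to the negative horizontal axis. -/
def linkedEdge (e : Bool × ℤ × ℤ) : Prop :=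
  ∃ x < 0, bdEdge s (false, x, 0) ∧ Relation.ReflTransGen (bdLink s) (false, x, 0) e

/-- The endpoint of a boundary edge outside the set. -/
def outPt (e : Bool × ℤ × ℤ) : ℤ × ℤ := if s e.2 then planeHd e else e.2

variable {s}

theorem linkedEdge.bdEdge {e : Bool × ℤ × ℤ} (h : linkedEdge s e) : bdEdge s e := by
  obtain ⟨x, -, hb, h⟩ := h
  rcases Relation.ReflTransGen.cases_tail h with rfl | ⟨_, _, _, h, _⟩
  exacts [hb, h]

theorem outBd_outPt {e : Bool × ℤ × ℤ} (h : bdEdge s e) : OutBd s (outPt s e) := by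
  obtain ⟨b, x, y⟩ := e
  unfold bdEdge at h
  unfold outPt
  split_ifs with hs
  · refine ⟨fun h' => h ⟨fun _ => h', fun _ => hs⟩, _, hs, ?_⟩
    cases b <;> simp [planeHd]
  · refine ⟨hs, planeHd (b, x, y), by_contra fun h' => h ⟨fun h => absurd h hs, fun h => absurd h h'⟩, ?_⟩
    cases b <;> simp [planeHd]

theorem outPt_near {e e' : Bool × ℤ × ℤ} (h : bdLink s e e') :
    |(outPt s e).1 - (outPt s e').1| ≤ 1 ∧ |(outPt s e).2 - (outPt s e').2| ≤ 1 := by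
  obtain ⟨-, -, x, y, h1, h2⟩ := h
  have key : ∀ e ∈ planeFace x y, x ≤ (outPt s e).1 ∧ (outPt s e).1 ≤ x + 1 ∧
      y ≤ (outPt s e).2 ∧ (outPt s e).2 ≤ y + 1 := by
    intro e he
    simp only [planeFace, Set.mem_insert_iff, Set.mem_singleton_iff] at he
    unfold outPt
    rcases he with rfl | rfl | rfl | rfl <;> split_ifs <;> simp [planeHd]
  obtain ⟨a1, a2, a3, a4⟩ := key e h1
  obtain ⟨b1, b2, b3, b4⟩ := key e' h2
  constructor <;> rw [abs_le] <;> constructor <;> omega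

theorem exists_linkedEdge_pos {M : ℕ} (hfin : ∀ x y, s (x, y) → |x| < M ∧ |y| < M) (h0 : s (0, 0)) :
    ∃ x ≥ 0, linkedEdge s (false, x, 0) := by
  by_contra! hno
  let σ : ℤ × ℤ → ZMod 2 := fun q => if s q then 1 else 0
  let c : Bool × ℤ × ℤ → ZMod 2 := fun e => if linkedEdge s e then 1 else 0
  have h2 : (2 : ZMod 2) = 0 := rfl
  have hc : ∀ e, (linkedEdge s e ↔ bdEdge s e) → c e = σ (planeHd e) - σ e.2 := by
    intro e he
    simp only [c, σ, he, bdEdge]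
    by_cases h1 : s e.2 <;> by_cases h3 : s (planeHd e) <;> simp [h1, h3]
  have hface : ∀ x y, c (false, x, y) + c (false, x, y + 1) =
      c (true, x + 1, y) - c (true, x, y) := by
    intro x y
    by_cases h : ∃ e ∈ planeFace x y, linkedEdge s e
    · obtain ⟨e, he, hl⟩ := h
      have hiff : ∀ e' ∈ planeFace x y, c e' = σ (planeHd e') - σ e'.2 := fun e' he' =>
        hc e' ⟨fun h => h.bdEdge, fun h => by
          obtain ⟨x0, hx0, hb, hr⟩ := hl
          exact ⟨x0, hx0, hb, hr.tail ⟨linkedEdge.bdEdge ⟨x0, hx0, hb, hr⟩, h, x, y, he, he'⟩⟩⟩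
      rw [hiff (false, x, y) (by simp [planeFace]), hiff (false, x, y + 1) (by simp [planeFace]),
        hiff (true, x + 1, y) (by simp [planeFace]), hiff (true, x, y) (by simp [planeFace])]
      simp only [planeHd]
      linear_combination (σ (x + 1, y) - σ (x, y)) * h2
    · push Not at h
      have : ∀ e' ∈ planeFace x y, c e' = 0 := fun e' he' => if_neg (h e' he')
      rw [this (false, x, y) (by simp [planeFace]), this (false, x, y + 1) (by simp [planeFace]),
        this (true, x + 1, y) (by simp [planeFace]), this (true, x, y) (by simp [planeFace])]
      simp
  have hout : ∀ e, ¬ bdEdge s e → c e = 0 := fun e he => if_neg fun h => he h.bdEdge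
  have hns : ∀ x y, (M : ℤ) ≤ |x| ∨ (M : ℤ) ≤ |y| → ¬ s (x, y) := fun x y h h' => by
    have := hfin x y h'
    omega
  let Hs : ℤ → ZMod 2 := fun y => ∑ i ∈ Finset.range (M + M), c (false, (i : ℤ) - M, y)
  have hstep : ∀ y, Hs y + Hs (y + 1) = 0 := by
    intro y
    simp only [Hs]
    rw [← Finset.sum_add_distrib]
    have h3 : ∀ i : ℕ, c (false, (i : ℤ) - M, y) + c (false, (i : ℤ) - M, y + 1) =
        c (true, ((i + 1 : ℕ) : ℤ) - M, y) - c (true, (i : ℤ) - M, y) := fun i => by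
      rw [hface]; push_cast; rw [show (i : ℤ) - M + 1 = i + 1 - M by ring]
    simp only [h3]
    rw [Finset.sum_range_sub (fun i : ℕ => c (true, (i : ℤ) - M, y)), hout, hout, sub_zero]
    · simp only [bdEdge, planeHd, not_not]
      exact iff_of_false (hns _ _ (by simp)) (hns _ _ (by simp))
    · simp only [bdEdge, planeHd, not_not]
      exact iff_of_false (hns _ _ (by simp)) (hns _ _ (by simp))
  have hall : ∀ y : ℕ, Hs y = Hs 0 := by
    intro y
    induction y with
    | zero => simp
    | succ y ih =>
      have := hstep y
      push_cast
      linear_combination this - ih - Hs 0 * h2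
  have hM : Hs M = 0 := by
    refine Finset.sum_eq_zero fun i _ => hout _ ?_
    simp only [bdEdge, planeHd, not_not]
    exact iff_of_false (hns _ _ (by simp)) (hns _ _ (by simp))
  have hH0 : Hs 0 = 1 := by
    simp only [Hs]
    rw [Finset.sum_range_add]
    have h3 : ∀ i ∈ Finset.range M, c (false, (i : ℤ) - M, 0) =
        σ (((i + 1 : ℕ) : ℤ) - M, 0) - σ ((i : ℤ) - M, 0) := fun i hi => by
      rw [hc]
      · simp only [planeHd]; push_cast; rw [show (i : ℤ) - M + 1 = i + 1 - M by ring]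
      · have := Finset.mem_range.1 hi
        exact ⟨fun h => h.bdEdge, fun h => ⟨_, by omega, h, .refl⟩⟩
    rw [Finset.sum_congr rfl h3, Finset.sum_range_sub (fun i : ℕ => σ ((i : ℤ) - M, 0)),
      Finset.sum_eq_zero fun i _ => if_neg (hno _ (by push_cast; omega))]
    simp only [σ]
    rw [if_pos (by simpa using h0), if_neg (hns _ _ (by simp))]
    simp
  rw [← hall M, hM] at hH0
  exact absurd hH0 (by decide)

theorem exists_outer_chain {M k : ℕ} (hfin : ∀ x y, s (x, y) → |x| < M ∧ |y| < M)
    (hs : ∀ x : ℤ, |x| ≤ k → s (x, 0)) : ∃ m : ℕ, k < m ∧ OutBd s (-m, 0) ∧ ∃ x : ℤ, 0 ≤ x ∧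
      Relation.ReflTransGen (fun q q' => (|q.1 - q'.1| ≤ 1 ∧ |q.2 - q'.2| ≤ 1) ∧
        OutBd s q ∧ OutBd s q') (-m, 0) (x, 0) := by
  obtain ⟨x', hx', x, hx, hb, hr⟩ := exists_linkedEdge_pos hfin (hs 0 (by simp))
  have h1 : ∀ x, bdEdge s (false, x, 0) → ∃ y, outPt s (false, x, 0) = (y, 0) ∧ ¬ |y| ≤ k ∧
      (y = x ∨ y = x + 1) := by
    intro x hx
    have h3 := (outBd_outPt hx).1
    unfold outPt at h3 ⊢
    split_ifs with h
    · refine ⟨x + 1, rfl, fun h' => ?_, Or.inr rfl⟩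
      rw [if_pos h] at h3
      exact h3 (hs _ h')
    · exact ⟨x, rfl, fun h' => h (hs _ h'), Or.inl rfl⟩
  have hb' : bdEdge s (false, x', 0) := linkedEdge.bdEdge ⟨x, hx, hb, hr⟩
  obtain ⟨y, hy1, hy2, hy3⟩ := h1 x hb
  obtain ⟨y', hy1', hy2', hy3'⟩ := h1 x' hb'
  have hy0 : y < -k := by
    rw [abs_le] at hy2
    omega
  have h4 : Relation.ReflTransGen (fun q q' => (|q.1 - q'.1| ≤ 1 ∧ |q.2 - q'.2| ≤ 1) ∧
        OutBd s q ∧ OutBd s q') (outPt s (false, x, 0)) (outPt s (false, x', 0)) := by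
    refine Relation.ReflTransGen.lift (outPt s) ?_ _ _ hr
    exact fun a b h => ⟨outPt_near h, outBd_outPt h.1, outBd_outPt h.2.1⟩
  rw [hy1, hy1'] at h4
  have hm : (y, (0 : ℤ)) = (-(y.natAbs : ℤ), 0) := by
    rw [Prod.mk.injEq]; exact ⟨by omega, rfl⟩
  refine ⟨y.natAbs, by omega, ?_, y', by omega, ?_⟩
  · rw [← hm, ← hy1]; exact outBd_outPt hb
  · rwa [← hm]

end Plane

/-! ### The Peierls argument -/

theorem le_dst_nsmul (r : ℕ) (x y : ZVec d) : r * dst x y ≤ dst (r • x) (r • y) := by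
  rcases Nat.eq_zero_or_pos (dst x y) with h | h
  · rw [h]; simp
  · obtain ⟨i, hi⟩ := exists_coord_dst x y h
    have h1 := coord_le_dst (r • x) (r • y) i
    simp only [Pi.smul_apply, nsmul_eq_mul] at h1
    rw [← mul_sub, abs_mul, hi, Nat.abs_cast] at h1
    exact_mod_cast h1

theorem dst_nsmul_le (r : ℕ) (x y : ZVec d) : dst (r • x) (r • y) ≤ r * dst x y :=
  dst_le.2 fun i => by
    simp only [Pi.smul_apply, nsmul_eq_mul]
    rw [← mul_sub, abs_mul, Nat.abs_cast]
    push_cast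
    exact mul_le_mul_of_nonneg_left (coord_le_dst x y i) (by positivity)

/-- The embedding of the coordinate plane. -/
def pl (d : ℕ) (q : ℤ × ℤ) : ZVec d :=
  fun i => if (i : ℕ) = 0 then q.1 else if (i : ℕ) = 1 then q.2 else 0

theorem dst_pl_le {q q' : ℤ × ℤ} {t : ℕ} (h1 : |q.1 - q'.1| ≤ t) (h2 : |q.2 - q'.2| ≤ t) :
    dst (pl d q) (pl d q') ≤ t := dst_le.2 fun i => by
  simp only [pl]
  split_ifs
  · exact h1
  · exact h2
  · simp

theorem le_dst_pl (hd : 2 ≤ d) {q q' : ℤ × ℤ} {t : ℕ} (h : (t : ℤ) ≤ |q.1 - q'.1| ∨ (t : ℤ) ≤ |q.2 - q'.2|) :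
    t ≤ dst (pl d q) (pl d q') := by
  have h1 := coord_le_dst (pl d q) (pl d q') ⟨0, by omega⟩
  have h2 := coord_le_dst (pl d q) (pl d q') ⟨1, by omega⟩
  simp [pl] at h1 h2
  omega

theorem Setup.noI_le (H : Setup d p μ ρ cs) : ∃ r0 : ℕ, 0 < r0 ∧
    ∀ k : ℕ, noI μ (2 * r0 * (k + 1)) ≤ 2⁻¹ ^ k := by
  obtain ⟨K, B, Q, f, hK, hQ, -, hf, hG⟩ := H.not_good_le
  have hlim : Filter.Tendsto (fun r => B * noI μ (r / Q) + f r) Filter.atTop (nhds 0) := by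
    have h1 : Filter.Tendsto (fun r => noI μ (r / Q)) Filter.atTop (nhds 0) :=
      H.noI_tendsto.comp (Nat.tendsto_div_const_atTop hQ.ne')
    have h2 := (ENNReal.Tendsto.const_mul h1 (a := (B : ℝ≥0∞)) (Or.inr (by simp))).add hf.tendsto
    simpa using h2
  set C : ℝ≥0∞ := ((15 * K) ^ d : ℕ) * 2 ^ (7 * K) with hC
  have hCt : C ≠ ⊤ := by simp [hC, ENNReal.mul_eq_top]
  have hC0 : C ≠ 0 := by
    simp only [hC, ne_eq, mul_eq_zero, not_or]
    constructor
    · have : 0 < (15 * K) ^ d := by positivity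
      exact_mod_cast this.ne'
    · simp
  obtain ⟨r0, hr0, hr1⟩ := ((hlim.eventually_le_const (u := 2⁻¹ / C)
    (ENNReal.div_pos (by simp) hCt)).and (Filter.eventually_ge_atTop 1)).exists
  refine ⟨r0, hr1, fun k => ?_⟩
  set good : Config d → ℤ × ℤ → Prop := fun ω q => Good K ω (r0 • pl d q) r0 with hgood
  set E : ℕ → Set (Config d) := fun m => {ω | ∃ (e : ZVec d) (F : Finset (ZVec d)), F.card ≤ 0 ∧
      m ≤ dst (pl d (-m, 0)) e ∧
      ¬ Good K ω (r0 • pl d (-m, 0)) r0 ∧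
      Relation.ReflTransGen (fun u u' => dst u u' ≤ 1 ∧
        ¬ Good K ω (r0 • u) r0 ∧ ¬ Good K ω (r0 • u') r0)
          (pl d (-m, 0)) e} with hE
  have hEm : ∀ m, μ (E m) ≤ 2⁻¹ ^ m := by
    intro m
    have := pathBad_le (Θ := Unit) (fun _ => 1) K H.p0.le H.p1.le H.ber (fun _ => le_rfl) (by omega)
      (fun _ => False) (fun _ u ω => ¬ Good K ω (r0 • u) r0) (fun _ u => bx (r0 • u) (K * r0))
      (fun _ _ => bx_finite _ _) (fun _ _ u u' h => Set.disjoint_left.2 fun y h1 h2 => by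
        have h3 := le_dst_nsmul r0 u u'
        have h4 := dst_triangle (r0 • u) y (r0 • u')
        rw [dst_comm _ y] at h4
        simp only [Set.mem_ofPred_eq] at h1 h2
        nlinarith) (fun _ u _ ω ω' h => not_congr (loc_good hK _ _ ω ω' h))
      (fun _ => 2⁻¹ / C) (fun _ u _ => (hG _ _).trans hr0) 1 2 le_rfl (by norm_num) (by
        simp only [Finset.univ_unique, Finset.sum_singleton, if_false, one_pow, mul_one]
        rw [mul_comm (2⁻¹ / C), ← mul_assoc, ← hC]
        exact ENNReal.mul_div_le) (pl d (-m, 0)) m 0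
    simp only [pow_zero, one_mul, if_false, exists_const] at this
    rw [← ENNReal.inv_pow, ENNReal.le_inv_iff_mul_le, mul_comm]
    exact this
  have hsub : {ω | ∀ x, dst x 0 ≤ 2 * r0 * (k + 1) → ¬ InI ω x} ⊆ ⋃ j : ℕ, E (k + 1 + j) := by
    intro ω hω
    set s : ℤ × ℤ → Prop := fun q => ∃ x : ℤ, |x| ≤ k ∧ Relation.ReflTransGen
      (fun a b : ℤ × ℤ => |a.1 - b.1| + |a.2 - b.2| = 1 ∧ good ω b) (x, 0) q with hs
    have hseed : ∀ q, good ω q → ∃ a, Seed ω (r0 • pl d q) r0 a := fun q h => h.1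
    choose! a ha using hseed
    have hlink : ∀ q q', good ω q → good ω q' → |q.1 - q'.1| + |q.2 - q'.2| = 1 →
        Conn ω Set.univ (a q) (a q') := fun q q' hq hq' h => by
      have h1 : dst (pl d q) (pl d q') ≤ 1 := by
        apply dst_pl_le <;> push_cast <;> have := abs_nonneg (q.1 - q'.1) <;>
          have := abs_nonneg (q.2 - q'.2) <;> omega
      have h2 := dst_nsmul_le r0 (pl d q) (pl d q')
      exact (Good.link hq' (ha q hq) (ha q' hq') (by nlinarith) (by omega)).mono (Set.subset_univ _)
    have hnear : ∀ q, good ω q → dst (a q) (r0 • pl d q) ≤ r0 := fun q hq => by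
      obtain ⟨b, hb, -⟩ := ha q hq
      exact hb.mem_left
    have hnot : ∀ x, dst x 0 ≤ 2 * r0 * (k + 1) → ∃ n, ∀ y, Conn ω Set.univ x y → dst y x < n :=
      fun x hx => by
        have := hω x hx
        unfold InI at this
        push Not at this
        exact this
    choose! n hn using hnot
    obtain ⟨N, hN⟩ : ∃ N, ∀ x, dst x 0 ≤ 2 * r0 * (k + 1) → n x ≤ N :=
      ⟨(bxF 0 (2 * r0 * (k + 1))).sup n, fun x hx => Finset.le_sup (mem_bxF.2 hx)⟩
    have hbd : ∀ x y, s (x, y) → |x| < (N + 4 * (k + 2) : ℕ) ∧ |y| < (N + 4 * (k + 2) : ℕ) := by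
      rintro x y ⟨x0, hx0, hr⟩
      by_contra hc
      have hfar : ((N + 4 * (k + 2) : ℕ) : ℤ) ≤ |x| ∨ ((N + 4 * (k + 2) : ℕ) : ℤ) ≤ |y| := by omega
      rcases Relation.ReflTransGen.cases_head hr with h | ⟨g, ⟨hg1, hg2⟩, hr'⟩
      · cases h
        simp at hfar
        omega
      · have h1 : good ω (x, y) ∧ Conn ω Set.univ (a g) (a (x, y)) := by
          generalize (x, y) = q at hr'
          clear hr hfar hc
          induction hr' with
          | refl => exact ⟨hg2, .refl trivial⟩
          | tail _ h ih => exact ⟨h.2, ih.2.trans (hlink _ _ ih.1 h.2 h.1)⟩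
        have h2 : dst (pl d g) 0 ≤ k + 1 := by
          have : pl d (0, 0) = 0 := by funext i; simp [pl]
          rw [← this]
          have := abs_nonneg (x0 - g.1)
          have := abs_nonneg (0 - g.2)
          apply dst_pl_le <;> push_cast <;> simp only [abs_le, sub_zero] at * <;> constructor <;>
            cases abs_cases (x0 - g.1) <;> cases abs_cases (0 - g.2) <;> omega
        have h3 : dst (a g) 0 ≤ r0 * (k + 2) := by
          have h4 := dst_nsmul_le r0 (pl d g) 0
          rw [smul_zero] at h4
          have h5 := dst_triangle (a g) (r0 • pl d g) 0
          have h6 := hnear g hg2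
          nlinarith
        have h4 : dst (a g) 0 ≤ 2 * r0 * (k + 1) := by nlinarith
        have h5 := hn _ h4 _ h1.2
        have h6 := hN _ h4
        have h7 := hnear _ h1.1
        have h8 : N + 4 * (k + 2) ≤ dst (pl d (x, y)) 0 := by
          have : pl d (0, 0) = 0 := by funext i; simp [pl]
          rw [← this]
          exact le_dst_pl H.hd (by simpa using hfar)
        have h9 := le_dst_nsmul r0 (pl d (x, y)) 0
        rw [smul_zero] at h9
        have h10 := dst_triangle (r0 • pl d (x, y)) (a (x, y)) 0
        have h11 := dst_triangle (a (x, y)) (a g) 0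
        rw [dst_comm _ (a (x, y))] at h10
        have h12 : r0 * (N + 4 * (k + 2)) ≤ r0 * dst (pl d (x, y)) 0 := Nat.mul_le_mul_left _ h8
        nlinarith
    obtain ⟨m, hm, hm0, x, hx, hr⟩ := exists_outer_chain hbd
      (fun x hx => ⟨x, hx, .refl⟩ : ∀ x : ℤ, |x| ≤ k → s (x, 0))
    have hbad : ∀ q, OutBd s q → ¬ good ω q := by
      rintro q ⟨h1, q', ⟨x, hx, hr⟩, h3⟩ hq
      exact h1 ⟨x, hx, hr.tail ⟨by rw [abs_sub_comm, abs_sub_comm q'.2]; exact h3, hq⟩⟩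
    refine Set.mem_iUnion.2 ⟨m - (k + 1), ?_⟩
    rw [show k + 1 + (m - (k + 1)) = m by omega]
    refine ⟨pl d (x, 0), ∅, by simp, le_dst_pl H.hd (Or.inl ?_), hbad _ hm0, ?_⟩
    · simp only
      rw [abs_sub_comm, abs_of_nonneg] <;> omega
    · refine Relation.ReflTransGen.lift (pl d) ?_ _ _ hr
      rintro q q' ⟨⟨h1, h2⟩, h3, h4⟩
      exact ⟨dst_pl_le (by exact_mod_cast h1) (by exact_mod_cast h2),
        hbad _ h3, hbad _ h4⟩
  calc _ ≤ ∑' j : ℕ, μ (E (k + 1 + j)) := (measure_mono hsub).trans (measure_iUnion_le _)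
    _ ≤ ∑' j : ℕ, 2⁻¹ ^ k * (2⁻¹ * 2⁻¹ ^ j) := ENNReal.tsum_le_tsum fun j => by
        refine (hEm _).trans (le_of_eq ?_)
        rw [pow_add, pow_add]; ring
    _ = 2⁻¹ ^ k := by
        rw [ENNReal.tsum_mul_left, ENNReal.tsum_mul_left, ENNReal.tsum_geometric,
          ENNReal.one_sub_inv_two, inv_inv, ENNReal.inv_mul_cancel] <;> simp

theorem Setup.noI_expSmall (H : Setup d p μ ρ cs) : ExpSmall (noI μ) := by
  obtain ⟨r0, hr0, h⟩ := H.noI_le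
  have hg : ExpSmall fun k : ℕ => (2⁻¹ : ℝ≥0∞) ^ k := by
    refine ⟨1, Real.log 2, one_pos, Real.log_pos (by norm_num), fun k => le_of_eq ?_⟩
    rw [one_mul, mul_comm, Real.exp_nat_mul, Real.exp_neg, Real.exp_log (by norm_num),
      ENNReal.ofReal_pow (by norm_num), ENNReal.ofReal_inv_of_pos (by norm_num)]
    simp
  have := H.ber.1
  refine ((hg.div (2 * r0) (by omega)).const_mul 2).mono fun r => ?_
  rcases Nat.eq_zero_or_pos (r / (2 * r0)) with hr | hr
  · rw [hr]
    refine (prob_le_one).trans (by norm_num)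
  · obtain ⟨k, hk⟩ : ∃ k, r / (2 * r0) = k + 1 := ⟨r / (2 * r0) - 1, by omega⟩
    rw [hk]
    calc noI μ r ≤ noI μ (2 * r0 * (k + 1)) := measure_mono fun ω hω x hx => hω x (hx.trans (by
          rw [← hk]; exact Nat.mul_div_le _ _))
      _ ≤ 2⁻¹ ^ k := h k
      _ = _ := by
        rw [pow_succ, mul_comm (2⁻¹ ^ k), ← mul_assoc, Nat.cast_ofNat,
          ENNReal.mul_inv_cancel (by simp) (by simp), one_mul]

theorem Setup.not_good_expSmall (H : Setup d p μ ρ cs) : ∃ K : ℕ, ∃ f : ℕ → ℝ≥0∞, 4 ≤ K ∧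
    (4 : ℝ) + 8 * ρ ≤ K ∧ ExpSmall f ∧ ∀ (z : ZVec d) (r : ℕ), μ {ω | ¬ Good K ω z r} ≤ f r := by
  obtain ⟨K, B, Q, f, hK, hQ, hKρ, hf, hG⟩ := H.not_good_le
  exact ⟨K, _, hK, hKρ, ((H.noI_expSmall.div Q hQ).const_mul B).add hf, hG⟩

end

section

variable {d : ℕ}
variable {p ρ cs : ℝ} {μ : Measure (Config d)} {ω : Config d} {w : ZVec d}

/-! ### Escaping into an orthant -/

/-- The part of an orthant with apex `w` used to escape in the diagonal direction `σ`, leaving `w`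
through its neighbour in direction `i`. -/
def orthReg (σ : Fin d → ℤ) (i : Fin d) (w : ZVec d) (L : ℕ) : Set (ZVec d) :=
  insert w {x | 1 ≤ σ i * (x i - w i) ∧ ∀ k, 0 ≤ σ k * (x k - w k) ∧ σ k * (x k - w k) ≤ L}

/-- Escape from `w` to depth `D` in the orthant. -/
def Escape (ω : Config d) (σ : Fin d → ℤ) (i : Fin d) (w : ZVec d) (L D : ℕ) : Prop :=
  ∃ y, Conn ω (orthReg σ i w L) w y ∧ ∀ k, (D : ℤ) ≤ σ k * (y k - w k)

theorem adj_update (x : ZVec d) (k : Fin d) {s : ℤ} (hs : |s| = 1) :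
    Adj d x (Function.update x k (x k + s)) := by
  unfold Adj norm1
  rw [Finset.sum_eq_single k]
  · rcases (abs_eq zero_le_one).1 hs with rfl | rfl <;> simp
  · intro j _ hj
    simp [Function.update_of_ne hj]
  · simp

theorem orthReg_mono {σ : Fin d → ℤ} {i : Fin d} {L L' : ℕ} (h : L ≤ L') :
    orthReg σ i w L ⊆ orthReg σ i w L' := by
  refine Set.insert_subset_insert fun x hx => ⟨hx.1, fun k => ⟨(hx.2 k).1, (hx.2 k).2.trans ?_⟩⟩
  exact_mod_cast h

theorem orthReg_subset {σ : Fin d → ℤ} (hσ : ∀ k, σ k = 1 ∨ σ k = -1) (i : Fin d) (L : ℕ) :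
    orthReg σ i w L ⊆ bx w L := by
  rintro x (rfl | hx)
  · simp
  · refine dst_le.2 fun k => ?_
    have := hx.2 k
    rw [abs_le]
    rcases hσ k with h | h <;> rw [h] at this <;> constructor <;> linarith

theorem conn_of_all_open {σ : Fin d → ℤ} (hσ : ∀ k, σ k = 1 ∨ σ k = -1) (i : Fin d) (L : ℕ)
    (ho : ∀ e ∈ edgesIn (orthReg σ i w L), ω e = true) :
    ∀ x ∈ orthReg σ i w L, Conn ω (orthReg σ i w L) w x := by
  have key : ∀ (n : ℕ) (x : ZVec d), norm1 d (x - w) = n → x ∈ orthReg σ i w L →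
      Conn ω (orthReg σ i w L) w x := by
    intro n
    induction n using Nat.strong_induction_on with
    | _ n ih =>
      intro x hn hx
      by_cases hxw : x = w
      · subst hxw; exact .refl hx
      have hx' := hx.resolve_left hxw
      have hstep : ∀ k, 1 ≤ σ k * (x k - w k) →
          Function.update x k (x k + -σ k) ∈ orthReg σ i w L → Conn ω (orthReg σ i w L) w x := by
        intro k hk hm
        have hadj := adj_update x k (s := -σ k) (by rcases hσ k with h | h <;> simp [h])
        set x' := Function.update x k (x k + -σ k) with hxd
        have hlt : norm1 d (x' - w) < n := by
          rw [← hn]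
          refine Finset.sum_lt_sum (fun j _ => ?_) ⟨k, Finset.mem_univ _, ?_⟩
          · by_cases hj : j = k
            · subst hj
              simp only [hxd, Pi.sub_apply, Function.update_self]
              rcases hσ j with h | h <;> rw [h] at hk ⊢ <;> omega
            · simp [hxd, Function.update_of_ne hj]
          · simp only [hxd, Pi.sub_apply, Function.update_self]
            rcases hσ k with h | h <;> rw [h] at hk ⊢ <;> omega
        refine (ih _ hlt x' rfl hm).trans (.single ?_ hm hx)
        rw [edgeOpen_iff (adj_comm.1 hadj)]
        refine ho _ ?_
        rcases mkEdge_val (adj_comm.1 hadj) with h | h <;> simp [edgesIn, h, hx, hm]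
      by_cases hk : ∃ k, k ≠ i ∧ 1 ≤ σ k * (x k - w k)
      · obtain ⟨k, hki, hk⟩ := hk
        refine hstep k hk (Or.inr ⟨?_, fun j => ?_⟩)
        · rw [Function.update_of_ne hki.symm]; exact hx'.1
        · by_cases hj : j = k
          · subst hj
            have := hx'.2 j
            rw [Function.update_self]
            rcases hσ j with h | h <;> rw [h] at this hk ⊢ <;> omega
          · rw [Function.update_of_ne hj]; exact hx'.2 j
      · push Not at hk
        refine hstep i hx'.1 ?_
        have hoff : ∀ k, k ≠ i → x k = w k := fun k hki => by
          have h1 := hk k hki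
          have h2 := (hx'.2 k).1
          rcases hσ k with h | h <;> rw [h] at h1 h2 <;> omega
        by_cases h2 : 2 ≤ σ i * (x i - w i)
        · refine Or.inr ⟨?_, fun j => ?_⟩
          · rw [Function.update_self]
            rcases hσ i with h | h <;> rw [h] at h2 ⊢ <;> omega
          · by_cases hj : j = i
            · subst hj
              have := hx'.2 j
              rw [Function.update_self]
              rcases hσ j with h | h <;> rw [h] at this h2 ⊢ <;> omega
            · rw [Function.update_of_ne hj]; exact hx'.2 j
        · refine Or.inl (funext fun j => ?_)
          by_cases hj : j = i
          · subst hj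
            have := hx'.1
            rw [Function.update_self]
            rcases hσ j with h | h <;> rw [h] at this h2 ⊢ <;> omega
          · rw [Function.update_of_ne hj]; exact hoff j hj
  exact fun x hx => key _ x rfl hx

theorem conn_of_le {ω ω' : Config d} {S : Set (ZVec d)} {a b : ZVec d}
    (h : ∀ e, ω e = true → ω' e = true) (hc : Conn ω S a b) : Conn ω' S a b :=
  ⟨hc.1, rtg_mono (fun _ _ ⟨⟨e, he, ho⟩, h1⟩ => ⟨⟨e, he, h e ho⟩, h1⟩) hc.2⟩

theorem card_edgesIn_bx (w : ZVec d) (m : ℕ) :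
    (edgesIn_finite (bx_finite w m)).toFinset.card ≤ ((2 * m + 1) ^ d) ^ 2 := by
  rw [← card_bxF w m, sq, ← Finset.card_product]
  refine Finset.card_le_card_of_injOn Subtype.val (fun e he => ?_) Subtype.val_injective.injOn
  simpa [edgesIn, mem_bxF] using he

theorem measure_all_open (h1 : p ≤ 1) (hμ : IsBernoulli d p μ) (w : ZVec d) (m : ℕ) :
    ENNReal.ofReal p ^ ((2 * m + 1) ^ d) ^ 2 ≤ μ {ω | ∀ e ∈ edgesIn (bx w m), ω e = true} := by
  have := hμ.2 (edgesIn_finite (bx_finite w m)).toFinset fun _ => true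
  simp only [Set.Finite.mem_toFinset, if_true, Finset.prod_const] at this
  rw [this]
  exact pow_le_pow_right_of_le_one' (ENNReal.ofReal_le_one.2 h1) (card_edgesIn_bx w m)

theorem loc_escape (σ : Fin d → ℤ) (i : Fin d) (w : ZVec d) (L D : ℕ) :
    Loc (edgesIn (orthReg σ i w L)) fun ω => Escape ω σ i w L D := fun _ _ hω =>
  exists_congr fun _ => and_congr_left fun _ => conn_congr hω subset_rfl

theorem Setup.escape (H : Setup d p μ ρ cs) : ∃ c0 : ℕ, ∃ θ : ℝ≥0∞, θ ≠ 0 ∧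
    ∀ (σ : Fin d → ℤ), (∀ k, σ k = 1 ∨ σ k = -1) → ∀ (i : Fin d) (w : ZVec d) (D : ℕ), 1 ≤ D →
      θ ≤ μ {ω | Escape ω σ i w (c0 * D) D} := by
  obtain ⟨K, f, hK, -, hf, hG⟩ := H.not_good_expSmall
  have := H.ber.1
  obtain ⟨m, hm, hmK⟩ := (((hf.div (2 * K) (by omega)).tail.tendsto.eventually_le_const
    (u := 2⁻¹) (by simp)).and (Filter.eventually_ge_atTop (2 * K))).exists
  refine ⟨4 + 2 * m, ENNReal.ofReal p ^ ((2 * (2 * m) + 1) ^ d) ^ 2 * 2⁻¹, ?_, ?_⟩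
  · have := H.p0
    simp [this]
  intro σ hσ i w D hD
  set L := (4 + 2 * m) * D with hL
  set n := max (2 * D) m with hn
  have hnL : 2 * n ≤ L := by
    have h1 : m ≤ m * D := Nat.le_mul_of_pos_right _ hD
    have h2 : n ≤ 2 * D + m * D := max_le (by omega) (by omega)
    rw [hL]; linarith
  set G : Set (Config d) :=
    {ω | ∀ k : ℕ, Good K ω (fun j => w j + (m + k : ℕ) * σ j) ((m + k) / (2 * K))} with hGd
  have hGm : 2⁻¹ ≤ μ G := by
    have h1 : μ Gᶜ ≤ 2⁻¹ := by
      have : Gᶜ ⊆ ⋃ k : ℕ, {ω | ¬ Good K ω (fun j => w j + (m + k : ℕ) * σ j) ((m + k) / (2 * K))} := by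
        intro ω hω
        simpa [G] using hω
      exact (measure_mono this).trans ((measure_iUnion_le _).trans
        ((ENNReal.tsum_le_tsum fun k => hG _ _).trans hm))
    have h2 : 1 ≤ μ G + μ Gᶜ := by
      rw [← measure_univ (μ := μ), ← Set.union_compl_self G]
      exact measure_union_le _ _
    have h3 : (2⁻¹ : ℝ≥0∞) + 2⁻¹ ≤ μ G + 2⁻¹ := by
      rw [ENNReal.inv_two_add_inv_two]
      exact h2.trans (by gcongr)
    exact (ENNReal.add_le_add_iff_right (by simp)).1 h3
  have hmn : m ≤ n := le_max_right _ _
  have hDn : 2 * D ≤ n := le_max_left _ _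
  have hin : ∀ j, 0 < σ j ∨ σ j < 0 := fun j => by rcases hσ j with h | h <;> simp [h]
  have hbox : ∀ k : ℕ, 1 ≤ k → k ≤ n → ∀ x, dst x (fun j => w j + (k : ℕ) * σ j) ≤ K * (k / (2 * K)) →
      ∀ j, (k : ℤ) ≤ 2 * (σ j * (x j - w j)) ∧ 2 * (σ j * (x j - w j)) ≤ 3 * k := by
    intro k hk hkn x hx j
    have h1 := (coord_le_dst x _ j).trans (Nat.cast_le.2 hx)
    have h2 : 2 * (K * (k / (2 * K))) ≤ k := by rw [← mul_assoc]; exact Nat.mul_div_le _ _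
    simp only [abs_le] at h1
    rcases hσ j with h | h <;> rw [h] at h1 ⊢ <;> constructor <;> omega
  have hreg : ∀ k : ℕ, 1 ≤ k → k ≤ n → bx (fun j => w j + (k : ℕ) * σ j) (K * (k / (2 * K))) ⊆
      orthReg σ i w L := fun k hk hkn x hx => by
    have h1 := hbox k hk hkn x hx
    refine Or.inr ⟨by have := h1 i; omega, fun j => ?_⟩
    have := h1 j
    constructor <;> omega
  have hesc : ∀ ω ∈ G, ∀ ω' : Config d, (∀ e, ω e = true → ω' e = true) →
      (∀ e ∈ edgesIn (bx w (2 * m)), ω' e = true) → Escape ω' σ i w L D := by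
    intro ω hω ω' hle hop
    choose a ha using fun k => (hω k).1
    have hlink : ∀ k, m + k < n → Conn ω (orthReg σ i w L) (a k) (a (k + 1)) := by
      intro k hk
      have h1 : 1 ≤ (m + k) / (2 * K) := (Nat.one_le_div_iff (by omega)).2 (by omega)
      have h2 : (m + (k + 1)) / (2 * K) ≤ (m + k) / (2 * K) + 1 := by
        rw [← Nat.add_div_right _ (by omega)]
        exact Nat.div_le_div_right (by omega)
      have h3 : (m + k) / (2 * K) ≤ (m + (k + 1)) / (2 * K) := Nat.div_le_div_right (by omega)
      refine (Good.link (hω (k + 1)) (ha k) (ha (k + 1)) ?_ (by omega)).mono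
        (hreg (m + (k + 1)) (by omega) (by omega))
      have h4 : dst (fun j => w j + ((m + k : ℕ) : ℤ) * σ j)
          (fun j => w j + ((m + (k + 1) : ℕ) : ℤ) * σ j) ≤ 1 :=
        dst_le.2 fun j => by
          rcases hσ j with h | h <;> rw [h, abs_le] <;> push_cast <;> constructor <;> linarith
      omega
    have hmem : ∀ k, a k ∈ bx (fun j => w j + ((m + k : ℕ) : ℤ) * σ j)
        (K * ((m + k) / (2 * K))) := fun k => by
      obtain ⟨b, hb, -⟩ := ha k
      exact bx_mono (by rw [dst_self, zero_add]; exact Nat.le_mul_of_pos_left _ (by omega)) hb.mem_left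
    have h1 : Conn ω' (orthReg σ i w L) (a 0) (a (n - m)) := conn_of_le hle
      (conn_chain a (n - m) (hreg (m + 0) (by omega) (by omega) (hmem 0)) fun k hk => hlink k (by omega))
    have h2 : Conn ω' (orthReg σ i w L) w (a 0) := by
      refine (conn_of_all_open hσ i (2 * m)
        (fun e he => hop e (edgesIn_mono (orthReg_subset hσ i _) he)) (a 0) ?_).mono
        (orthReg_mono (by omega))
      have h3 := hbox (m + 0) (by omega) (by omega) _ (hmem 0)
      exact Or.inr ⟨by have := h3 i; omega, fun j => by have := h3 j; constructor <;> omega⟩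
    refine ⟨_, h2.trans h1, fun k => ?_⟩
    have h3 := hbox (m + (n - m)) (by omega) (by omega) _ (hmem (n - m)) k
    omega
  set E := edgesIn (bx w (2 * m)) with hE
  let op : Config d → Config d := fun ω e => if e ∈ E then true else ω e
  have hind := measure_inter_of_loc H.p0.le H.p1.le H.ber (F := E)
    (G := edgesIn (orthReg σ i w L) \ E) (P := fun ω => ∀ e ∈ E, ω e = true)
    (Q := fun ω => Escape (op ω) σ i w L D)
    (fun ω ω' h => forall₂_congr fun e he => by rw [h e he])
    (fun ω ω' h => loc_escape σ i w L D _ _ fun e he => by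
      by_cases heE : e ∈ E
      · simp [op, heE]
      · simp [op, heE, h e ⟨he, heE⟩])
    (edgesIn_finite (bx_finite _ _))
    ((edgesIn_finite ((bx_finite _ _).subset (orthReg_subset hσ i L))).subset Set.sdiff_subset)
    Set.disjoint_sdiff_right
  have hsub : {ω | (∀ e ∈ E, ω e = true) ∧ Escape (op ω) σ i w L D} ⊆
      {ω | Escape ω σ i w L D} := by
    rintro ω ⟨h1, h2⟩
    have : op ω = ω := funext fun e => by
      by_cases heE : e ∈ E
      · simp [op, heE, h1 e heE]
      · simp [op, heE]
    rwa [this] at h2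
  refine le_trans ?_ (measure_mono hsub)
  rw [hind]
  refine mul_le_mul' (measure_all_open H.p1.le H.ber w (2 * m)) (hGm.trans (measure_mono ?_))
  intro ω hω
  refine hesc ω hω _ (fun e he => ?_) fun e he => ?_
  · simp only [op, he, ite_self]
  · simp [op, he]

end

section

variable {d : ℕ}
variable {p ρ cs : ℝ} {μ : Measure (Config d)} {ω : Config d}

/-! ### Clusters hugging the boundary of a box -/

section Choice

variable (h0 : 0 ≤ p) (h1 : p ≤ 1) (hμ : IsBernoulli d p μ)
include h0 h1 hμ

theorem measure_choice_le {α : Type*} {F : Set (EdgeD d)} (hF : F.Finite) {A : Config d → Prop}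
    (hA : Loc F A) (W : Config d → α) (hW : ∀ ω ω', (∀ e ∈ F, ω e = ω' e) → W ω = W ω')
    (V : Finset α) (hV : ∀ ω, A ω → W ω ∈ V) (E : α → Config d → Prop) (G : α → Set (EdgeD d))
    (hE : ∀ v ∈ V, Loc (G v) (E v)) (hG : ∀ v ∈ V, (G v).Finite)
    (hFG : ∀ v ∈ V, Disjoint F (G v)) (q : ℝ≥0∞) (hq : ∀ v ∈ V, μ {ω | E v ω} ≤ q) :
    μ {ω | A ω ∧ E (W ω) ω} ≤ μ {ω | A ω} * q := by
  have hloc : ∀ v, Loc F fun ω => A ω ∧ W ω = v := fun v ω ω' h => by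
    simp only [hA ω ω' h, hW ω ω' h]
  have h2 : {ω | A ω ∧ E (W ω) ω} ⊆ ⋃ v ∈ V, {ω | (A ω ∧ W ω = v) ∧ E v ω} := by
    rintro ω ⟨h1, h2⟩
    simp only [Set.mem_iUnion]
    exact ⟨W ω, hV ω h1, ⟨h1, rfl⟩, h2⟩
  have h3 : ⋃ v ∈ V, {ω | A ω ∧ W ω = v} ⊆ {ω | A ω} :=
    Set.iUnion₂_subset fun v _ ω h => h.1
  calc _ ≤ ∑ v ∈ V, μ {ω | (A ω ∧ W ω = v) ∧ E v ω} :=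
        (measure_mono h2).trans (measure_biUnion_finset_le _ _)
    _ ≤ ∑ v ∈ V, μ {ω | A ω ∧ W ω = v} * q := Finset.sum_le_sum fun v hv => by
        rw [measure_inter_of_loc h0 h1 hμ (hloc v) (hE v hv) hF (hG v hv) (hFG v hv)]
        gcongr
        exact hq v hv
    _ = μ (⋃ v ∈ V, {ω | A ω ∧ W ω = v}) * q := by
        rw [← Finset.sum_mul, measure_biUnion_finset]
        · intro v _ v' _ hvv
          exact Set.disjoint_left.2 fun ω h h' => hvv (h.2.symm.trans h'.2)
        · exact fun v _ => (hloc v).measurableSet hF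
    _ ≤ _ := by gcongr

end Choice

theorem Conn.cut_dir {S : Set (ZVec d)} {a b : ZVec d} {s β : ℤ} {i : Fin d} (hs : s = 1 ∨ s = -1)
    (h : Conn ω S a b) (ha : s * a i ≤ β) (hb : β ≤ s * b i) :
    ∃ b', Conn ω (S ∩ {x | s * x i ≤ β}) a b' ∧ s * b' i = β := by
  rcases hs with rfl | rfl
  · simpa using h.cut_le (β := β) (i := i) (by simpa using ha) (by simpa using hb)
  · obtain ⟨b', h1, h2⟩ := h.cut_ge (β := -β) (i := i) (by omega) (by omega)
    refine ⟨b', h1.mono (Set.inter_subset_inter_right _ fun x hx => ?_), by omega⟩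
    simp only [Set.mem_ofPred_eq] at *
    omega

/-- The cluster of `u` reaches distance `M` in the box `bx o R` without reaching the points at
distance at least `D` from the boundary. -/
def Hug (ω : Config d) (o : ZVec d) (R : ℕ) (u : ZVec d) (M D : ℕ) : Prop :=
  (∃ x, Conn ω (bx u M ∩ bx o R) u x ∧ dst x u = M) ∧
    ¬ ∃ y, Conn ω (bx u (2 * M) ∩ bx o R) u y ∧ dst y o + D ≤ R

theorem loc_hug (o : ZVec d) (R : ℕ) (u : ZVec d) (M D : ℕ) :
    Loc (edgesIn (bx u (2 * M))) fun ω => Hug ω o R u M D := fun ω ω' h => by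
  unfold Hug
  refine and_congr (exists_congr fun x => and_congr_left fun _ => ?_)
    (not_congr (exists_congr fun x => and_congr_left fun _ => ?_))
  · exact conn_congr h (edgesIn_mono (Set.inter_subset_left.trans (bx_mono (by simp; omega))))
  · exact conn_congr h (edgesIn_mono Set.inter_subset_left)

/-- The directional version of `Hug`, at the level `β` in direction `s • e_i`. -/
def HugDir (ω : Config d) (o : ZVec d) (R : ℕ) (u : ZVec d) (M D : ℕ) (i : Fin d) (s β : ℤ) :
    Prop :=
  (∃ x, Conn ω (bx u M ∩ bx o R ∩ {x | s * x i ≤ β}) u x ∧ s * x i = β) ∧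
    ¬ ∃ y, Conn ω (bx u (2 * M) ∩ bx o R ∩ {x | s * x i ≤ β}) u y ∧ dst y o + D ≤ R

theorem hugDir_step {c0 : ℕ} {q : ℝ≥0∞} (h0 : 0 ≤ p) (h1 : p ≤ 1) (hμ : IsBernoulli d p μ)
    {D : ℕ} (hesc : ∀ (σ : Fin d → ℤ), (∀ k, σ k = 1 ∨ σ k = -1) → ∀ (i : Fin d) (w : ZVec d),
      μ {ω | ¬ Escape ω σ i w (c0 * D) D} ≤ q) {o u : ZVec d} {R M : ℕ} {i : Fin d} {s β : ℤ}
    (hs : s = 1 ∨ s = -1) (hR : (c0 + 1) * D ≤ R) (hM : c0 * D ≤ M)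
    (hβ : s * u i ≤ β) (hβR : β + c0 * D + D ≤ s * o i + R) :
    μ {ω | HugDir ω o R u M D i s (β + (c0 * D + 1 : ℕ))} ≤
      μ {ω | HugDir ω o R u M D i s β} * q := by
  set L := c0 * D with hL
  have hRL : L + D ≤ R := by rw [hL]; linarith
  set S := bx u M ∩ bx o R ∩ {x | s * x i ≤ β} with hS
  set T := bx u (2 * M) ∩ bx o R ∩ {x | s * x i ≤ β} with hT
  have hST : S ⊆ T := Set.inter_subset_inter_left _ (Set.inter_subset_inter_left _
    (bx_mono (by simp; omega)))
  let rch : Config d → Set (ZVec d) := fun ω => {x | Conn ω S u x ∧ s * x i = β}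
  let pick : Set (ZVec d) → ZVec d := fun A => if h : A.Nonempty then h.some else u
  let σ : ZVec d → Fin d → ℤ := fun w k => if k = i then s else if w k ≤ o k then 1 else -1
  have hσ : ∀ w k, σ w k = 1 ∨ σ w k = -1 := fun w k => by
    by_cases hk : k = i
    · simpa [σ, hk] using hs
    · by_cases hw : w k ≤ o k <;> simp [σ, hk, hw]
  have hrch : ∀ ω ω', (∀ e ∈ edgesIn T, ω e = ω' e) → rch ω = rch ω' := fun ω ω' h => by
    ext x
    exact and_congr_left fun _ => conn_congr h (edgesIn_mono hST)
  have hpick : ∀ ω, (∃ x, Conn ω S u x ∧ s * x i = β) → pick (rch ω) ∈ rch ω := by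
    intro ω h
    have h' : (rch ω).Nonempty := h
    simp only [pick, h', dif_pos]
    exact h'.some_mem
  set V : Finset (ZVec d) := (bxF u M).filter fun w => w ∈ bx o R ∧ s * w i = β with hVd
  have key := measure_choice_le h0 h1 hμ (F := edgesIn T)
    (edgesIn_finite ((bx_finite u (2 * M)).subset (Set.inter_subset_left.trans Set.inter_subset_left)))
    (A := fun ω => HugDir ω o R u M D i s β)
    (fun ω ω' h => and_congr (exists_congr fun x => and_congr_left fun _ =>
      conn_congr h (edgesIn_mono hST)) (not_congr (exists_congr fun x => and_congr_left fun _ =>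
      conn_congr h subset_rfl)))
    (fun ω => pick (rch ω)) (fun ω ω' h => by rw [hrch ω ω' h]) V
    (fun ω h => by
      have h2 := hpick ω h.1
      have h3 := h2.1.mem_right
      simp only [hVd, Finset.mem_filter, mem_bxF]
      exact ⟨h3.1.1, h3.1.2, h2.2⟩)
    (fun w ω => ¬ Escape ω (σ w) i w L D) (fun w => edgesIn (orthReg (σ w) i w L))
    (fun w _ ω ω' h => not_congr (loc_escape _ _ _ _ _ ω ω' h))
    (fun w _ => edgesIn_finite ((bx_finite w L).subset (orthReg_subset (hσ w) i L)))
    (fun w hw => by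
      simp only [hVd, Finset.mem_filter] at hw
      refine Set.disjoint_left.2 fun e he he' => ?_
      have hone : ∀ x ∈ T, x ∈ orthReg (σ w) i w L → x = w := by
        rintro x hx (rfl | hx')
        · rfl
        have h1 := hx.2
        have h2 := hx'.1
        simp only [Set.mem_ofPred_eq] at h1
        simp only [σ, if_true, mul_sub] at h2
        omega
      have h2 := e.2.2
      rw [hone _ he.1 he'.1, hone _ he.2 he'.2] at h2
      exact lt_irrefl _ h2)
    q (fun w _ => hesc (σ w) (hσ w) i w)
  refine (measure_mono ?_).trans key
  rintro ω ⟨⟨x, hx, hxi⟩, hnd⟩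
  have hTT : T ⊆ bx u (2 * M) ∩ bx o R ∩ {x | s * x i ≤ β + (L + 1 : ℕ)} :=
    Set.inter_subset_inter_right _ fun x hx => by simp only [Set.mem_ofPred_eq] at *; omega
  obtain ⟨x', hx', hx'i⟩ := hx.cut_dir hs hβ (by rw [hxi]; omega)
  have hx'S : Conn ω S u x' := hx'.mono fun y hy => ⟨hy.1.1, hy.2⟩
  refine ⟨⟨⟨x', hx'S, hx'i⟩, fun ⟨y, hy, hyo⟩ => hnd ⟨y, hy.mono hTT, hyo⟩⟩, ?_⟩
  have hw := hpick ω ⟨x', hx'S, hx'i⟩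
  rintro ⟨y, hy, hyD⟩
  set w := pick (rch ω) with hwd
  have hwS := hw.1.mem_right
  have hwo := dst_le.1 hwS.1.2
  have hdir : ∀ k, ∀ t : ℤ, 0 ≤ σ w k * t → σ w k * t ≤ L → |w k + t - o k| ≤ R := by
    intro k t ht0 htL
    have h1 := abs_le.1 (hwo k)
    rw [abs_le]
    by_cases hk : k = i
    · subst hk
      have h2 := hw.2
      simp only [σ, if_true] at ht0 htL
      rcases hs with rfl | rfl <;> constructor <;> omega
    · by_cases hwk : w k ≤ o k
      · simp only [σ, hk, hwk, if_false, if_true] at ht0 htL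
        constructor <;> omega
      · simp only [σ, hk, hwk, if_false] at ht0 htL
        constructor <;> omega
  have hsub : orthReg (σ w) i w L ⊆ bx u (2 * M) ∩ bx o R ∩ {x | s * x i ≤ β + (L + 1 : ℕ)} := by
    intro z hz
    refine ⟨⟨?_, ?_⟩, ?_⟩
    · have h1 := orthReg_subset (hσ w) i L hz
      have h2 := hwS.1.1
      have h3 := dst_triangle z w u
      simp only [Set.mem_ofPred_eq] at *
      omega
    · rcases hz with rfl | hz
      · exact hwS.1.2
      refine dst_le.2 fun k => ?_
      have := hdir k (z k - w k) (hz.2 k).1 (hz.2 k).2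
      simpa using this
    · have h2 := hw.2
      rcases hz with rfl | hz
      · simp only [Set.mem_ofPred_eq]; omega
      have := (hz.2 i).2
      simp only [σ, if_true, mul_sub] at this
      simp only [Set.mem_ofPred_eq]
      omega
  have hconn := (hw.1.mono (hST.trans hTT)).trans (hy.mono hsub)
  refine hnd ⟨y, hconn, ?_⟩
  have hyr := hy.mem_right
  suffices h : dst y o ≤ R - D by omega
  refine dst_le.2 fun k => ?_
  have hyL : σ w k * (y k - w k) ≤ L := by
    rcases hyr with h | h
    · rw [h]; simp
    · exact (h.2 k).2
  have hyD := hyD k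
  have h1 := abs_le.1 (hwo k)
  rw [abs_le]
  have hRD : ((R - D : ℕ) : ℤ) = R - D := by omega
  rw [hRD]
  by_cases hk : k = i
  · subst hk
    have h2 := hw.2
    simp only [σ, if_true] at hyL hyD
    rcases hs with rfl | rfl <;> constructor <;> omega
  · by_cases hwk : w k ≤ o k
    · simp only [σ, hk, hwk, if_false, if_true] at hyL hyD
      constructor <;> omega
    · simp only [σ, hk, hwk, if_false] at hyL hyD
      constructor <;> omega

theorem Setup.hug (H : Setup d p μ ρ cs) : ∃ c0 : ℕ, ∃ q : ℝ≥0∞, q < 1 ∧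
    ∀ (o u : ZVec d) (R M D : ℕ), 1 ≤ D → (c0 + 1) * D ≤ R → c0 * D + D ≤ M →
      μ {ω | Hug ω o R u M D} ≤ (2 * d : ℕ) * q ^ ((M - D) / (c0 * D + 1)) := by
  obtain ⟨c0, θ, hθ, hesc⟩ := H.escape
  have := H.ber.1
  refine ⟨c0, 1 - θ, ENNReal.sub_lt_self (by simp) (by simp) hθ, fun o u R M D hD hR hM => ?_⟩
  have hesc' : ∀ (σ : Fin d → ℤ), (∀ k, σ k = 1 ∨ σ k = -1) → ∀ (i : Fin d) (w : ZVec d),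
      μ {ω | ¬ Escape ω σ i w (c0 * D) D} ≤ 1 - θ := by
    intro σ hσ i w
    have hm : MeasurableSet {ω | Escape ω σ i w (c0 * D) D} := (loc_escape σ i w _ D).measurableSet
      (edgesIn_finite ((bx_finite w _).subset (orthReg_subset hσ i _)))
    have := prob_compl_eq_one_sub (μ := μ) hm
    rw [show {ω | ¬ Escape ω σ i w (c0 * D) D} = {ω | Escape ω σ i w (c0 * D) D}ᶜ from rfl, this]
    exact tsub_le_tsub_left (hesc σ hσ i w D hD) _
  set J := (M - D) / (c0 * D + 1) with hJ
  have hJM : J * (c0 * D + 1) + D ≤ M := by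
    have := Nat.div_mul_le_self (M - D) (c0 * D + 1)
    rw [← hJ] at this
    omega
  have hdir : ∀ (i : Fin d) (s : ℤ), (s = 1 ∨ s = -1) → s * u i + M ≤ s * o i + R →
      μ {ω | HugDir ω o R u M D i s (s * u i + (J * (c0 * D + 1) : ℕ))} ≤ (1 - θ) ^ J := by
    intro i s hs hin
    have : ∀ j ≤ J, μ {ω | HugDir ω o R u M D i s (s * u i + (j * (c0 * D + 1) : ℕ))} ≤
        (1 - θ) ^ j := by
      intro j
      induction j with
      | zero => intro _; simpa using prob_le_one
      | succ j ih =>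
        intro hj
        rw [pow_succ]
        refine le_trans ?_ (mul_le_mul_left (ih (by omega)) _)
        have h3 : (j + 1) * (c0 * D + 1) ≤ J * (c0 * D + 1) := Nat.mul_le_mul_right _ hj
        rw [add_mul, one_mul] at h3
        rw [add_mul, one_mul, Nat.cast_add, ← add_assoc]
        exact hugDir_step H.p0.le H.p1.le H.ber hesc' hs hR (by omega) (by omega) (by omega)
    exact this J le_rfl
  have hsub : {ω | Hug ω o R u M D} ⊆ ⋃ i ∈ (Finset.univ : Finset (Fin d)),
      ⋃ s ∈ ({1, -1} : Finset ℤ), {ω | s * u i + M ≤ s * o i + R ∧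
        HugDir ω o R u M D i s (s * u i + (J * (c0 * D + 1) : ℕ))} := by
    rintro ω ⟨⟨x, hx, hxM⟩, hnd⟩
    obtain ⟨i, hi⟩ := exists_coord_dst x u (by omega)
    have hxo := abs_le.1 (dst_le.1 hx.mem_right.2 i)
    simp only [Set.mem_iUnion]
    refine ⟨i, Finset.mem_univ _, ?_⟩
    obtain ⟨s, hs, hsx⟩ : ∃ s : ℤ, (s = 1 ∨ s = -1) ∧ s * (x i - u i) = M := by
      rcases abs_choice (x i - u i) with h | h
      · exact ⟨1, by simp, by omega⟩
      · exact ⟨-1, by simp, by omega⟩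
    refine ⟨s, by simpa using hs, ?_, ?_, ?_⟩
    · rcases hs with rfl | rfl <;> omega
    · obtain ⟨b, hb, hbi⟩ := hx.cut_dir (i := i) (β := s * u i + (J * (c0 * D + 1) : ℕ)) hs (by omega)
        (by rw [mul_sub] at hsx; omega)
      exact ⟨b, hb, hbi⟩
    · rintro ⟨y, hy, hyo⟩
      exact hnd ⟨y, hy.mono Set.inter_subset_left, hyo⟩
  refine (measure_mono hsub).trans ((measure_biUnion_finset_le _ _).trans ?_)
  have hone : ∀ (i : Fin d) (s : ℤ), (s = 1 ∨ s = -1) → μ {ω | s * u i + M ≤ s * o i + R ∧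
        HugDir ω o R u M D i s (s * u i + (J * (c0 * D + 1) : ℕ))} ≤ (1 - θ) ^ J := by
    intro i s hs
    by_cases h : s * u i + M ≤ s * o i + R
    · exact (measure_mono fun ω h => h.2).trans (hdir i s hs h)
    · simp [h]
  calc _ ≤ ∑ i : Fin d, (2 : ℝ≥0∞) * (1 - θ) ^ J := Finset.sum_le_sum fun i _ => by
        refine (measure_biUnion_finset_le _ _).trans ?_
        rw [Finset.sum_pair (by norm_num), two_mul]
        exact add_le_add (hone i 1 (by simp)) (hone i (-1) (by simp))
    _ = _ := by
        simp only [Finset.sum_const, Finset.card_univ, Fintype.card_fin, nsmul_eq_mul]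
        push_cast; ring

end

section

variable {d : ℕ}
variable {ω : Config d} {o u y v : ZVec d} {K D M R : ℕ}

/-! ### Rays towards the centre of a box -/

/-- The point obtained from `y` by moving each coordinate by at most `k` towards `o`. -/
def tow (o y : ZVec d) (k : ℕ) : ZVec d := fun i =>
  if y i ≤ o i then min (y i + k) (o i) else max (y i - k) (o i)

theorem tow_zero : tow o y 0 = y := by
  funext i
  unfold tow
  split_ifs <;> omega

theorem dst_tow_succ (k : ℕ) : dst (tow o y k) (tow o y (k + 1)) ≤ 1 :=
  dst_le.2 fun i => by
    rw [abs_le]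
    unfold tow
    split_ifs <;> constructor <;> push_cast <;> omega

theorem dst_tow_le (k : ℕ) : dst (tow o y k) y ≤ k :=
  dst_le.2 fun i => by
    rw [abs_le]
    unfold tow
    split_ifs <;> constructor <;> omega

theorem dst_tow_add_le {t : ℕ} (k : ℕ) (h : dst y o + t ≤ R) (hk : t + k ≤ R) :
    dst (tow o y k) o + (t + k) ≤ R := by
  suffices hs : dst (tow o y k) o ≤ R - (t + k) by omega
  refine dst_le.2 fun i => ?_
  have := abs_le.1 (coord_le_dst y o i)
  rw [abs_le]
  unfold tow
  split_ifs <;> constructor <;> omega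

theorem tow_eq (k : ℕ) (h : dst y o ≤ k) : tow o y k = o := by
  funext i
  have := abs_le.1 (dst_le.1 h i)
  unfold tow
  split_ifs <;> omega

theorem Seed.of_conn {S : Set (ZVec d)} {a b : ZVec d} {r : ℕ} (h : Conn ω S a b)
    (hr : r ≤ dst b a) : Seed ω a r a := by
  obtain ⟨e, he, hd⟩ := h.exit_ball hr
  exact ⟨e, he.mono Set.inter_subset_right, by rw [dst_comm a e]; omega⟩

theorem conn_of_ray (hK : 4 ≤ K) (hDK : K ≤ D) (hy : dst y o + D ≤ R)
    (hs : Seed ω y (D / K) y)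
    (hg : ∀ k, D ≤ k → k ≤ R → Good K ω (tow o y (k - D)) (k / K)) (hv : Seed ω o (R / K) v) :
    Conn ω (bx o R) y v := by
  have hsub : ∀ j, D + j ≤ R → bx (tow o y j) (K * ((D + j) / K)) ⊆ bx o R := fun j hj =>
    bx_mono (by
      have := dst_tow_add_le j hy hj
      have := Nat.mul_div_le (D + j) K
      omega)
  have key : ∀ j, D + j ≤ R → ∀ a, Seed ω (tow o y j) ((D + j) / K) a → Conn ω (bx o R) y a := by
    intro j
    induction j with
    | zero =>
      intro hj a ha
      have := hg D le_rfl hj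
      have h0 := hsub 0 hj
      rw [Nat.sub_self] at this
      rw [tow_zero] at this ha h0
      exact (Good.link this hs ha (by rw [dst_self]; omega) (by omega)).mono h0
    | succ j ih =>
      intro hj a ha
      have h1 := hg (D + j) (by omega) (by omega)
      have h2 := hg (D + (j + 1)) (by omega) hj
      rw [Nat.add_sub_cancel_left] at h1 h2
      obtain ⟨a', ha'⟩ := h1.1
      have h3 : 1 ≤ (D + j) / K := (Nat.one_le_div_iff (by omega)).2 (by omega)
      have h4 : (D + (j + 1)) / K ≤ (D + j) / K + 1 := by
        rw [← Nat.add_div_right _ (by omega)]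
        exact Nat.div_le_div_right (by omega)
      have h5 : (D + j) / K ≤ (D + (j + 1)) / K := Nat.div_le_div_right (by omega)
      have h6 := dst_tow_succ (o := o) (y := y) j
      exact (ih (by omega) a' ha').trans
        ((Good.link h2 ha' ha (by omega) (by omega)).mono (hsub _ hj))
  refine key (R - D) (by omega) v ?_
  rwa [tow_eq _ (by omega), show D + (R - D) = R by omega]

/-- The bad event at `u` and scale `M + j`. -/
def BadAt (K : ℕ) (o : ZVec d) (R D M j : ℕ) (u : ZVec d) (ω : Config d) : Prop :=
  (j = 0 ∧ (Hug ω o R u M D ∨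
    ∃ k ∈ Finset.Ico D M, ∃ z ∈ bxF u (3 * M), ¬ Good K ω z (k / K))) ∨
  ∃ z ∈ bxF u (3 * (M + j)), ¬ Good K ω z ((M + j) / K)

/-- The union of the clusters in `bx o R` of the central seeds. -/
def hub (K : ℕ) (o : ZVec d) (R : ℕ) (ω : Config d) : Set (ZVec d) :=
  {x | ∃ v, Seed ω o (R / K) v ∧ Conn ω (bx o R) x v}

theorem mem_hub_of_not_badAt (hK : 4 ≤ K) (hDK : K ≤ D) (hDM : D ≤ M)
    (hbad : ∀ j ≤ R, ¬ BadAt K o R D M j u ω)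
    (hu : ∃ x, Conn ω (bx u M ∩ bx o R) u x ∧ dst x u = M) : u ∈ hub K o R ω := by
  have hD := Nat.div_le_self D K
  have hDK2 : 2 * (D / K) ≤ D := by
    have h1 := Nat.div_le_div_left hK (by norm_num) (a := D)
    omega
  have hh : ∃ y, Conn ω (bx u (2 * M) ∩ bx o R) u y ∧ dst y o + D ≤ R := by
    by_contra hcon
    exact hbad 0 (by omega) (Or.inl ⟨rfl, Or.inl ⟨hu, hcon⟩⟩)
  obtain ⟨y, hy, hyo⟩ := hh
  obtain ⟨x, hx, hxu⟩ := hu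
  have hyu : dst y u ≤ 2 * M := hy.mem_right.1
  have hs : Seed ω y (D / K) y := by
    by_cases h : D / K ≤ dst u y
    · exact Seed.of_conn hy.symm h
    · have hxy := dst_triangle x y u
      rw [dst_comm y u] at hxy
      exact Seed.of_conn (hy.symm.trans (hx.mono (Set.inter_subset_inter_left _
        (bx_mono (by simp; omega))))) (b := x) (by omega)
  have hg : ∀ k, D ≤ k → k ≤ R → Good K ω (tow o y (k - D)) (k / K) := by
    intro k hk hkR
    by_contra hng
    have h1 := dst_triangle (tow o y (k - D)) y u
    have h2 := dst_tow_le (o := o) (y := y) (k - D)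
    by_cases hkM : k < M
    · exact hbad 0 (by omega) (Or.inl ⟨rfl, Or.inr ⟨k, Finset.mem_Ico.2 ⟨hk, hkM⟩, _,
        mem_bxF.2 (by omega), hng⟩⟩)
    · refine hbad (k - M) (by omega) (Or.inr ⟨tow o y (k - D), mem_bxF.2 ?_, ?_⟩)
      · omega
      · rwa [show M + (k - M) = k by omega]
  obtain ⟨v, hv⟩ := (hg R (by omega) le_rfl).1
  rw [tow_eq _ (by omega)] at hv
  exact ⟨v, hv, (hy.mono Set.inter_subset_right).trans (conn_of_ray hK hDK hyo hs hg hv)⟩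

/-- A step in `S` along an edge which is open or has both endpoints in `F`. -/
def StepF (ω : Config d) (S : Set (ZVec d)) (F : Finset (ZVec d)) (x y : ZVec d) : Prop :=
  Adj d x y ∧ x ∈ S ∧ y ∈ S ∧ (EdgeOpen d ω x y ∨ x ∈ F ∧ y ∈ F)

theorem StepF.symm {S : Set (ZVec d)} {F : Finset (ZVec d)} {x y : ZVec d}
    (h : StepF ω S F x y) : StepF ω S F y x :=
  ⟨adj_comm.1 h.1, h.2.2.1, h.2.1, h.2.2.2.imp EdgeOpen.symm And.symm⟩

theorem exists_mem_or_conn {S : Set (ZVec d)} {F : Finset (ZVec d)} (hM : 1 ≤ M) (hu : u ∈ S)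
    (h : Relation.ReflTransGen (StepF ω S F) u y) (hy : M ≤ dst u y) :
    (∃ c ∈ F, dst u c ≤ M) ∨ ∃ x, Conn ω (bx u M ∩ S) u x ∧ dst x u = M := by
  obtain ⟨c, e, -, ⟨hc, hcM⟩, ⟨hadj, hcS, heS, hopen⟩, he⟩ := exists_exit
    (P := fun x => Conn ω (bx u M ∩ S) u x ∧ dst x u < M) h
    ⟨.refl ⟨by simp, hu⟩, by rw [dst_self]; omega⟩
    (by rw [dst_comm] at hy; rintro ⟨-, h⟩; omega)
  rcases hopen with ho | ho
  · right
    have h1 := ho.adj.dst_le_one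
    have h2 := dst_triangle e c u
    rw [dst_comm e c] at h2
    have h3 : Conn ω (bx u M ∩ S) u e := hc.trans (.single ho hc.mem_right ⟨by simp; omega, heS⟩)
    exact ⟨e, h3, by_contra fun h => he ⟨h3, by omega⟩⟩
  · exact Or.inl ⟨c, ho.1, by rw [dst_comm]; exact hcM.le⟩

/-- A chain of steps in `bx o R`, long but using few vertices of closed edges, which avoids the
hub. -/
def Avoids (K : ℕ) (o : ZVec d) (R l f : ℕ) (ω : Config d) : Prop :=
  ∃ v ∈ bx o R, ∃ (e : ZVec d) (F : Finset (ZVec d)), F.card ≤ f ∧ l ≤ dst v e ∧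
    Relation.ReflTransGen (StepF ω (bx o R \ hub K o R ω) F) v e

theorem Avoids.exists_chain {l f : ℕ} (hK : 4 ≤ K) (hDK : K ≤ D) (hDM : D ≤ M)
    (hl : 2 * M ≤ l) (h : Avoids K o R l f ω) :
    ∃ v ∈ bxF o R, ∃ (e : ZVec d) (F : Finset (ZVec d)), F.card ≤ f ∧ l ≤ dst v e ∧
      (∀ OK : ZVec d → Prop, (∀ u, ((∃ c ∈ F, dst u c ≤ M) ∨ ∃ j ≤ R, BadAt K o R D M j u ω) → OK u) →
        OK v ∧ Relation.ReflTransGen (fun u u' => dst u u' ≤ 1 ∧ OK u ∧ OK u') v e) := by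
  obtain ⟨v, hv, e, F, hF, hve, hc⟩ := h
  refine ⟨v, mem_bxF.2 hv, e, F, hF, hve, fun OK hOK => ?_⟩
  have hall : ∀ u ∈ bx o R \ hub K o R ω,
      Relation.ReflTransGen (StepF ω (bx o R \ hub K o R ω) F) v u →
      OK u := by
    intro u hu hvu
    have huv := rtg_symm (fun _ _ h => StepF.symm h) hvu
    obtain ⟨y, hy, huy⟩ : ∃ y, Relation.ReflTransGen (StepF ω (bx o R \ hub K o R ω) F) u y ∧
        M ≤ dst u y := by
      by_cases h : M ≤ dst u v
      · exact ⟨v, huv, h⟩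
      · have := dst_triangle v u e
        rw [dst_comm v u] at this
        exact ⟨e, huv.trans hc, by omega⟩
    rcases exists_mem_or_conn (by omega) hu hy huy with h | ⟨x, hx, hxu⟩
    · exact hOK u (Or.inl h)
    · refine hOK u (Or.inr ?_)
      by_contra! hcon
      exact hu.2 (mem_hub_of_not_badAt hK hDK hDM hcon ⟨x, hx.mono (Set.inter_subset_inter_right _
        Set.sdiff_subset), hxu⟩)
  have hvS : v ∈ bx o R \ hub K o R ω := by
    rcases Relation.ReflTransGen.cases_head hc with rfl | ⟨c, hc, -⟩
    · simp at hve; omega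
    · exact hc.2.1
  refine ⟨hall v hvS .refl, ?_⟩
  clear hve
  induction hc with
  | refl => exact .refl
  | @tail b c hb hbc ih =>
    exact ih.tail ⟨hbc.1.dst_le_one, hall b hbc.2.1 hb, hall c hbc.2.2.1 (hb.tail hbc)⟩

end

section

variable {d : ℕ}
variable {p ρ cs : ℝ} {μ : Measure (Config d)} {ω : Config d}

/-! ### Long chains avoiding the hub are exponentially unlikely -/

theorem expSmall_pow {q : ℝ≥0∞} (hq : q < 1) : ExpSmall fun n => q ^ n := by
  set t : ℝ := max q.toReal (1 / 2) with ht
  have hqt : q.toReal < 1 := by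
    rw [← ENNReal.toReal_one]
    exact (ENNReal.toReal_lt_toReal hq.ne_top (by simp)).2 hq
  have ht1 : t < 1 := max_lt hqt (by norm_num)
  have ht0 : 0 < t := lt_max_of_lt_right (by norm_num)
  refine (expSmall_exp one_pos (neg_pos.2 (Real.log_neg ht0 ht1))).mono fun n => ?_
  have h1 : q ≤ ENNReal.ofReal t := by
    rw [← ENNReal.ofReal_toReal hq.ne_top]
    exact ENNReal.ofReal_le_ofReal (le_max_left _ _)
  refine (pow_le_pow_left' h1 n).trans ?_
  rw [← ENNReal.ofReal_pow ht0.le, one_mul, neg_neg, mul_comm, Real.exp_nat_mul, Real.exp_log ht0]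

theorem loc_badAt {K D M : ℕ} (hK : 4 ≤ K) (o : ZVec d) (R j : ℕ) (u : ZVec d) :
    Loc (edgesIn (bx u (4 * (M + j)))) (BadAt K o R D M j u) := by
  intro ω ω' h
  have hgood : ∀ z k, dst z u ≤ 3 * (M + j) → k ≤ M + j →
      (Good K ω z (k / K) ↔ Good K ω' z (k / K)) := by
    intro z k hz hk
    refine (loc_good hK z (k / K)).mono (edgesIn_mono (bx_mono ?_)) ω ω' h
    have := Nat.mul_div_le k K
    omega
  refine or_congr (and_congr_right fun hj => or_congr ?_ ?_) ?_
  · exact (loc_hug o R u M D).mono (edgesIn_mono (bx_mono (by simp; omega))) ω ω' h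
  · refine exists_congr fun k => and_congr_right fun hk => exists_congr fun z =>
      and_congr_right fun hz => not_congr (hgood z k ?_ ?_)
    · have := mem_bxF.1 hz; omega
    · have := Finset.mem_Ico.1 hk; omega
  · exact exists_congr fun z => and_congr_right fun hz => not_congr (hgood z _ (mem_bxF.1 hz) le_rfl)

theorem measure_exists_not_good_le {K : ℕ} {f : ℕ → ℝ≥0∞}
    (hG : ∀ z r, μ {ω | ¬ Good K ω z r} ≤ f r) (u : ZVec d) (t r : ℕ) :
    μ {ω | ∃ z ∈ bxF u t, ¬ Good K ω z r} ≤ ((2 * t + 1) ^ d : ℕ) * f r := by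
  have : {ω | ∃ z ∈ bxF u t, ¬ Good K ω z r} = ⋃ z ∈ bxF u t, {ω | ¬ Good K ω z r} := by
    ext; simp
  rw [this]
  refine (measure_biUnion_finset_le _ _).trans ((Finset.sum_le_sum fun z _ => hG z r).trans ?_)
  rw [Finset.sum_const, card_bxF, nsmul_eq_mul]

theorem measure_badAt_le {K D M R : ℕ} {f : ℕ → ℝ≥0∞} {q : ℝ≥0∞} {o : ZVec d}
    (hG : ∀ z r, μ {ω | ¬ Good K ω z r} ≤ f r) (hq : ∀ u, μ {ω | Hug ω o R u M D} ≤ q)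
    (j : ℕ) (u : ZVec d) :
    μ {ω | BadAt K o R D M j u ω} ≤
      (if j = 0 then q + ((6 * M + 1) ^ d : ℕ) * ∑' k, f ((D + k) / K) else 0) +
        ((6 * (M + j) + 1) ^ d : ℕ) * f ((M + j) / K) := by
  have h6 : ∀ m : ℕ, 2 * (3 * m) + 1 = 6 * m + 1 := fun m => by ring
  have h2 : μ {ω | ∃ z ∈ bxF u (3 * (M + j)), ¬ Good K ω z ((M + j) / K)} ≤
      ((6 * (M + j) + 1) ^ d : ℕ) * f ((M + j) / K) := by
    have := measure_exists_not_good_le hG u (3 * (M + j)) ((M + j) / K)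
    rwa [h6] at this
  have hsub : {ω | BadAt K o R D M j u ω} ⊆
      (if j = 0 then {ω | Hug ω o R u M D} ∪
        ⋃ k ∈ Finset.Ico D M, {ω | ∃ z ∈ bxF u (3 * M), ¬ Good K ω z (k / K)} else ∅) ∪
      {ω | ∃ z ∈ bxF u (3 * (M + j)), ¬ Good K ω z ((M + j) / K)} := by
    rintro ω (⟨hj, h⟩ | h)
    · left
      rw [if_pos hj]
      refine h.imp id fun ⟨k, hk, h⟩ => ?_
      simp only [Set.mem_iUnion]
      exact ⟨k, hk, h⟩
    · exact Or.inr h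
  refine (measure_mono hsub).trans ((measure_union_le _ _).trans (add_le_add ?_ h2))
  split_ifs with hj
  · refine (measure_union_le _ _).trans (add_le_add (hq u) ((measure_biUnion_finset_le _ _).trans ?_))
    calc _ ≤ ∑ k ∈ Finset.Ico D M, (((6 * M + 1) ^ d : ℕ) : ℝ≥0∞) * f (k / K) :=
          Finset.sum_le_sum fun k _ => by
            have := measure_exists_not_good_le hG u (3 * M) (k / K)
            rwa [h6] at this
      _ ≤ _ := by
        rw [← Finset.mul_sum, Finset.sum_Ico_eq_sum_range]
        gcongr
        exact ENNReal.sum_le_tsum _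
  · simp

theorem Setup.avoids_aux (H : Setup d p μ ρ cs) {K : ℕ} {f : ℕ → ℝ≥0∞} (hK : 4 ≤ K)
    (hf : ExpSmall f) (hG : ∀ z r, μ {ω | ¬ Good K ω z r} ≤ f r) :
    ∃ (M : ℕ) (x b : ℝ≥0∞), x ≠ 0 ∧ x ≤ 1 ∧ 1 < b ∧ b ≠ ⊤ ∧ ∀ (o : ZVec d) (R l m : ℕ),
      M ≤ R → 2 * M ≤ l →
        x ^ m * b ^ l * μ {ω | Avoids K o R l m ω} ≤ ((2 * R + 1) ^ d : ℕ) := by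
  obtain ⟨c0, q, hq, hhug⟩ := H.hug
  have hK0 : 0 < K := by omega
  let Mf : ℕ → ℕ := fun D => D + D * (c0 * D + 1)
  have hMD : ∀ D, D ≤ Mf D := fun D => by simp [Mf]
  have hMsq : ∀ D, Mf D ≤ ((c0 + 2) * D + 0) ^ 2 := fun D => by
    rcases Nat.eq_zero_or_pos D with rfl | h
    · simp [Mf]
    simp only [Mf, add_zero, mul_pow]
    have h1 : D ≤ D ^ 2 := Nat.le_self_pow two_ne_zero D
    nlinarith [Nat.zero_le (c0 * D ^ 2), Nat.zero_le (c0 ^ 2 * D ^ 2)]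
  let e28 : ℕ := ⌈Real.exp 28⌉₊
  have hg1 : ExpSmall fun D => ((60 ^ d * e28 * Mf D ^ (2 * d) : ℕ) : ℝ≥0∞) *
      ((2 * d : ℕ) * q ^ D) := by
    refine ((((expSmall_pow hq).const_mul (2 * d)).poly (c0 + 2) 0 (2 * (2 * d))).const_mul
      (60 ^ d * e28)).mono fun D => ?_
    have h1 : Mf D ^ (2 * d) ≤ ((c0 + 2) * D + 0) ^ (2 * (2 * d)) := by
      rw [pow_mul _ 2 (2 * d)]; exact Nat.pow_le_pow_left (hMsq D) _
    rw [← mul_assoc ((60 ^ d * e28 : ℕ) : ℝ≥0∞), ← Nat.cast_mul]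
    exact mul_le_mul' (Nat.cast_le.2 (Nat.mul_le_mul_left _ h1)) le_rfl
  have hg2 : ExpSmall fun D => ((60 ^ d * e28 * Mf D ^ (2 * d) : ℕ) : ℝ≥0∞) *
      (((6 * Mf D + 1) ^ d : ℕ) * ∑' k, f ((D + k) / K)) := by
    refine ((((hf.div K hK0).tail).poly (7 * (c0 + 2)) 1 (2 * (3 * d))).const_mul
      (60 ^ d * e28)).mono fun D => ?_
    have h1 := hMsq D
    rw [add_zero] at h1
    have h2 : 6 * Mf D + 1 ≤ (7 * (c0 + 2) * D + 1) ^ 2 := by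
      generalize hX : (c0 + 2) * D = X at h1
      rw [mul_assoc, hX]
      nlinarith [Nat.zero_le X, Nat.zero_le (X ^ 2)]
    have h3 : Mf D ≤ (7 * (c0 + 2) * D + 1) ^ 2 := by omega
    have h4 : Mf D ^ (2 * d) * (6 * Mf D + 1) ^ d ≤ (7 * (c0 + 2) * D + 1) ^ (2 * (3 * d)) := by
      rw [pow_mul _ 2 (3 * d), show 3 * d = 2 * d + d by ring, pow_add]
      exact Nat.mul_le_mul (Nat.pow_le_pow_left h3 _) (Nat.pow_le_pow_left h2 _)
    rw [← mul_assoc, ← Nat.cast_mul, ← mul_assoc, ← Nat.cast_mul]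
    refine mul_le_mul' (Nat.cast_le.2 ?_) le_rfl
    rw [mul_assoc (60 ^ d * e28)]
    exact Nat.mul_le_mul_left _ h4
  have hgs := (hg1.add hg2).tendsto
  have hh : ExpSmall fun m => ((60 ^ d : ℕ) : ℝ≥0∞) * (((1 * m + 0) ^ (2 * d) : ℕ) *
      (((6 * m + 1) ^ d : ℕ) * f (m / K))) := (((hf.div K hK0).poly 6 1 d).poly 1 0 (2 * d)).const_mul _
  obtain ⟨C, c, hC, hc, hhb⟩ := hh
  have hh2 := (expSmall_exp hC (half_pos hc)).tail.tendsto
  obtain ⟨D0, hD0⟩ := Filter.eventually_atTop.1 (hh2.eventually_le_const (u := 8⁻¹) (by simp))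
  obtain ⟨D, ⟨hgD, hDD0⟩, hDc, hDK⟩ := (((hgs.eventually_le_const (u := 8⁻¹) (by simp)).and
    (Filter.eventually_ge_atTop D0)).and ((Filter.eventually_ge_atTop ⌈56 / c⌉₊).and
    (Filter.eventually_ge_atTop K))).exists
  set M := Mf D with hM
  have hDM : D ≤ M := hMD D
  have hM0 : 0 < M := by omega
  have hMr : (0 : ℝ) < M := by exact_mod_cast hM0
  have hMc : 56 / c ≤ M := (Nat.ceil_le.1 hDc).trans (by exact_mod_cast hDM)
  set b : ℝ≥0∞ := ENNReal.ofReal (Real.exp (1 / M)) with hb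
  have hbpow : ∀ m : ℕ, b ^ (7 * 4 * m) = ENNReal.ofReal (Real.exp (28 * m / M)) := fun m => by
    rw [hb, ← ENNReal.ofReal_pow (Real.exp_pos _).le, ← Real.exp_nat_mul]
    congr 2
    push_cast
    ring
  have hb1 : 1 < b := by
    rw [hb, ← ENNReal.ofReal_one]
    exact (ENNReal.ofReal_lt_ofReal_iff (Real.exp_pos _)).2 (Real.one_lt_exp_iff.2 (by positivity))
  set A : ℕ := 60 ^ d * e28 * M ^ (2 * d) with hA
  have hbM : b ^ (7 * 4 * M) ≤ e28 := by
    rw [hbpow, mul_div_assoc, div_self hMr.ne', mul_one, ← ENNReal.ofReal_natCast]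
    exact ENNReal.ofReal_le_ofReal (Nat.le_ceil _)
  have he28 : 0 < e28 := Nat.ceil_pos.2 (Real.exp_pos _)
  have hA0 : 0 < A := by positivity
  refine ⟨M, (8 * A : ℕ)⁻¹, b, by simp [ENNReal.mul_eq_top], ?_, hb1, by simp [hb], ?_⟩
  · rw [ENNReal.inv_le_one]
    exact_mod_cast (by omega : 1 ≤ 8 * A)
  intro o R l m hMR hl
  have hD1 : 1 ≤ D := by omega
  have hhugM : ∀ u, μ {ω | Hug ω o R u M D} ≤ (2 * d : ℕ) * q ^ D := by
    intro u
    have h1 : c0 * D + D ≤ M := by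
      have : D * 1 ≤ D * D := Nat.mul_le_mul_left D hD1
      rw [hM]
      simp only [Mf]
      nlinarith [Nat.mul_le_mul_left c0 this]
    have := hhug o u R M D hD1 (by rw [add_mul, one_mul]; omega) h1
    rwa [show M - D = D * (c0 * D + 1) by rw [hM]; simp [Mf], Nat.mul_div_cancel _ (by omega)] at this
  let w : Option (Fin (R + 1)) → ℝ≥0∞ := fun θ => θ.elim 0 fun j =>
    (if (j : ℕ) = 0 then (2 * d : ℕ) * q ^ D + ((6 * M + 1) ^ d : ℕ) * ∑' k, f ((D + k) / K) else 0) +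
        ((6 * (M + j) + 1) ^ d : ℕ) * f ((M + j) / K)
  let rad : Option (Fin (R + 1)) → ℕ := fun θ => θ.elim M fun j => M + j
  let P : Option (Fin (R + 1)) → ZVec d → Config d → Prop := fun θ u ω =>
    θ.elim False fun j => BadAt K o R D M j u ω
  obtain ⟨cl, hcl⟩ : ∃ cl : Option (Fin (R + 1)) → Prop, ∀ θ, cl θ ↔ θ = none :=
    ⟨_, fun _ => Iff.rfl⟩
  have hclS : ∀ j, ¬ cl (some j) := fun j => by simp [hcl]
  have hclN : cl none := by simp [hcl]
  have key := pathBad_le rad 4 H.p0.le H.p1.le H.ber (by rintro (_ | j) <;> simp [rad] <;> omega)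
    (by norm_num) cl P (fun θ u => bx u (4 * rad θ)) (fun θ u => bx_finite _ _)
    (fun θ θ' u u' h => Set.disjoint_left.2 fun y h1 h2 => by
      have := dst_triangle u y u'
      simp only [Set.mem_ofPred_eq] at h1 h2
      rw [dst_comm u y] at this
      omega)
    (by
      rintro (_ | j) u h
      · exact absurd hclN h
      · exact loc_badAt hK o R j u)
    w (by
      rintro (_ | j) u h
      · exact absurd hclN h
      · exact measure_badAt_le hG hhugM j u)
    (8 * A : ℕ)⁻¹ b (by
      rw [ENNReal.inv_le_one]
      exact_mod_cast (by omega : 1 ≤ 8 * A)) hb1.le (by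
      rw [Fintype.sum_option]
      have hnone : (((15 * 4) ^ d * rad none ^ (2 * d) : ℕ) : ℝ≥0∞) *
          ((if cl none then ((8 * A : ℕ) : ℝ≥0∞)⁻¹ else w none) * b ^ (7 * 4 * rad none)) ≤ 8⁻¹ := by
        rw [if_pos hclN, mul_comm (_⁻¹), ← mul_assoc]
        have h1 : (((15 * 4) ^ d * rad none ^ (2 * d) : ℕ) : ℝ≥0∞) * b ^ (7 * 4 * rad none) ≤ A := by
          refine (mul_le_mul_right hbM _).trans (le_of_eq ?_)
          rw [hA]
          simp only [rad, Option.elim]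
          push_cast
          ring
        refine (mul_le_mul_left h1 _).trans ?_
        rw [show ((8 * A : ℕ) : ℝ≥0∞) = ((8 : ℕ) : ℝ≥0∞) * ((A : ℕ) : ℝ≥0∞) from Nat.cast_mul 8 A,
          ENNReal.mul_inv (by simp) (by simp), mul_comm, mul_assoc,
          ENNReal.inv_mul_cancel (Nat.cast_ne_zero.2 hA0.ne') (by simp), mul_one]
        simp
      have hsome : ∀ j : Fin (R + 1), (((15 * 4) ^ d * rad (some j) ^ (2 * d) : ℕ) : ℝ≥0∞) *
          ((if cl (some j) then ((8 * A : ℕ) : ℝ≥0∞)⁻¹ else w (some j)) * b ^ (7 * 4 * rad (some j))) ≤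
          (if (j : ℕ) = 0 then 8⁻¹ else 0) +
            ENNReal.ofReal (C * Real.exp (-(c / 2) * ((M + j : ℕ) : ℝ))) := by
        intro j
        rw [if_neg (hclS j)]
        simp only [rad, w, Option.elim]
        rw [add_mul, mul_add]
        refine add_le_add ?_ ?_
        · split_ifs with hj
          · rw [hj, add_zero]
            refine le_trans ?_ hgD
            rw [← mul_add, mul_comm (_ + _), ← mul_assoc]
            gcongr
            exact (mul_le_mul_right hbM _).trans (le_of_eq (by rw [hA]; push_cast; ring))
          · simp
        · rw [← mul_assoc, hbpow]
          have h1 := hhb (M + j)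
          beta_reduce at h1
          rw [one_mul, add_zero, ← mul_assoc, ← Nat.cast_mul] at h1
          refine (mul_le_mul_left h1 _).trans ?_
          rw [← ENNReal.ofReal_mul (by positivity)]
          refine ENNReal.ofReal_le_ofReal ?_
          rw [mul_assoc, ← Real.exp_add]
          gcongr
          have h2 : 28 / (M : ℝ) ≤ c / 2 := by
            rw [div_le_iff₀ hMr]
            rw [div_le_iff₀ hc] at hMc
            linarith
          have h3 : (0 : ℝ) ≤ ((M + j : ℕ) : ℝ) := by positivity
          have h4 : 28 * ((M + j : ℕ) : ℝ) / M = 28 / M * ((M + j : ℕ) : ℝ) := by ring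
          rw [h4]
          nlinarith
      have hsum : ∑ j : Fin (R + 1), ((if (j : ℕ) = 0 then (8⁻¹ : ℝ≥0∞) else 0) +
            ENNReal.ofReal (C * Real.exp (-(c / 2) * ((M + j : ℕ) : ℝ)))) ≤ 8⁻¹ + 8⁻¹ := by
        rw [Finset.sum_add_distrib]
        refine add_le_add ?_ ?_
        · rw [Fin.sum_univ_succ]
          simp
        · refine le_trans ?_ (hD0 M (by omega))
          rw [Fin.sum_univ_eq_sum_range (fun j =>
            ENNReal.ofReal (C * Real.exp (-(c / 2) * ((M + j : ℕ) : ℝ))))]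
          exact ENNReal.sum_le_tsum _
      refine (add_le_add hnone ((Finset.sum_le_sum fun j _ => hsome j).trans hsum)).trans ?_
      have h8 : (8⁻¹ : ℝ≥0∞) = ENNReal.ofReal (1 / 8) := by
        rw [one_div, ENNReal.ofReal_inv_of_pos (by norm_num)]; simp
      have h2 : (2⁻¹ : ℝ≥0∞) = ENNReal.ofReal (1 / 2) := by
        rw [one_div, ENNReal.ofReal_inv_of_pos (by norm_num)]; simp
      rw [h8, h2, ← ENNReal.ofReal_add (by norm_num) (by norm_num),
        ← ENNReal.ofReal_add (by norm_num) (by norm_num)]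
      exact ENNReal.ofReal_le_ofReal (by norm_num))
  have hsub : {ω | Avoids K o R l m ω} ⊆ ⋃ v ∈ bxF o R, {ω | ∃ (e : ZVec d) (F : Finset (ZVec d)),
      F.card ≤ m ∧ l ≤ dst v e ∧ (∃ θ, if cl θ then ∃ y ∈ F, dst v y ≤ rad θ else P θ v ω) ∧
      Relation.ReflTransGen (fun u u' => dst u u' ≤ 1 ∧
        (∃ θ, if cl θ then ∃ y ∈ F, dst u y ≤ rad θ else P θ u ω) ∧
        ∃ θ, if cl θ then ∃ y ∈ F, dst u' y ≤ rad θ else P θ u' ω) v e} := by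
    intro ω hω
    obtain ⟨v, hv, e, F, hF, hve, hOK⟩ := Avoids.exists_chain hK hDK hDM hl hω
    simp only [Set.mem_iUnion]
    refine ⟨v, hv, e, F, hF, hve, hOK (fun u => ∃ θ, if cl θ then ∃ y ∈ F, dst u y ≤ rad θ else P θ u ω)
      fun u hu => ?_⟩
    rcases hu with hu | ⟨j, hj, hu⟩
    · exact ⟨none, by rw [if_pos hclN]; exact hu⟩
    · exact ⟨some ⟨j, by omega⟩, by rw [if_neg (hclS _)]; exact hu⟩
  calc _ ≤ ((8 * A : ℕ) : ℝ≥0∞)⁻¹ ^ m * b ^ l * ∑ v ∈ bxF o R, μ _ := by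
        gcongr
        exact (measure_mono hsub).trans (measure_biUnion_finset_le _ _)
    _ ≤ ∑ v ∈ bxF o R, 1 := by
        rw [Finset.mul_sum]
        exact Finset.sum_le_sum fun v _ => key v l m
    _ = _ := by rw [Finset.sum_const, card_bxF, nsmul_eq_mul, mul_one]

end

section

variable {d : ℕ}
variable {p ρ cs : ℝ} {μ : Measure (Config d)} {ω : Config d}

theorem Setup.avoids (H : Setup d p μ ρ cs) {K : ℕ} {f : ℕ → ℝ≥0∞} (hK : 4 ≤ K)
    (hf : ExpSmall f) (hG : ∀ z r, μ {ω | ¬ Good K ω z r} ≤ f r) {Q : ℕ} (hQ : 0 < Q) :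
    ∃ (Q' : ℕ) (g : ℕ → ℝ≥0∞), 0 < Q' ∧ ExpSmall g ∧
      ∀ (o : ZVec d) (N : ℕ), μ {ω | Avoids K o (3 * N) (N / Q) (N / Q') ω} ≤ g N := by
  have := H.ber.1
  obtain ⟨M, x, b, hx0, hx1, hb1, hbt, hmain⟩ := H.avoids_aux hK hf hG
  obtain ⟨β, hβ, hbβ⟩ : ∃ β : ℝ, 0 < β ∧ b = ENNReal.ofReal (Real.exp β) := by
    have h1 : 1 < b.toReal := by
      rw [← ENNReal.toReal_one]; exact (ENNReal.toReal_lt_toReal (by simp) hbt).2 hb1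
    exact ⟨Real.log b.toReal, Real.log_pos h1, by
      rw [Real.exp_log (by linarith), ENNReal.ofReal_toReal hbt]⟩
  obtain ⟨α, hα, hxα⟩ : ∃ α : ℝ, 0 ≤ α ∧ x = ENNReal.ofReal (Real.exp (-α)) := by
    have hxt : x ≠ ⊤ := (hx1.trans_lt (by simp)).ne
    have h0 : 0 < x.toReal := ENNReal.toReal_pos hx0 hxt
    have h1 : x.toReal ≤ 1 := by
      rw [← ENNReal.toReal_one]; exact (ENNReal.toReal_le_toReal hxt (by simp)).2 hx1
    exact ⟨-Real.log x.toReal, neg_nonneg.2 (Real.log_nonpos h0.le h1), by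
      rw [neg_neg, Real.exp_log h0, ENNReal.ofReal_toReal hxt]⟩
  have hQr : (0 : ℝ) < Q := by exact_mod_cast hQ
  obtain ⟨Q', hQ'⟩ := exists_nat_ge (2 * Q * α / β + 1)
  have hQ'1 : 1 ≤ (Q' : ℝ) := by
    have : 0 ≤ 2 * Q * α / β := by positivity
    linarith
  have hQ'0 : 0 < Q' := by exact_mod_cast (by linarith : (0 : ℝ) < Q')
  have hαβ : α / Q' ≤ β / (2 * Q) := by
    rw [div_le_div_iff₀ (by linarith) (by positivity)]
    have : 2 * Q * α / β ≤ Q' := by linarith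
    rw [div_le_iff₀ hβ] at this
    linarith
  have hg : ExpSmall fun N => ((6 * N + 1) ^ d : ℕ) *
      ENNReal.ofReal (Real.exp β * Real.exp (-(β / (2 * Q)) * N)) :=
    (expSmall_exp (Real.exp_pos β) (by positivity : 0 < β / (2 * Q))).poly 6 1 d
  refine ⟨Q', fun N => ⨆ o, μ {ω | Avoids K o (3 * N) (N / Q) (N / Q') ω}, hQ'0,
    ExpSmall.of_eventually (fun N => iSup_le fun o => prob_le_one) (2 * M * Q + M) hg
      fun N hN => iSup_le fun o => ?_,
    fun o N => le_iSup (fun o => μ {ω | Avoids K o (3 * N) (N / Q) (N / Q') ω}) o⟩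
  have hNl : 2 * M ≤ N / Q := (Nat.le_div_iff_mul_le hQ).2 (by omega)
  have h := hmain o (3 * N) (N / Q) (N / Q') (by omega) hNl
  rw [show 2 * (3 * N) + 1 = 6 * N + 1 by ring] at h
  have hm : ((N / Q' : ℕ) : ℝ) ≤ N / Q' := Nat.cast_div_le
  have hl : (N : ℝ) / Q - 1 ≤ ((N / Q : ℕ) : ℝ) := by
    have := Nat.lt_div_mul_add hQ (a := N)
    have h2 : (N : ℝ) < (N / Q : ℕ) * Q + Q := by exact_mod_cast this
    rw [sub_le_iff_le_add, div_le_iff₀ hQr]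
    linarith
  have hE : ENNReal.ofReal (Real.exp (-β + β / (2 * Q) * N)) ≤ x ^ (N / Q') * b ^ (N / Q) := by
    rw [hxα, hbβ, ← ENNReal.ofReal_pow (Real.exp_pos _).le, ← ENNReal.ofReal_pow (Real.exp_pos _).le,
      ← Real.exp_nat_mul, ← Real.exp_nat_mul, ← ENNReal.ofReal_mul (Real.exp_pos _).le, ← Real.exp_add]
    refine ENNReal.ofReal_le_ofReal (Real.exp_le_exp.2 ?_)
    have h1 : ((N / Q' : ℕ) : ℝ) * α ≤ β / (2 * Q) * N := by
      calc _ ≤ (N : ℝ) / Q' * α := by gcongr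
        _ = α / Q' * N := by ring
        _ ≤ _ := by gcongr
    have h2 : ((N : ℝ) / Q - 1) * β ≤ ((N / Q : ℕ) : ℝ) * β := by gcongr
    have h3 : ((N : ℝ) / Q - 1) * β = 2 * (β / (2 * Q) * N) - β := by field_simp
    linarith
  have h1 : ENNReal.ofReal (Real.exp (-β + β / (2 * Q) * N)) *
      ENNReal.ofReal (Real.exp β * Real.exp (-(β / (2 * Q)) * N)) = 1 := by
    rw [← ENNReal.ofReal_mul (Real.exp_pos _).le, ← Real.exp_add, ← Real.exp_add,
      ← ENNReal.ofReal_one, ← Real.exp_zero]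
    congr 2
    ring
  calc _ = ENNReal.ofReal (Real.exp (-β + β / (2 * Q) * N)) *
        ENNReal.ofReal (Real.exp β * Real.exp (-(β / (2 * Q)) * N)) * μ _ := by rw [h1, one_mul]
    _ = ENNReal.ofReal (Real.exp (-β + β / (2 * Q) * N)) * μ _ *
        ENNReal.ofReal (Real.exp β * Real.exp (-(β / (2 * Q)) * N)) := by ring
    _ ≤ _ := mul_le_mul' ((mul_le_mul' hE le_rfl).trans h) le_rfl

end

section

variable {d : ℕ}
variable {ω : Config d} {n : ℕ}

/-! ### Closed edges of modified geodesics -/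

theorem pairWeight_nonneg (x y : ZVec d) : 0 ≤ pairWeight d n ω x y := by
  unfold pairWeight
  split_ifs <;> positivity

theorem pathCost_append (l₁ l₂ : List (ZVec d)) (x : ZVec d) :
    pathCost d n ω (l₁ ++ x :: l₂) = pathCost d n ω (l₁ ++ [x]) + pathCost d n ω (x :: l₂) := by
  induction l₁ with
  | nil => simp [pathCost]
  | cons a l ih =>
    cases l with
    | nil => simp [pathCost]
    | cons b l =>
      simp only [List.cons_append, pathCost] at ih ⊢
      rw [ih, add_assoc]

/-- The points `a` and `b` are joined by a path in `A` of cost at most `c`. -/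
def CostLE (n : ℕ) (ω : Config d) (A : Set (ZVec d)) (c : ℝ) (a b : ZVec d) : Prop :=
  ∃ γ, IsPath d γ ∧ (∀ v ∈ γ, v ∈ A) ∧ γ.head? = some a ∧ γ.getLast? = some b ∧
    pathCost d n ω γ ≤ c

theorem CostLE.refl {A : Set (ZVec d)} {a : ZVec d} (ha : a ∈ A) : CostLE n ω A 0 a a :=
  ⟨[a], ⟨by simp, by simp, List.isChain_singleton _⟩, by simpa using ha, rfl, rfl, by simp [pathCost]⟩

theorem CostLE.mono {A : Set (ZVec d)} {a b : ZVec d} {c c' : ℝ} (h : CostLE n ω A c a b)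
    (hc : c ≤ c') : CostLE n ω A c' a b := by
  obtain ⟨γ, h1, h2, h3, h4, h5⟩ := h
  exact ⟨γ, h1, h2, h3, h4, h5.trans hc⟩

theorem CostLE.cons {A : Set (ZVec d)} {x a b : ZVec d} {c : ℝ} (hx : x ∈ A) (hxa : Adj d x a)
    (h : CostLE n ω A c a b) : CostLE n ω A (pairWeight d n ω x a + c) x b := by
  obtain ⟨γ, ⟨hne, hnd, hch⟩, hA, hh, hl, hc⟩ := h
  have hw := pairWeight_nonneg (n := n) (ω := ω) x a
  by_cases hxγ : x ∈ γ
  · obtain ⟨s, t, rfl⟩ := List.append_of_mem hxγ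
    refine ⟨x :: t, ⟨by simp, hnd.of_append_right, List.IsChain.right_of_append hch⟩,
      fun v hv => hA v (List.mem_append_right _ hv), rfl, by simpa using hl, ?_⟩
    rw [pathCost_append] at hc
    have := pathCost_nonneg (ω := ω) n (s ++ [x])
    linarith
  · cases γ with
    | nil => exact absurd rfl hne
    | cons y γ =>
      simp only [List.head?_cons, Option.some.injEq] at hh
      subst hh
      refine ⟨x :: y :: γ, ⟨by simp, List.nodup_cons.2 ⟨hxγ, hnd⟩,
        List.isChain_cons_cons.2 ⟨hxa, hch⟩⟩, ?_, rfl, by simpa using hl, ?_⟩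
      · intro v hv
        rcases List.mem_cons.1 hv with rfl | hv
        · exact hx
        · exact hA v hv
      · rw [pathCost]
        linarith

theorem CostLE.prepend {A : Set (ZVec d)} {a b e : ZVec d} {c : ℝ} (h : CostLE n ω A c b e)
    {l : List (ZVec d)} (hl : l.IsChain (Adj d)) (hA : ∀ v ∈ l, v ∈ A) (ha : l.head? = some a)
    (hb : l.getLast? = some b) : CostLE n ω A (pathCost d n ω l + c) a e := by
  induction l generalizing a with
  | nil => simp at ha
  | cons x l ih =>
    simp only [List.head?_cons, Option.some.injEq] at ha
    subst ha
    cases l with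
    | nil =>
      simp only [List.getLast?_singleton, Option.some.injEq] at hb
      subst hb
      simpa [pathCost] using h
    | cons y l =>
      rw [pathCost, add_assoc]
      exact CostLE.cons (hA x (by simp)) (List.isChain_cons_cons.1 hl).1
        (ih hl.tail (fun v hv => hA v (List.mem_cons_of_mem _ hv)) rfl (by simpa using hb))

theorem CostLE.trans {A : Set (ZVec d)} {a b e : ZVec d} {c c' : ℝ} (h : CostLE n ω A c a b)
    (h' : CostLE n ω A c' b e) : CostLE n ω A (c + c') a e := by
  obtain ⟨γ, h1, h2, h3, h4, h5⟩ := h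
  exact (h'.prepend h1.2.2 h2 h3 h4).mono (by linarith)

theorem costLE_of_dst {o : ZVec d} {R : ℕ} {A : Set (ZVec d)} {L : ℝ} (hA : bx o R ⊆ A)
    (hL : Real.log n ^ 2 ≤ L) (hL1 : 1 ≤ L) {a b : ZVec d} (ha : a ∈ bx o R) (hb : b ∈ bx o R) :
    CostLE n ω A (d * dst a b * L) a b := by
  suffices h : ∀ k : ℕ, ∀ a ∈ bx o R, norm1 d (a - b) = k → CostLE n ω A (k * L) a b by
    refine (h _ a ha rfl).mono ?_
    have h1 : norm1 d (a - b) ≤ d * dst a b := by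
      unfold norm1
      calc _ ≤ ∑ _i : Fin d, dst a b := Finset.sum_le_sum fun i _ => by
            have := coord_le_dst a b i
            rw [Int.abs_eq_natAbs] at this
            exact_mod_cast this
        _ = _ := by simp
    have h2 : (norm1 d (a - b) : ℝ) ≤ d * dst a b := by exact_mod_cast h1
    gcongr
  intro k
  induction k with
  | zero =>
    intro a ha h
    have : a = b := by
      funext i
      have := (Finset.sum_eq_zero_iff.1 h) i (Finset.mem_univ i)
      simp only [Pi.sub_apply, Int.natAbs_eq_zero] at this
      omega
    subst this
    simpa using CostLE.refl (hA ha)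
  | succ k ih =>
    intro a ha h
    obtain ⟨i, hi⟩ : ∃ i, a i ≠ b i := by
      by_contra hc
      push Not at hc
      rw [funext hc] at h
      simp [norm1] at h
    obtain ⟨s, hs, hab⟩ : ∃ s : ℤ, |s| = 1 ∧ (a i + s - b i).natAbs + 1 = (a i - b i).natAbs := by
      rcases lt_or_gt_of_ne hi with h | h
      · exact ⟨1, rfl, by omega⟩
      · exact ⟨-1, rfl, by omega⟩
    have hadj := adj_update a i hs
    set a' := Function.update a i (a i + s) with ha'
    have hi' : a' i = a i + s := by simp [ha']
    have hj' : ∀ j, j ≠ i → a' j = a j := fun j hj => by simp [ha', hj]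
    have hbox : a' ∈ bx o R := by
      refine dst_le.2 fun j => ?_
      have h1 := abs_le.1 (dst_le.1 ha j)
      have h2 := abs_le.1 (dst_le.1 hb j)
      by_cases hj : j = i
      · subst hj
        rw [abs_le, hi']
        rcases (abs_eq zero_le_one).1 hs with rfl | rfl <;> constructor <;> omega
      · rw [hj' j hj]
        exact abs_le.2 h1
    have hn : norm1 d (a' - b) = k := by
      unfold norm1 at h ⊢
      rw [← Finset.add_sum_erase _ _ (Finset.mem_univ i)] at h ⊢
      have : ∑ j ∈ Finset.univ.erase i, ((a' - b) j).natAbs =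
          ∑ j ∈ Finset.univ.erase i, ((a - b) j).natAbs :=
        Finset.sum_congr rfl fun j hj => by
          rw [Pi.sub_apply, hj' j (Finset.ne_of_mem_erase hj), Pi.sub_apply]
      rw [this]
      simp only [Pi.sub_apply, hi'] at h ⊢
      omega
    refine (CostLE.cons (hA ha) hadj (ih a' hbox hn)).mono ?_
    have hw : pairWeight d n ω a a' ≤ L := by
      unfold pairWeight
      split_ifs <;> assumption
    push_cast
    linarith

theorem costLE_of_chemDist {A : Set (ZVec d)} {a b : ZVec d} (h : Conn ω Set.univ a b)
    (hA : bx a (chemDist d ω a b).toNat ⊆ A) :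
    CostLE n ω A (chemDist d ω a b).toNat a b := by
  obtain ⟨γ, h1, h2, -, h4, h5, h6⟩ := chemDistIn_attained (chemDist_ne_top.2 h)
  have h7 : (chemDist d ω a b).toNat = γ.length - 1 := by
    rw [chemDist, ← h6, ENat.toNat_natCast]
  rw [h7] at hA ⊢
  have hcost : ∀ γ : List (ZVec d), IsOpenPath d ω γ → pathCost d n ω γ = ((γ.length - 1 : ℕ) : ℝ) := by
    intro γ
    induction γ with
    | nil => intro _; simp [pathCost]
    | cons x l ih =>
      cases l with
      | nil => intro _; simp [pathCost]
      | cons y l =>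
        intro h
        rw [pathCost, ih (List.IsChain.tail h), pairWeight, if_pos (List.isChain_cons_cons.1 h).1]
        simp
        ring
  exact ⟨γ, h1, fun v hv => hA (dst_le_length h1.2.2 h4 v hv), h4, h5, (hcost γ h2).le⟩

theorem exists_closed_endpoints (l : List (ZVec d)) : ∃ F : Finset (ZVec d),
    F.card * Real.log n ^ 2 ≤ 2 * pathCost d n ω l ∧
      ∀ x y, (x, y) ∈ l.zip l.tail → EdgeOpen d ω x y ∨ x ∈ F ∧ y ∈ F := by
  induction l with
  | nil => exact ⟨∅, by simp [pathCost], by simp⟩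
  | cons a l ih =>
    cases l with
    | nil => exact ⟨∅, by simp [pathCost], by simp⟩
    | cons b l =>
      obtain ⟨F, hF, hxy⟩ := ih
      have hzip : ∀ x y, (x, y) ∈ (a :: b :: l).zip (a :: b :: l).tail →
          x = a ∧ y = b ∨ (x, y) ∈ (b :: l).zip (b :: l).tail := by
        intro x y h
        simpa using h
      by_cases hab : EdgeOpen d ω a b
      · refine ⟨F, ?_, fun x y h => ?_⟩
        · rw [pathCost]
          have := pairWeight_nonneg (n := n) (ω := ω) a b
          linarith
        · rcases hzip x y h with ⟨rfl, rfl⟩ | h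
          · exact Or.inl hab
          · exact hxy x y h
      · refine ⟨insert a (insert b F), ?_, fun x y h => ?_⟩
        · rw [pathCost, pairWeight, if_neg hab]
          have h1 : (insert a (insert b F)).card ≤ F.card + 2 := by
            have h1 := Finset.card_insert_le a (insert b F)
            have h2 := Finset.card_insert_le b F
            omega
          have h2 : ((insert a (insert b F)).card : ℝ) ≤ F.card + 2 := by exact_mod_cast h1
          have := mul_le_mul_of_nonneg_right h2 (sq_nonneg (Real.log n))
          linarith
        · rcases hzip x y h with ⟨rfl, rfl⟩ | h
          · exact Or.inr ⟨by simp, by simp⟩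
          · exact (hxy x y h).imp id fun h => ⟨by simp [h.1], by simp [h.2]⟩

theorem zip_tail_of_append_left {α : Type*} {x y : α} (l₁ l : List α) (hx : x ∉ l₁)
    (h : (x, y) ∈ (l₁ ++ l).zip (l₁ ++ l).tail) : (x, y) ∈ l.zip l.tail := by
  induction l₁ with
  | nil => exact h
  | cons a l₁ ih =>
    simp only [List.mem_cons, not_or] at hx
    refine ih hx.2 ?_
    simp only [List.cons_append, List.tail_cons] at h
    cases hl : l₁ ++ l with
    | nil => rw [hl] at h; simp at h
    | cons b r =>
      rw [hl, List.zip_cons_cons] at h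
      rcases List.mem_cons.1 h with h | h
      · exact absurd (Prod.mk.inj h).1 hx.1
      · exact h

theorem zip_tail_of_append_right {α : Type*} {x y : α} (l l₃ : List α) (hy : y ∉ l₃)
    (h : (x, y) ∈ (l ++ l₃).zip (l ++ l₃).tail) : (x, y) ∈ l.zip l.tail := by
  induction l with
  | nil => exact absurd (List.mem_of_mem_tail (List.of_mem_zip h).2) hy
  | cons a l ih =>
    cases l with
    | nil => exact absurd (List.of_mem_zip h).2 hy
    | cons b l =>
      simp only [List.cons_append, List.tail_cons, List.zip_cons_cons, List.mem_cons] at h ih ⊢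
      exact h.imp id ih

theorem exists_first {α : Type*} {P : α → Prop} {l : List α} (h : ∃ x ∈ l, P x) :
    ∃ l₁ a l₂, l = l₁ ++ a :: l₂ ∧ P a ∧ ∀ x ∈ l₁, ¬ P x := by
  induction l with
  | nil => simp at h
  | cons y l ih =>
    by_cases hy : P y
    · exact ⟨[], y, l, rfl, hy, by simp⟩
    · obtain ⟨l₁, a, l₂, rfl, ha, h1⟩ := ih (by
        obtain ⟨x, hx, hP⟩ := h
        rcases List.mem_cons.1 hx with rfl | hx
        · exact absurd hP hy
        · exact ⟨x, hx, hP⟩)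
      exact ⟨y :: l₁, a, l₂, rfl, ha, by simpa [hy] using h1⟩

theorem exists_first_last {α : Type*} {P : α → Prop} {l : List α} (h : ∃ x ∈ l, P x) :
    ∃ l₁ a l₂ m b l₃, l = l₁ ++ a :: l₂ ∧ a :: l₂ = m ++ b :: l₃ ∧ P a ∧ P b ∧
      (∀ x ∈ l₁, ¬ P x) ∧ ∀ x ∈ l₃, ¬ P x := by
  obtain ⟨l₁, a, l₂, h1, ha, hl₁⟩ := exists_first h
  obtain ⟨l₃, b, m, h2, hb, hl₃⟩ := exists_first (P := P) (l := (a :: l₂).reverse)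
    ⟨a, by simp, ha⟩
  refine ⟨l₁, a, l₂, m.reverse, b, l₃.reverse, h1, ?_, ha, hb, hl₁, by simpa using hl₃⟩
  rw [← List.reverse_reverse (a :: l₂), h2]
  simp

/-- The closed edges inside `U` of a modified geodesic are few if any two points of `U` are joined
by cheap paths. -/
theorem GstarIn.exists_finset {A U : Set (ZVec d)} {γ : List (ZVec d)} {C : ℝ}
    (hγ : GstarIn d n ω A γ) (hC0 : 0 ≤ C) (hU : ∀ a ∈ U, ∀ b ∈ U, CostLE n ω A C a b) :
    ∃ F : Finset (ZVec d), F.card * Real.log n ^ 2 ≤ 2 * C ∧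
      ∀ x ∈ U, ∀ y ∈ U, edgeMemPath d x y γ → EdgeOpen d ω x y ∨ x ∈ F ∧ y ∈ F := by
  obtain ⟨-, -, σ, ⟨hσ, hσA, hmin⟩, hopen⟩ := hγ
  by_cases hex : ∃ x ∈ σ, x ∈ U
  · obtain ⟨l₁, a, l₂, m, b, l₃, h1, h2, ha, hb, hl₁, hl₃⟩ := exists_first_last hex
    obtain ⟨F, hF, hxy⟩ := exists_closed_endpoints (n := n) (ω := ω) (m ++ [b])
    refine ⟨F, hF.trans ?_, fun x hx y hy hγ => ?_⟩
    · have hchain : (l₁ ++ a :: l₂).IsChain (Adj d) := h1 ▸ hσ.2.2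
      have hA : ∀ v ∈ l₁ ++ a :: l₂, v ∈ A := h1 ▸ hσA
      have hc2 := List.IsChain.right_of_append hchain
      have hbl : CostLE n ω A (pathCost d n ω (b :: l₃)) b ((b :: l₃).getLast (by simp)) := by
        have hs : b :: l₃ <:+ l₁ ++ a :: l₂ := by
          rw [h2, ← List.append_assoc]; exact List.suffix_append _ _
        refine ⟨b :: l₃, ⟨by simp, (h1 ▸ hσ.2.1 : (l₁ ++ a :: l₂).Nodup).sublist hs.sublist, ?_⟩,
          fun v hv => hA v (hs.subset hv), rfl, List.getLast?_eq_some_getLast _, le_rfl⟩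
        rw [h2] at hc2
        exact hc2.right_of_append
      have hpre : (l₁ ++ [a]) <+: l₁ ++ a :: l₂ := ⟨l₂, by simp⟩
      obtain ⟨π, p1, p2, p3, p4, p5⟩ := ((hU a ha b hb).trans hbl).prepend
        (l := l₁ ++ [a]) (hchain.prefix hpre) (fun v hv => hA v (hpre.subset hv))
        (a := (l₁ ++ [a]).head (by simp)) (List.head?_eq_some_head _) (by simp)
      have h3 := hmin π p1 p2 (by
        rw [p3, h1, ← List.head?_eq_some_head]
        cases l₁ <;> simp) (by
        rw [p4, h1, h2, ← List.getLast?_eq_some_getLast, List.getLast?_append_of_ne_nil _ (by simp),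
          List.getLast?_append_of_ne_nil _ (by simp)])
      rw [h1, pathCost_append, h2, pathCost_append m] at h3
      linarith
    · by_cases hm : edgeMemPath d x y σ
      · have key : ∀ x ∈ U, ∀ y ∈ U, (x, y) ∈ σ.zip σ.tail → EdgeOpen d ω x y ∨ x ∈ F ∧ y ∈ F := by
          intro x hx y hy h
          rw [h1] at h
          have h3 := zip_tail_of_append_left _ _ (fun h => hl₁ x h hx) h
          rw [h2, ← List.singleton_append, ← List.append_assoc] at h3
          exact hxy x y (zip_tail_of_append_right _ _ (fun h => hl₃ y h hy) h3)
        rcases hm with hm | hm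
        · exact key x hx y hy hm
        · exact (key y hy x hx hm).imp EdgeOpen.symm And.symm
      · exact Or.inl (hopen x y hγ hm)
  · push Not at hex
    refine ⟨∅, by simpa using hC0, fun x hx y hy hγ => Or.inl (hopen x y hγ ?_)⟩
    rintro (h | h)
    · exact hex x (List.of_mem_zip h).1 hx
    · exact hex y (List.of_mem_zip h).1 hy

theorem isChain_edgeMem (l : List (ZVec d)) : l.IsChain fun x y => edgeMemPath d x y l := by
  suffices h : ∀ l : List (ZVec d), l.IsChain fun x y => (x, y) ∈ l.zip l.tail from
    (h l).imp fun _ _ h => Or.inl h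
  intro l
  induction l with
  | nil => simp
  | cons a l ih =>
    cases l with
    | nil => simp
    | cons b l =>
      refine List.isChain_cons_cons.2 ⟨by simp, ih.imp fun x y h => ?_⟩
      simp only [List.tail_cons, List.zip_cons_cons, List.mem_cons] at h ⊢
      exact Or.inr h

theorem rtg_of_chain {α : Type*} {r : α → α → Prop} (hs : ∀ x y, r x y → r y x) {l : List α}
    (h : l.IsChain r) {x y : α} (hx : x ∈ l) (hy : y ∈ l) : Relation.ReflTransGen r x y := by
  induction l generalizing x y with
  | nil => simp at hx
  | cons a l ih =>
    have key : ∀ z ∈ a :: l, Relation.ReflTransGen r a z := by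
      intro z hz
      rcases List.mem_cons.1 hz with rfl | hz
      · exact .refl
      · cases l with
        | nil => simp at hz
        | cons b l =>
          exact .head (List.isChain_cons_cons.1 h).1 (ih h.tail (by simp) hz)
    exact (rtg_symm hs (key x hx)).trans (key y hy)

end

section

variable {d : ℕ}
variable {ω : Config d} {K h R t m n N : ℕ} {o : ZVec d} {ρ : ℝ}

/-! ### Deterministic consequences of good scales -/

/-- All scales between `D` and `R` are good around every point of `bx o t`. -/
def AllGood (K D R t : ℕ) (o : ZVec d) (ω : Config d) : Prop :=
  ∀ z ∈ bx o t, ∀ k, D ≤ k → k ≤ R → Good K ω z (k / K)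

theorem AllGood.mono {t' : ℕ} (hG : AllGood K (K * h) R t' o ω) (ht : t ≤ t') :
    AllGood K (K * h) R t o ω :=
  fun z hz => hG z (bx_mono (by simpa using ht) hz)

theorem hub_of_conn {x y : ZVec d} (h : Conn ω (bx o R) x y) (hy : y ∈ hub K o R ω) :
    x ∈ hub K o R ω := by
  obtain ⟨v, hv, hc⟩ := hy
  exact ⟨v, hv, h.trans hc⟩

theorem conn_of_hub (hG : Good K ω o (R / K)) {x y : ZVec d} (hx : x ∈ hub K o R ω)
    (hy : y ∈ hub K o R ω) : Conn ω (bx o R) x y := by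
  obtain ⟨v, hv, hxv⟩ := hx
  obtain ⟨v', hv', hyv⟩ := hy
  have h1 := (hG.link hv hv' (by simp; omega) (by omega)).mono
    (bx_mono (w := o) (t := R) (by simpa using Nat.mul_div_le R K))
  exact (hxv.trans h1).trans hyv.symm

theorem mem_hub_of_deep (hK : 4 ≤ K) (hh : 1 ≤ h) (hG : AllGood K (K * h) R R o ω) {y : ZVec d}
    (hy : dst y o + K * h ≤ R) (hs : Seed ω y h y) : y ∈ hub K o R ω := by
  have hKh : K ≤ K * h := Nat.le_mul_of_pos_right K hh
  obtain ⟨v, hv⟩ := (hG o (by simp) R (by omega) le_rfl).1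
  refine ⟨v, hv, conn_of_ray hK hKh hy ?_ (fun k hk hkR => hG _ ?_ k hk hkR) hv⟩
  · rwa [Nat.mul_div_cancel_left _ (by omega)]
  · have := dst_tow_add_le (t := K * h) (k - K * h) hy (by omega)
    simp only [Set.mem_ofPred_eq]
    omega

theorem exists_hub_near (hK : 4 ≤ K) (hh : 1 ≤ h) (hR : 2 * (K * h) ≤ R)
    (hG : AllGood K (K * h) R R o ω) {a : ZVec d} (ha : a ∈ bx o R) :
    ∃ b ∈ hub K o R ω, dst a b ≤ 2 * (K * h) := by
  have hKh : 4 * h ≤ K * h := Nat.mul_le_mul_right h hK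
  have h1 := dst_tow_add_le (t := 0) (K * h + 2 * h) (y := a) (o := o) (R := R) (by simpa using ha)
    (by omega)
  obtain ⟨y, b', hc, hr⟩ := (hG (tow o a (K * h + 2 * h)) (by simp only [Set.mem_ofPred_eq]; omega)
    (2 * (K * h)) (by omega) hR).1
  rw [show 2 * (K * h) = K * (2 * h) by ring, Nat.mul_div_cancel_left _ (by omega)] at hc hr
  have hyz : dst y (tow o a (K * h + 2 * h)) ≤ 2 * h := hc.mem_left
  have h2 := dst_triangle y (tow o a (K * h + 2 * h)) o
  have h3 := dst_triangle y (tow o a (K * h + 2 * h)) a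
  have h4 := dst_tow_le (o := o) (y := a) (K * h + 2 * h)
  refine ⟨y, mem_hub_of_deep hK hh hG (by omega)
    (Seed.of_conn hc (by rw [dst_comm]; omega)), by rw [dst_comm]; omega⟩

theorem exists_crossing (hK : 4 ≤ K) (hh : 1 ≤ h) (hm : 4 * (K * h) ≤ m)
    (hR : K * h ≤ R) (hG : AllGood K (K * h) R (R + h) o ω) {z : ZVec d}
    (hz : cube d m z ⊆ bx o R) (i : Fin d) :
    ∃ a b, Conn ω (cube d m z) a b ∧ a i = z i ∧ b i = z i + m ∧ a ∈ hub K o R ω := by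
  have hKh : 4 * h ≤ K * h := Nat.mul_le_mul_right h hK
  have hKhh : (K * h) / K = h := Nat.mul_div_cancel_left _ (by omega)
  have hlo : ∀ j, o j - R ≤ z j := fun j => by
    have := abs_le.1 (dst_le.1 (hz (fun j => ⟨le_rfl, by omega⟩ : z ∈ cube d m z)) j)
    omega
  have hhi : ∀ j, z j + m ≤ o j + R := fun j => by
    have := abs_le.1 (dst_le.1 (hz (fun j => ⟨by simp, le_rfl⟩ : (fun j => z j + m) ∈ cube d m z)) j)
    omega
  let c : ℕ → ZVec d := fun s j => if j = i then z i - h + s else z j + m / 2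
  have hci : ∀ s, c s i = z i - h + s := fun s => by simp [c]
  have hcj : ∀ s j, j ≠ i → c s j = z j + m / 2 := fun s j hj => by simp [c, hj]
  have hcbox : ∀ s ≤ m + 2 * h, c s ∈ bx o (R + h) := fun s hs => dst_le.2 fun j => by
    have h1 := hlo j
    have h2 := hhi j
    rw [abs_le]
    by_cases hj : j = i
    · subst hj
      rw [hci]
      constructor <;> push_cast <;> omega
    · rw [hcj s j hj]
      constructor <;> push_cast <;> omega
  have hgood : ∀ s ≤ m + 2 * h, Good K ω (c s) h := fun s hs => by
    have := hG (c s) (hcbox s hs) (K * h) le_rfl hR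
    rwa [hKhh] at this
  have hseed : ∀ s, ∃ a, s ≤ m + 2 * h → Seed ω (c s) h a := fun s => by
    by_cases hs : s ≤ m + 2 * h
    · obtain ⟨a, ha⟩ := (hgood s hs).1
      exact ⟨a, fun _ => ha⟩
    · exact ⟨o, fun h => absurd h hs⟩
  choose f hf using hseed
  have hfb : ∀ s ≤ m + 2 * h, dst (f s) (c s) ≤ h := fun s hs => by
    obtain ⟨b, hb, -⟩ := hf s hs
    exact hb.mem_left
  let S : Set (ZVec d) := {x | ∀ j, j ≠ i → |x j - (z j + m / 2)| ≤ (K * h : ℕ)}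
  have hbS : ∀ s, bx (c s) (K * h) ⊆ S := fun s x hx j hj => by
    have := dst_le.1 hx j
    rwa [hcj s j hj] at this
  have hcc : ∀ s, dst (c s) (c (s + 1)) ≤ 1 := fun s => dst_le.2 fun j => by
    rw [abs_le]
    by_cases hj : j = i
    · subst hj
      rw [hci, hci]
      constructor <;> push_cast <;> omega
    · rw [hcj s j hj, hcj _ j hj]
      constructor <;> push_cast <;> omega
  have hconn := conn_chain (ω := ω) (S := S) f (m + 2 * h)
    (hbS 0 (bx_mono (by simp; omega) (hfb 0 (by omega)))) fun s hs =>
      ((hgood (s + 1) hs).link (hf s hs.le) (hf (s + 1) hs) (by have := hcc s; omega)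
        (by omega)).mono (hbS _)
  have h0 := abs_le.1 (dst_le.1 (hfb 0 (by omega)) i)
  have hl := abs_le.1 (dst_le.1 (hfb (m + 2 * h) le_rfl) i)
  rw [hci] at h0 hl
  obtain ⟨a, b, hab, hai, hbi, -⟩ := hconn.cut (i := i) (α := z i) (β := z i + m) (by omega)
    (by push_cast at h0; omega) (by push_cast at hl; omega)
  have hSc : S ∩ {x | z i ≤ x i ∧ x i ≤ z i + m} ⊆ cube d m z := by
    rintro x ⟨h1, h2⟩ j
    by_cases hj : j = i
    · subst hj; exact h2
    · have := abs_le.1 (h1 j hj)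
      constructor <;> omega
  obtain ⟨y, hay, hyi⟩ := hab.cut_le (i := i) (β := z i + m / 2) (by omega) (by omega)
  have hay' : Conn ω (bx o R) a y := hay.mono (Set.inter_subset_left.trans (hSc.trans hz))
  refine ⟨a, b, hab.mono hSc, hai, hbi, hub_of_conn hay' (mem_hub_of_deep hK hh
    (hG.mono (by omega)) ?_ ?_)⟩
  · suffices dst y o ≤ R - K * h by omega
    refine dst_le.2 fun j => ?_
    have h1 := hlo j
    have h2 := hhi j
    rw [abs_le]
    by_cases hj : j = i
    · subst hj
      rw [hyi]
      constructor <;> omega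
    · have := abs_le.1 (hay.mem_right.1.1 j hj)
      constructor <;> omega
  · refine Seed.of_conn hay'.symm ?_
    have h1 := coord_le_dst a y i
    have h2 := abs_le.1 h1
    omega

theorem chemDistIn_eq {A : Set (ZVec d)} {x y : ZVec d} (h : Conn ω Set.univ x y)
    (hA : bx x (chemDist d ω x y).toNat ⊆ A) : chemDistIn d ω A x y = chemDist d ω x y := by
  refine le_antisymm ?_ ?_
  · obtain ⟨γ, h1, h2, -, h4, h5, h6⟩ := chemDistIn_attained (chemDist_ne_top.2 h)
    have h7 : (chemDist d ω x y).toNat = γ.length - 1 := by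
      rw [chemDist, ← h6, ENat.toNat_natCast]
    rw [h7] at hA
    exact sInf_le ⟨γ, h1, h2, fun v hv => hA (dst_le_length h1.2.2 h4 v hv), h4, h5, h6⟩
  · refine sInf_le_sInf ?_
    rintro k ⟨γ, h1, h2, -, h4⟩
    exact ⟨γ, h1, h2, fun _ _ => trivial, h4⟩

theorem chemLE_of_conn {x y : ZVec d} {r : ℝ} (h : Conn ω Set.univ x y)
    (hr : ((chemDist d ω x y).toNat : ℝ) ≤ r) : chemLE (chemDist d ω x y) r :=
  ⟨_, (ENat.natCast_toNat (chemDist_ne_top.2 h)).symm, hr⟩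

theorem four_mul_nrho_le (hρ : 1 ≤ ρ) (N : ℕ) : 4 * ρ * (Nrho ρ N : ℝ) ≤ N / 4 := by
  have h1 : (Nrho ρ N : ℝ) ≤ N / (16 * ρ ^ 2) := Nat.floor_le (by positivity)
  calc 4 * ρ * (Nrho ρ N : ℝ) ≤ 4 * ρ * (N / (16 * ρ ^ 2)) := by gcongr
    _ = N / 4 / ρ := by field_simp; ring
    _ ≤ N / 4 := div_le_self (by positivity) hρ

theorem four_mul_lt {r : ℕ} (hρ : 1 ≤ ρ) (hr : (r : ℝ) < 4 * ρ * (Nrho ρ N : ℝ)) : 4 * r < N := by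
  have h1 := hr.trans_le (four_mul_nrho_le hρ N)
  have h2 : (4 : ℝ) * r < N := by linarith
  exact_mod_cast h2

/-- A point far from both boundary spheres is deep in the annulus. -/
theorem deep_of_far (hN : 1 ≤ N) {x : ZVec d} (h3 : dst x o ≤ 3 * N) (h1 : N < dst x o)
    (hb : ∀ b : ZVec d, dst b o = N ∨ dst b o = 3 * N → N ≤ 2 * dst x b) :
    3 * N ≤ 2 * dst x o ∧ 2 * dst x o ≤ 5 * N := by
  constructor
  · have ht := dst_tow_le (o := o) (y := x) (dst x o - N)
    have ht2 := dst_tow_add_le (t := 0) (dst x o - N) (y := x) (o := o) (R := dst x o) (by omega)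
      (by omega)
    have ht3 := dst_triangle x (tow o x (dst x o - N)) o
    rw [dst_comm x (tow o x (dst x o - N))] at ht3
    have := hb (tow o x (dst x o - N)) (Or.inl (by omega))
    rw [dst_comm x (tow o x (dst x o - N))] at this
    omega
  · obtain ⟨i, hi⟩ := exists_coord_dst (x := x) (y := o) (by omega)
    obtain ⟨s, hs, hsx⟩ : ∃ s : ℤ, |s| = 1 ∧ x i - o i = s * dst x o := by
      rcases abs_choice (x i - o i) with h | h
      · exact ⟨1, rfl, by omega⟩
      · exact ⟨-1, rfl, by omega⟩
    set b : ZVec d := Function.update x i (o i + s * (3 * N)) with hbd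
    have hbi : b i = o i + s * (3 * N) := by simp [hbd]
    have hbj : ∀ j, j ≠ i → b j = x j := fun j hj => by simp [hbd, hj]
    have hs' := (abs_eq zero_le_one).1 hs
    have hbo : dst b o = 3 * N := by
      apply le_antisymm
      · refine dst_le.2 fun j => ?_
        by_cases hj : j = i
        · subst hj
          rw [hbi, abs_le]
          rcases hs' with rfl | rfl <;> constructor <;> push_cast <;> omega
        · rw [hbj j hj]
          exact (coord_le_dst x o j).trans (by exact_mod_cast h3)
      · have h := coord_le_dst b o i
        rw [hbi, add_sub_cancel_left, abs_mul, hs, one_mul, abs_of_nonneg (by positivity)] at h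
        exact_mod_cast h
    have hxb : dst x b ≤ 3 * N - dst x o := dst_le.2 fun j => by
      by_cases hj : j = i
      · subst hj
        rw [hbi, abs_le]
        rcases hs' with rfl | rfl <;> constructor <;> omega
      · rw [hbj j hj]
        simp
    have := hb b (Or.inr hbo)
    omega

theorem isChain_and {α : Type*} {R S : α → α → Prop} :
    ∀ {l : List α}, l.IsChain R → l.IsChain S → l.IsChain fun x y => R x y ∧ S x y
  | [], _, _ => .nil
  | [_], _, _ => .singleton _
  | _ :: _ :: _, h1, h2 => by
    rw [List.isChain_cons_cons] at h1 h2 ⊢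
    exact ⟨⟨h1.1, h2.1⟩, isChain_and h1.2 h2.2⟩

theorem exists_mem_hub {A : Set (ZVec d)} {π : List (ZVec d)} {l f : ℕ} {τ : ℝ} (hK : 4 ≤ K)
    (hh : 1 ≤ h) (hR : 2 * (K * h) ≤ R) (hG : AllGood K (K * h) R R o ω) (hρ : 0 ≤ ρ)
    (hτ : ρ * (2 * R) ≤ τ) (hGM : GMev ρ τ o R ω)
    (hA : ∀ a ∈ bx o R, {y | (dst y a : ℝ) ≤ τ} ⊆ A) (hAR : bx o R ⊆ A)
    (hav : ¬ Avoids K o R l f ω) (hl : l ≤ m) (hn1 : 1 ≤ Real.log n ^ 2)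
    (hcount : 2 * (d * (4 * (K * h) : ℕ) * Real.log n ^ 2 + τ) ≤ f * Real.log n ^ 2)
    (hπ : ∀ u ∈ π, u ∈ bx o R) (hgs : GstarIn d n ω A π) (hdiam : DiamGE d π m) :
    ∃ u ∈ π, u ∈ hub K o R ω := by
  by_contra hcon
  push Not at hcon
  have hτ0 : 0 ≤ τ := le_trans (by positivity) hτ
  have hKh : K ≤ K * h := Nat.le_mul_of_pos_right K hh
  have hgo := hG o (by simp) R (by omega) le_rfl
  have hcost : ∀ a ∈ bx o R, ∀ b ∈ bx o R,
      CostLE n ω A (d * (4 * (K * h) : ℕ) * Real.log n ^ 2 + τ) a b := by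
    intro a ha b hb
    obtain ⟨a', ha', hda⟩ := exists_hub_near hK hh hR hG ha
    obtain ⟨b', hb', hdb⟩ := exists_hub_near hK hh hR hG hb
    have hc := conn_of_hub hgo ha' hb'
    have hcu : Conn ω Set.univ a' b' := hc.mono (Set.subset_univ _)
    have hca := hc.mem_left
    have hcb := hc.mem_right
    have hdd : ρ * dst a' b' ≤ τ := by
      refine le_trans ?_ hτ
      have h1 := dst_triangle a' o b'
      have h2 : dst a' b' ≤ 2 * R := by
        rw [dst_comm o] at h1
        simp only [Set.mem_ofPred_eq] at hca hcb
        omega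
      have h3 : (dst a' b' : ℝ) ≤ 2 * R := by exact_mod_cast h2
      gcongr
    have hlt := hGM a' b' hca hcb hdd hcu
    have h1 := costLE_of_dst (n := n) (ω := ω) hAR le_rfl hn1 ha hca
    have h2 := costLE_of_dst (n := n) (ω := ω) hAR le_rfl hn1 hcb hb
    have h3 : CostLE n ω A (chemDist d ω a' b').toNat a' b' := costLE_of_chemDist hcu fun y hy =>
      hA a' hca (by
        have : (dst y a' : ℝ) ≤ (chemDist d ω a' b').toNat := by exact_mod_cast hy
        exact this.trans hlt.le)
    refine ((h1.trans h3).trans h2).mono ?_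
    have h4 : (dst a a' : ℝ) + dst b' b ≤ (4 * (K * h) : ℕ) := by
      rw [dst_comm b']
      exact_mod_cast (by omega : dst a a' + dst b b' ≤ 4 * (K * h))
    have h5 : (d : ℝ) * (dst a a' + dst b' b) * Real.log n ^ 2 ≤
        d * (4 * (K * h) : ℕ) * Real.log n ^ 2 := by gcongr
    linarith
  obtain ⟨F, hF, hxy⟩ := hgs.exists_finset (by positivity) hcost
  have hFf : F.card ≤ f := by
    have h1 := le_of_mul_le_mul_right (hF.trans hcount) (by linarith)
    exact_mod_cast h1
  obtain ⟨i, x, hx, y, hy, hd⟩ := hdiam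
  refine hav ⟨x, hπ x hx, y, F, hFf, hl.trans ?_, rtg_of_chain (fun _ _ => StepF.symm)
    (l := π) ?_ hx hy⟩
  · have h1 := coord_le_dst x y i
    have h2 : (m : ℝ) ≤ dst x y := hd.trans (by exact_mod_cast h1)
    exact_mod_cast h2
  · have h1 := isChain_edgeMem π
    have h2 := hgs.1.2.2
    have key : ∀ x y, edgeMemPath d x y π → x ∈ π ∧ y ∈ π := by
      rintro x y (h | h)
      · exact ⟨(List.of_mem_zip h).1, List.mem_of_mem_tail (List.of_mem_zip h).2⟩
      · exact ⟨List.mem_of_mem_tail (List.of_mem_zip h).2, (List.of_mem_zip h).1⟩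
    refine (isChain_and h1 h2).imp fun x y ⟨hm, hadj⟩ => ?_
    obtain ⟨hx, hy⟩ := key x y hm
    exact ⟨hadj, ⟨hπ x hx, hcon x hx⟩, ⟨hπ y hy, hcon y hy⟩, hxy x (hπ x hx) y (hπ y hy) hm⟩

end

section

variable {d : ℕ}
variable {ω : Config d} {K h n N : ℕ} {ρ : ℝ}

/-! ### The good box -/

theorem goodBox_of {e : EdgeD d} {l f : ℕ} {Cstar : ℝ} (hρ : 1 ≤ ρ) (hC : 3 + 6 * ρ ≤ Cstar)
    (hK : 4 ≤ K) (hh : 1 ≤ h) (hm : 4 * (K * h) ≤ Nrho ρ N)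
    (hG : AllGood K (K * h) (3 * N) (4 * N) e.val.1 ω)
    (hg1 : GMev ρ (4 * ρ * Nrho ρ N) e.val.1 (3 * N) ω)
    (hg2 : GMev ρ (6 * ρ * N) e.val.1 (3 * N) ω)
    (hav : ¬ Avoids K e.val.1 (3 * N) l f ω) (hl : l ≤ Nrho ρ N) (hn1 : 1 ≤ Real.log n ^ 2)
    (hcount : 2 * (d * (4 * (K * h) : ℕ) * Real.log n ^ 2 + 6 * ρ * N) ≤ f * Real.log n ^ 2) :
    GoodBox d n ρ Cstar e N ω := by
  have hNr : 16 * Nrho ρ N ≤ N := by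
    have h1 := four_mul_nrho_le hρ N
    have h2 : (Nrho ρ N : ℝ) ≤ ρ * Nrho ρ N := le_mul_of_one_le_left (by positivity) hρ
    have h3 : (16 : ℝ) * Nrho ρ N ≤ N := by linarith
    exact_mod_cast h3
  have hKh : 4 * h ≤ K * h := Nat.mul_le_mul_right h hK
  have hN : 1 ≤ N := by omega
  have hGR : AllGood K (K * h) (3 * N) (3 * N) e.val.1 ω := hG.mono (by omega)
  have hgo := hGR e.val.1 (by simp) (3 * N) (by omega) le_rfl
  obtain ⟨v0, hv0, -⟩ := exists_hub_near hK hh (by omega) hGR (a := e.val.1) (by simp)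
  have hcl : ∀ u ∈ hub K e.val.1 (3 * N) ω, u ∈ clusterIn d ω (bx e.val.1 (3 * N)) v0 := fun u hu =>
    chemDistIn_ne_top.2 (conn_of_hub hgo hv0 hu)
  have hlin : ∀ x y, dst x e.val.1 ≤ 3 * N → dst y e.val.1 ≤ 3 * N → dst x y ≤ 2 * Nrho ρ N →
      chemDist d ω x y ≠ ⊤ → 4 * (chemDist d ω x y).toNat < N ∧
        chemLE (chemDist d ω x y) (4 * ρ * (Nrho ρ N : ℝ)) := by
    intro x y hx hy hxy hc
    have hcon := chemDist_ne_top.1 hc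
    have hd : ρ * dst x y ≤ 4 * ρ * Nrho ρ N := by
      have h1 : (dst x y : ℝ) ≤ 2 * Nrho ρ N := by exact_mod_cast hxy
      have h2 : ρ * dst x y ≤ ρ * (2 * Nrho ρ N) := by gcongr
      have h3 : 0 ≤ ρ * Nrho ρ N := by positivity
      linarith
    have hlt := hg1 x y hx hy hd hcon
    exact ⟨four_mul_lt hρ hlt, chemLE_of_conn hcon hlt.le⟩
  refine ⟨⟨v0, hv0.choose_spec.2.mem_left, fun z hz i => ?_, fun π _ hπ hgs hdiam => ?_⟩, ?_, ?_⟩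
  · obtain ⟨a, b, hab, hai, hbi, ha⟩ := exists_crossing hK hh hm (by omega)
      (hG.mono (t := 3 * N + h) (by omega)) hz i
    obtain ⟨γ, h1, h2, h3, h4, h5⟩ := hab.exists_path
    refine ⟨γ, h1, h2, fun u hu => ⟨hcl u ?_, h3 u hu⟩, ⟨a, List.mem_of_mem_head? h4, hai⟩,
      ⟨b, mem_of_getLast? h5, hbi⟩⟩
    exact hub_of_conn ((conn_of_list h2 h3 h4 u hu).symm.mono hz) ha
  · have hA : ∀ a ∈ bx e.val.1 (3 * N), {y | (dst y a : ℝ) ≤ 6 * ρ * N} ⊆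
        boxR d (Cstar * N) e.val.1 := by
      intro a ha y hy
      have h1 : (dst y e.val.1 : ℝ) ≤ dst y a + dst a e.val.1 := by
        exact_mod_cast dst_triangle y a e.val.1
      have h2 : (dst a e.val.1 : ℝ) ≤ 3 * N := by exact_mod_cast ha
      have h3 : (3 + 6 * ρ) * N ≤ Cstar * N := by gcongr
      have h4 : (dst y a : ℝ) ≤ 6 * ρ * N := hy
      change (dst y e.val.1 : ℝ) ≤ _
      linarith
    have hAR : bx e.val.1 (3 * N) ⊆ boxR d (Cstar * N) e.val.1 := by
      intro a ha
      have h2 : (dst a e.val.1 : ℝ) ≤ 3 * N := by exact_mod_cast ha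
      have h3 : 3 * (N : ℝ) ≤ Cstar * N := by gcongr; linarith
      exact h2.trans h3
    obtain ⟨u, hu, hh⟩ := exists_mem_hub hK hh (by omega) hGR (by linarith)
      (le_of_eq (by push_cast; ring)) hg2 hA hAR hav hl hn1 hcount hπ hgs hdiam
    exact ⟨u, hu, hcl u hh⟩
  · intro x y hx hy hxy hc
    obtain ⟨h1, h2⟩ := hlin x y hx hy hxy hc
    refine ⟨chemDistIn_eq (chemDist_ne_top.1 hc) (bx_mono ?_), h2⟩
    have : dst x e.val.1 ≤ 3 * N := hx
    omega
  · intro x y hx hy hb hxy hc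
    obtain ⟨h1, h2⟩ := hlin x y hx.1 hy.1 hxy hc
    refine ⟨chemDistIn_eq (chemDist_ne_top.1 hc) fun v hv => ?_, h2⟩
    have hd := deep_of_far hN hx.1 hx.2 fun b hbo => by
      have h3 : (N : ℝ) / 2 ≤ dst x b := (hb b hbo).1
      have h4 : (N : ℝ) ≤ 2 * dst x b := by linarith
      exact_mod_cast h4
    have h3 := dst_triangle v x e.val.1
    have h4 := dst_triangle x v e.val.1
    rw [dst_comm x v] at h4
    simp only [Set.mem_ofPred_eq] at hv
    change dst v e.val.1 ≤ 3 * N ∧ N < dst v e.val.1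
    omega

end

section

variable {d : ℕ}
variable {p ρ cs : ℝ} {μ : Measure (Config d)} {ω : Config d}

/-! ### The probability of a good box -/

theorem ExpSmall.comp_mul {f : ℕ → ℝ≥0∞} (hf : ExpSmall f) {K : ℕ} (hK : 1 ≤ K) :
    ExpSmall fun r => f (K * r) := by
  obtain ⟨C, c, hC, hc, hb⟩ := hf
  refine ⟨C, c, hC, hc, fun r => (hb _).trans ?_⟩
  have h1 : (r : ℝ) ≤ (K * r : ℕ) := by exact_mod_cast Nat.le_mul_of_pos_left r hK
  apply ENNReal.ofReal_le_ofReal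
  have h2 : -c * (K * r : ℕ) ≤ -c * r := by nlinarith
  gcongr

theorem measure_not_allGood_le {K : ℕ} {f : ℕ → ℝ≥0∞}
    (hG : ∀ z r, μ {ω | ¬ Good K ω z r} ≤ f r) (o : ZVec d) (D R t : ℕ) :
    μ {ω | ¬ AllGood K D R t o ω} ≤ ((2 * t + 1) ^ d : ℕ) * ∑' k, f ((D + k) / K) := by
  have hsub : {ω | ¬ AllGood K D R t o ω} ⊆
      ⋃ k ∈ Finset.Ico D (R + 1), {ω | ∃ z ∈ bxF o t, ¬ Good K ω z (k / K)} := by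
    intro ω hω
    simp only [AllGood, Set.mem_ofPred_eq] at hω
    push Not at hω
    obtain ⟨z, hz, k, h1, h2, h3⟩ := hω
    exact Set.mem_biUnion (x := k) (Finset.mem_coe.2 (Finset.mem_Ico.2 ⟨h1, by omega⟩))
      ⟨z, mem_bxF.2 hz, h3⟩
  refine (measure_mono hsub).trans ((measure_biUnion_finset_le _ _).trans ?_)
  calc _ ≤ ∑ k ∈ Finset.Ico D (R + 1), (((2 * t + 1) ^ d : ℕ) : ℝ≥0∞) * f (k / K) :=
        Finset.sum_le_sum fun k _ => measure_exists_not_good_le hG o t (k / K)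
    _ ≤ _ := by
      rw [← Finset.mul_sum, Finset.sum_Ico_eq_sum_range]
      gcongr
      exact ENNReal.sum_le_tsum _

theorem Setup.gmev_expSmall (H : Setup d p μ ρ cs) {a : ℝ} (ha : 0 < a) (b : ℝ) :
    ∃ g : ℕ → ℝ≥0∞, ExpSmall g ∧ ∀ (z : ZVec d) (N : ℕ) (τ : ℝ), a * N - b ≤ τ →
      μ {ω | ¬ GMev ρ τ z (3 * N) ω} ≤ g N := by
  obtain ⟨c, hc, h⟩ := H.gmev
  refine ⟨_, (expSmall_exp (C := c⁻¹ * Real.exp (c * b)) (c := c * a) (by positivity)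
    (by positivity)).poly 6 1 (2 * d), fun z N τ hτ => (h z (3 * N) τ).trans ?_⟩
  rw [show 2 * (3 * N) + 1 = 6 * N + 1 by ring]
  refine mul_le_mul' le_rfl (ENNReal.ofReal_le_ofReal ?_)
  rw [mul_assoc, ← Real.exp_add]
  have h2 : -c * τ ≤ c * b + -(c * a) * N := by nlinarith
  gcongr

theorem Setup.goodBox (H : Setup d p μ ρ cs) {Cstar : ℝ} (hC : 3 + 6 * ρ ≤ Cstar) :
    ∃ (L : ℝ) (g : ℕ → ℝ≥0∞), 0 < L ∧ ExpSmall g ∧ ∀ (n N : ℕ) (e : EdgeD d),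
      L ≤ Real.log n ^ 2 → μ {ω | ¬ GoodBox d n ρ Cstar e N ω} ≤ g N := by
  have := H.ber.1
  have hρ := H.gm.1
  have hd := H.hd
  obtain ⟨K, f, hK, -, hf, hG⟩ := H.not_good_expSmall
  set q := ⌈16 * ρ ^ 2⌉₊ with hq
  have hq0 : 0 < q := Nat.ceil_pos.2 (by positivity)
  have hqρ : 16 * ρ ^ 2 ≤ q := Nat.le_ceil _
  obtain ⟨Q', g, hQ', hg, hav⟩ := H.avoids hK hf hG hq0
  obtain ⟨g1, hg1, h1⟩ := H.gmev_expSmall (a := 1 / (4 * ρ)) (by positivity) (4 * ρ)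
  set Q := 24 * d * K * Q' * q with hQ
  have hQ0 : 0 < Q := by positivity
  have hQr : (Q : ℝ) = 24 * d * K * Q' * q := by rw [hQ]; push_cast; ring
  have hnr : ∀ N m : ℕ, m * q ≤ N → m ≤ Nrho ρ N := by
    intro N m hm
    have hm' : (m : ℝ) * q ≤ N := by exact_mod_cast hm
    refine Nat.le_floor ?_
    rw [le_div_iff₀ (by positivity)]
    refine le_trans ?_ hm'
    gcongr
  have hS : ExpSmall fun N => ((8 * N + 1) ^ d : ℕ) * ∑' k, f ((K * (N / Q) + k) / K) :=
    ((((hf.div K (by omega)).tail.comp_mul (by omega : 1 ≤ K)).div Q hQ0).poly 8 1 d)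
  have hQ'r : (0 : ℝ) < Q' := by exact_mod_cast hQ'
  refine ⟨36 * ρ * Q', fun N => ⨆ (n : ℕ) (e : EdgeD d) (_ : 36 * ρ * Q' ≤ Real.log n ^ 2),
    μ {ω | ¬ GoodBox d n ρ Cstar e N ω}, by positivity, ExpSmall.of_eventually
      (fun N => iSup_le fun n => iSup_le fun e => iSup_le fun _ => prob_le_one) Q
      (((hS.add hg1).add hg1).add hg) fun N hN => iSup_le fun n => iSup_le fun e => iSup_le fun hn => ?_,
    fun n N e hn => le_iSup_of_le n (le_iSup_of_le e (le_iSup_of_le hn le_rfl))⟩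
  have hdiv : ((N / Q : ℕ) : ℝ) * Q ≤ N := by exact_mod_cast Nat.div_mul_le_self N Q
  have hh : 1 ≤ N / Q := (Nat.one_le_div_iff hQ0).2 hN
  have hsub : {ω | ¬ GoodBox d n ρ Cstar e N ω} ⊆
      (({ω | ¬ AllGood K (K * (N / Q)) (3 * N) (4 * N) e.val.1 ω} ∪
        {ω | ¬ GMev ρ (4 * ρ * Nrho ρ N) e.val.1 (3 * N) ω}) ∪
        {ω | ¬ GMev ρ (6 * ρ * N) e.val.1 (3 * N) ω}) ∪
        {ω | Avoids K e.val.1 (3 * N) (N / q) (N / Q') ω} := by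
    intro ω hω
    by_contra hcon
    simp only [Set.mem_union, Set.mem_ofPred_eq, not_or, not_not] at hcon
    obtain ⟨⟨⟨e1, e2⟩, e3⟩, e4⟩ := hcon
    have hl1 : 1 ≤ Real.log n ^ 2 := by
      have h2 : (1 : ℝ) ≤ Q' := by exact_mod_cast hQ'
      nlinarith
    refine hω (goodBox_of hρ hC hK hh ?_ e1 e2 e3 e4 ?_ hl1 ?_)
    · have h4 : 4 * K * q ≤ Q := by
        rw [hQ]
        calc 4 * K * q = 4 * 1 * K * 1 * q := by ring
          _ ≤ 24 * d * K * Q' * q := by gcongr <;> omega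
      refine hnr _ _ (le_trans ?_ (Nat.div_mul_le_self N Q))
      calc 4 * (K * (N / Q)) * q = N / Q * (4 * K * q) := by ring
        _ ≤ _ := by gcongr
    · exact hnr _ _ (Nat.div_mul_le_self N q)
    · have h2 : (N : ℝ) < (N / Q' : ℕ) * Q' + Q' := by
        exact_mod_cast Nat.lt_div_mul_add hQ' (a := N)
      have h3 : 3 * (Q' : ℝ) ≤ N := by
        have : 3 * Q' ≤ Q := by
          rw [hQ]
          calc 3 * Q' = 3 * 1 * 1 * Q' * 1 := by ring
            _ ≤ 24 * d * K * Q' * q := by gcongr <;> omega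
        exact_mod_cast this.trans hN
      have h4 : 24 * (d * K * (N / Q : ℕ)) * (Q' : ℝ) ≤ N := by
        refine le_trans ?_ hdiv
        rw [hQr]
        have h5 : (1 : ℝ) ≤ q := by exact_mod_cast hq0
        calc _ = ((N / Q : ℕ) : ℝ) * (24 * d * K * Q' * 1) := by ring
          _ ≤ _ := by gcongr
      have h5 : 24 * (d * K * (N / Q : ℕ)) * (Q' : ℝ) * Real.log n ^ 2 ≤ N * Real.log n ^ 2 := by
        gcongr
      have h6 : 36 * ρ * Q' * N ≤ Real.log n ^ 2 * N := by gcongr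
      have h7 : 2 * (N : ℝ) * Real.log n ^ 2 ≤ 3 * ((N / Q' : ℕ) * Q') * Real.log n ^ 2 :=
        mul_le_mul_of_nonneg_right (by linarith) (by positivity)
      refine le_of_mul_le_mul_right ?_ (by positivity : (0 : ℝ) < 3 * Q')
      push_cast at h5 ⊢
      nlinarith
  refine (measure_mono hsub).trans ?_
  refine (measure_union_le _ _).trans (add_le_add ((measure_union_le _ _).trans (add_le_add
    ((measure_union_le _ _).trans (add_le_add ?_ (h1 _ _ _ ?_))) (h1 _ _ _ ?_))) (hav _ _))
  · have := measure_not_allGood_le hG e.val.1 (K * (N / Q)) (3 * N) (4 * N)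
    rwa [show 2 * (4 * N) + 1 = 8 * N + 1 by ring] at this
  · have h2 : (N : ℝ) / (16 * ρ ^ 2) < Nrho ρ N + 1 := Nat.lt_floor_add_one _
    have h3 : 1 / (4 * ρ) * (N : ℝ) = 4 * ρ * (N / (16 * ρ ^ 2)) := by field_simp; ring
    rw [h3]
    nlinarith
  · have h3 : 1 / (4 * ρ) ≤ 6 * ρ := by
      rw [div_le_iff₀ (by positivity)]
      nlinarith
    have h4 : 1 / (4 * ρ) * (N : ℝ) ≤ 6 * ρ * N := by gcongr
    linarith

theorem Setup.good_box_probability (H : Setup d p μ ρ cs) {Cstar : ℝ} (hC : 3 + 6 * ρ ≤ Cstar) :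
    ∃ c : ℝ, 0 < c ∧ ∀ n : ℕ, 2 ≤ n → ∀ e : EdgeD d, ∀ N : ℕ, 1 ≤ N →
      (N : ℝ) ≤ Real.exp (c * (Real.log n) ^ 2) →
      1 - ENNReal.ofReal (c⁻¹ * Real.exp (-c * N)) ≤ μ {ω | GoodBox d n ρ Cstar e N ω} := by
  have := H.ber.1
  obtain ⟨L, g, hL, ⟨C, c0, hC0, hc0, hb⟩, hg⟩ := H.goodBox hC
  set c := min c0 (min C⁻¹ (min L⁻¹ (1 / 6))) with hc
  have hcpos : 0 < c := by positivity
  have hcc0 : c ≤ c0 := min_le_left _ _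
  have hcC : c ≤ C⁻¹ := (min_le_right _ _).trans (min_le_left _ _)
  have hcL : c ≤ L⁻¹ := ((min_le_right _ _).trans (min_le_right _ _)).trans (min_le_left _ _)
  have hc6 : c ≤ 1 / 6 := ((min_le_right _ _).trans (min_le_right _ _)).trans (min_le_right _ _)
  refine ⟨c, hcpos, fun n _ e N _ hN => ?_⟩
  rw [tsub_le_iff_right]
  rcases le_or_gt L (Real.log n ^ 2) with hn | hn
  · have h1 : (1 : ℝ≥0∞) ≤ μ {ω | GoodBox d n ρ Cstar e N ω} +
        μ {ω | ¬ GoodBox d n ρ Cstar e N ω} := by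
      rw [← measure_univ (μ := μ)]
      refine le_trans (measure_mono fun ω _ => ?_) (measure_union_le _ _)
      exact em _
    refine h1.trans (add_le_add le_rfl ((hg n N e hn).trans ((hb N).trans ?_)))
    apply ENNReal.ofReal_le_ofReal
    have h2 : C ≤ c⁻¹ := by rwa [le_inv_comm₀ hC0 hcpos]
    gcongr
  · refine le_add_left ?_
    rw [← ENNReal.ofReal_one]
    apply ENNReal.ofReal_le_ofReal
    have h1 : c * Real.log n ^ 2 ≤ 1 := by
      calc c * Real.log n ^ 2 ≤ L⁻¹ * L := by gcongr
        _ = 1 := inv_mul_cancel₀ hL.ne'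
    have h2 : (N : ℝ) ≤ 3 := (hN.trans (Real.exp_le_exp.2 h1)).trans Real.exp_one_lt_three.le
    have h3 := Real.add_one_le_exp (-c * N)
    rw [inv_mul_eq_div, le_div_iff₀ hcpos]
    nlinarith

end

/-- Lemma 2.10: good-box probability.  There is `c > 0` such that for
every edge `e` and every integer `1 ≤ N ≤ exp(c log² n)`,
`P(Λ_{3N}(e) is good) ≥ 1 − c⁻¹ exp(−cN)`. -/
theorem good_box_probability
    (d : ℕ) (hd : 2 ≤ d) (p : ℝ) (hp : pc d < p) (hp1 : p < 1)
    (μ : Measure (Config d)) (hμ : IsBernoulli d p μ)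
    (ρ cs Cstar : ℝ) (hρ : GMprop d μ ρ) (hcs : CrossProp d μ cs)
    (hC : Cstar = 1 / cs + (100 * ρ ^ 2) ^ d) :
    ∃ c : ℝ, 0 < c ∧ ∀ n : ℕ, 2 ≤ n → ∀ e : EdgeD d, ∀ N : ℕ, 1 ≤ N →
      (N : ℝ) ≤ Real.exp (c * (Real.log n) ^ 2) →
      1 - ENNReal.ofReal (c⁻¹ * Real.exp (-c * N)) ≤ μ {ω | GoodBox d n ρ Cstar e N ω} := by
  have hp0 : 0 < p := lt_of_le_of_lt (Real.sSup_nonneg fun x hx => hx.1) hp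
  refine Setup.good_box_probability ⟨hd, hp0, hp1, hμ, hρ, hcs⟩ ?_
  have h1 := hρ.1
  have h2 : 0 < 1 / cs := one_div_pos.2 hcs.1
  have h3 : 100 * ρ ^ 2 ≤ (100 * ρ ^ 2) ^ d := le_self_pow₀ (by nlinarith) (by omega)
  rw [hC]
  nlinarith

end Perco
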